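/- Suppose T is Σ1-ill and n > m ≥ 1. Then there exists a Σ1 provability predicate PR_T(x) of T such that: (1) for any modal formula A and any arithmetical interpretation f based on PR_T(x), if N⁺A_{m,n} ⊢ A then T ⊢ f(A); and (2) there exists an arithmetical interpretation f based on PR_T(x) such that for every modal formula A, N⁺A_{m,n} ⊢ A if and only if T ⊢ f(A). -/

import Mathlib

namespace PLN

/-! ### Modal formulas and the logics N⁺A_{m,n} -/

/-- Formulas of modal propositional logic. -/
inductive MFml : Type
  | var : ℕ → MFml
  | bot : MFml
  | neg : MFml → MFml
  | and : MFml → MFml → MFml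
  | or : MFml → MFml → MFml
  | imp : MFml → MFml → MFml
  | box : MFml → MFml
  deriving DecidableEq

/-- `boxIter n A` is `□ⁿ A`, where `□⁰ A = A` and `□^(k+1) A = □ (□ᵏ A)`. -/
def boxIter : ℕ → MFml → MFml
  | 0, A => A
  | k + 1, A => .box (boxIter k A)

/-- Evaluation of a modal formula under a valuation of its "propositional atoms"
(propositional variables, and boxed formulas); used to define propositional tautologies
in the modal language. -/
def MFml.evalTC (v : MFml → Prop) : MFml → Prop
  | .bot => False
  | .neg A => ¬ A.evalTC v
  | .and A B => A.evalTC v ∧ B.evalTC v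
  | .or A B => A.evalTC v ∨ B.evalTC v
  | .imp A B => A.evalTC v → B.evalTC v
  | A => v A

/-- Propositional tautologies in the modal language. -/
def MTaut (A : MFml) : Prop := ∀ v, A.evalTC v

/-- Provability in the logic `N⁺A_{m,n}`: the pure logic of necessitation `N`
(propositional tautologies, modus ponens, necessitation) together with the axiom scheme
`□ⁿA → □ᵐA` and the rule `Ros□` (from `¬□A` infer `¬□□A`). -/
inductive NAProves (m n : ℕ) : MFml → Prop
  | taut {A} : MTaut A → NAProves m n A
  | acc (A) : NAProves m n (.imp (boxIter n A) (boxIter m A))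
  | mp {A B} : NAProves m n (.imp A B) → NAProves m n A → NAProves m n B
  | nec {A} : NAProves m n A → NAProves m n (.box A)
  | ros {A} : NAProves m n (.neg (.box A)) → NAProves m n (.neg (.box (.box A)))

/-- `IsSub B A` : `B` is a subformula of `A`. -/
inductive IsSub : MFml → MFml → Prop
  | refl (A) : IsSub A A
  | neg {B A} : IsSub B A → IsSub B (.neg A)
  | andL {B A C} : IsSub B A → IsSub B (.and A C)
  | andR {B A C} : IsSub B C → IsSub B (.and A C)
  | orL {B A C} : IsSub B A → IsSub B (.or A C)
  | orR {B A C} : IsSub B C → IsSub B (.or A C)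
  | impL {B A C} : IsSub B A → IsSub B (.imp A C)
  | impR {B A C} : IsSub B C → IsSub B (.imp A C)
  | box {B A} : IsSub B A → IsSub B (.box A)

/-! ### N-frames and N-models -/

/-- An N-model on a set `W` of worlds: an N-frame (a binary relation `≺_B` on `W`
for each modal formula `B`) together with a valuation of propositional variables. -/
structure NModel (W : Type) where
  rel : MFml → W → W → Prop
  val : W → ℕ → Prop

/-- The forcing relation of an N-model:
`x ⊩ □B` iff every `y` with `x ≺_B y` satisfies `y ⊩ B`. -/
def NModel.Forces {W : Type} (M : NModel W) : W → MFml → Prop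
  | x, .var p => M.val x p
  | _, .bot => False
  | x, .neg A => ¬ NModel.Forces M x A
  | x, .and A B => NModel.Forces M x A ∧ NModel.Forces M x B
  | x, .or A B => NModel.Forces M x A ∨ NModel.Forces M x B
  | x, .imp A B => NModel.Forces M x A → NModel.Forces M x B
  | x, .box A => ∀ y, M.rel A x y → NModel.Forces M y A

/-- The relations `≺_B^k` : `x ≺_B^0 y` iff `x = y`, and
`x ≺_B^(k+1) y` iff `∃ w, x ≺_{□ᵏB} w` and `w ≺_B^k y`. -/
def NModel.relIter {W : Type} (M : NModel W) (B : MFml) : ℕ → W → W → Prop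
  | 0, x, y => x = y
  | k + 1, x, y => ∃ w, M.rel (boxIter k B) x w ∧ NModel.relIter M B k w y

/-- `(m,n)`-accessibility of (the frame of) an N-model. -/
def NModel.Accessible {W : Type} (M : NModel W) (m n : ℕ) : Prop :=
  ∀ (B : MFml) (x y : W), NModel.relIter M B m x y → NModel.relIter M B n x y

/-! ### The language of first-order arithmetic -/

/-- Terms of the language of arithmetic, with de Bruijn variables. -/
inductive ATerm : Type
  | var : ℕ → ATerm
  | zero : ATerm
  | succ : ATerm → ATerm
  | add : ATerm → ATerm → ATerm
  | mul : ATerm → ATerm → ATerm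
  deriving DecidableEq

/-- Formulas of the language of arithmetic (with `≤` primitive), de Bruijn variables. -/
inductive AFml : Type
  | eq : ATerm → ATerm → AFml
  | le : ATerm → ATerm → AFml
  | neg : AFml → AFml
  | and : AFml → AFml → AFml
  | or : AFml → AFml → AFml
  | imp : AFml → AFml → AFml
  | all : AFml → AFml
  | ex : AFml → AFml
  deriving DecidableEq

/-- Lift (shift up by one) the variables `≥ c` of a term. -/
def ATerm.lift (c : ℕ) : ATerm → ATerm
  | .var n => .var (if n < c then n else n + 1)
  | .zero => .zero
  | .succ t => .succ (t.lift c)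
  | .add t s => .add (t.lift c) (s.lift c)
  | .mul t s => .mul (t.lift c) (s.lift c)

/-- Simultaneous substitution in terms. -/
def ATerm.substAll (σ : ℕ → ATerm) : ATerm → ATerm
  | .var n => σ n
  | .zero => .zero
  | .succ t => .succ (t.substAll σ)
  | .add t s => .add (t.substAll σ) (s.substAll σ)
  | .mul t s => .mul (t.substAll σ) (s.substAll σ)

/-- Pushing a substitution under a binder. -/
def liftSub (σ : ℕ → ATerm) : ℕ → ATerm
  | 0 => .var 0
  | n + 1 => (σ n).lift 0

/-- Lift (shift up by one) the free variables `≥ c` of a formula. -/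
def AFml.lift (c : ℕ) : AFml → AFml
  | .eq t s => .eq (t.lift c) (s.lift c)
  | .le t s => .le (t.lift c) (s.lift c)
  | .neg φ => .neg (φ.lift c)
  | .and φ ψ => .and (φ.lift c) (ψ.lift c)
  | .or φ ψ => .or (φ.lift c) (ψ.lift c)
  | .imp φ ψ => .imp (φ.lift c) (ψ.lift c)
  | .all φ => .all (φ.lift (c + 1))
  | .ex φ => .ex (φ.lift (c + 1))

/-- Simultaneous (capture-avoiding) substitution in formulas. -/
def AFml.substAll (σ : ℕ → ATerm) : AFml → AFml
  | .eq t s => .eq (t.substAll σ) (s.substAll σ)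
  | .le t s => .le (t.substAll σ) (s.substAll σ)
  | .neg φ => .neg (φ.substAll σ)
  | .and φ ψ => .and (φ.substAll σ) (ψ.substAll σ)
  | .or φ ψ => .or (φ.substAll σ) (ψ.substAll σ)
  | .imp φ ψ => .imp (φ.substAll σ) (ψ.substAll σ)
  | .all φ => .all (φ.substAll (liftSub σ))
  | .ex φ => .ex (φ.substAll (liftSub σ))

def subst0Env (t : ATerm) : ℕ → ATerm
  | 0 => t
  | n + 1 => .var n

def subst2Env (t s : ATerm) : ℕ → ATerm
  | 0 => t
  | 1 => s
  | n + 2 => .var n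

/-- Substitute the term `t` for the free variable `0` (decrementing other variables). -/
def AFml.subst0 (φ : AFml) (t : ATerm) : AFml := φ.substAll (subst0Env t)

/-- Substitute the terms `t`, `s` for the free variables `0`, `1` simultaneously. -/
def AFml.subst2 (φ : AFml) (t s : ATerm) : AFml := φ.substAll (subst2Env t s)

/-- Substitute `S(var 0)` for `var 0`, leaving all other free variables unchanged. -/
def succSubst (φ : AFml) : AFml :=
  φ.substAll fun n => if n = 0 then .succ (.var 0) else .var n

/-- All variables of a term are `< c`. -/
def ATerm.FreeLt (c : ℕ) : ATerm → Prop
  | .var n => n < c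
  | .zero => True
  | .succ t => t.FreeLt c
  | .add t s => t.FreeLt c ∧ s.FreeLt c
  | .mul t s => t.FreeLt c ∧ s.FreeLt c

/-- All free variables of a formula are `< c`; `FreeLt 0 φ` says that `φ` is a sentence. -/
def AFml.FreeLt (c : ℕ) : AFml → Prop
  | .eq t s => t.FreeLt c ∧ s.FreeLt c
  | .le t s => t.FreeLt c ∧ s.FreeLt c
  | .neg φ => φ.FreeLt c
  | .and φ ψ => φ.FreeLt c ∧ ψ.FreeLt c
  | .or φ ψ => φ.FreeLt c ∧ ψ.FreeLt c
  | .imp φ ψ => φ.FreeLt c ∧ ψ.FreeLt c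
  | .all φ => φ.FreeLt (c + 1)
  | .ex φ => φ.FreeLt (c + 1)

/-- The numeral `n̄`. -/
def numeral : ℕ → ATerm
  | 0 => .zero
  | n + 1 => .succ (numeral n)

/-- A Gödel numbering of terms. -/
def ATerm.code : ATerm → ℕ
  | .var n => Nat.pair 0 n
  | .zero => Nat.pair 1 0
  | .succ t => Nat.pair 2 t.code
  | .add t s => Nat.pair 3 (Nat.pair t.code s.code)
  | .mul t s => Nat.pair 4 (Nat.pair t.code s.code)

/-- A Gödel numbering of formulas. -/
def AFml.code : AFml → ℕ
  | .eq t s => Nat.pair 0 (Nat.pair t.code s.code)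
  | .le t s => Nat.pair 1 (Nat.pair t.code s.code)
  | .neg φ => Nat.pair 2 φ.code
  | .and φ ψ => Nat.pair 3 (Nat.pair φ.code ψ.code)
  | .or φ ψ => Nat.pair 4 (Nat.pair φ.code ψ.code)
  | .imp φ ψ => Nat.pair 5 (Nat.pair φ.code ψ.code)
  | .all φ => Nat.pair 6 φ.code
  | .ex φ => Nat.pair 7 φ.code

/-- `⌜φ⌝`, the numeral of the Gödel number of `φ`. -/
def gnum (φ : AFml) : ATerm := numeral φ.code

/-- For a formula `P(x)` (with free variable `var 0`), `P.appNum φ` is `P(⌜φ⌝)`. -/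
def AFml.appNum (P φ : AFml) : AFml := P.subst0 (gnum φ)

/-- Iterated application of a predicate: `iterPred P k φ = P(⌜P(⌜⋯P(⌜φ⌝)⋯⌝)⌝)` (`k` times). -/
def iterPred (P : AFml) : ℕ → AFml → AFml
  | 0, φ => φ
  | k + 1, φ => P.appNum (iterPred P k φ)

/-! ### Satisfaction in the standard model -/

def ATerm.val (ρ : ℕ → ℕ) : ATerm → ℕ
  | .var n => ρ n
  | .zero => 0
  | .succ t => t.val ρ + 1
  | .add t s => t.val ρ + s.val ρ
  | .mul t s => t.val ρ * s.val ρ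

def consEnv (a : ℕ) (ρ : ℕ → ℕ) : ℕ → ℕ
  | 0 => a
  | n + 1 => ρ n

/-- Satisfaction in the standard model `ℕ` under an environment `ρ`. -/
def AFml.Sat (ρ : ℕ → ℕ) : AFml → Prop
  | .eq t s => t.val ρ = s.val ρ
  | .le t s => t.val ρ ≤ s.val ρ
  | .neg φ => ¬ φ.Sat ρ
  | .and φ ψ => φ.Sat ρ ∧ ψ.Sat ρ
  | .or φ ψ => φ.Sat ρ ∨ ψ.Sat ρ
  | .imp φ ψ => φ.Sat ρ → ψ.Sat ρ
  | .all φ => ∀ a, φ.Sat (consEnv a ρ)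
  | .ex φ => ∃ a, φ.Sat (consEnv a ρ)

/-- `ℕ ⊨ φ`. -/
def TrueN (φ : AFml) : Prop := φ.Sat fun _ => 0

/-! ### The arithmetical hierarchy: Δ₀, Σ₁, Π₁ -/

/-- `Δ₀` formulas: every quantifier is bounded. -/
inductive IsDelta0 : AFml → Prop
  | eq (t s : ATerm) : IsDelta0 (.eq t s)
  | le (t s : ATerm) : IsDelta0 (.le t s)
  | neg {φ} : IsDelta0 φ → IsDelta0 (.neg φ)
  | and {φ ψ} : IsDelta0 φ → IsDelta0 ψ → IsDelta0 (.and φ ψ)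
  | or {φ ψ} : IsDelta0 φ → IsDelta0 ψ → IsDelta0 (.or φ ψ)
  | imp {φ ψ} : IsDelta0 φ → IsDelta0 ψ → IsDelta0 (.imp φ ψ)
  | ball {φ : AFml} (t : ATerm) : IsDelta0 φ → IsDelta0 (.all (.imp (.le (.var 0) (ATerm.lift 0 t)) φ))
  | bex {φ : AFml} (t : ATerm) : IsDelta0 φ → IsDelta0 (.ex (.and (.le (.var 0) (ATerm.lift 0 t)) φ))

mutual
  /-- `Σ₁` formulas. -/
  inductive IsSigma1 : AFml → Prop
    | delta0 {φ} : IsDelta0 φ → IsSigma1 φ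
    | and {φ ψ} : IsSigma1 φ → IsSigma1 ψ → IsSigma1 (.and φ ψ)
    | or {φ ψ} : IsSigma1 φ → IsSigma1 ψ → IsSigma1 (.or φ ψ)
    | ex {φ} : IsSigma1 φ → IsSigma1 (.ex φ)
    | negPi {φ} : IsPi1 φ → IsSigma1 (.neg φ)
    | impPiSigma {φ ψ} : IsPi1 φ → IsSigma1 ψ → IsSigma1 (.imp φ ψ)
  /-- `Π₁` formulas. -/
  inductive IsPi1 : AFml → Prop
    | delta0 {φ} : IsDelta0 φ → IsPi1 φ
    | and {φ ψ} : IsPi1 φ → IsPi1 ψ → IsPi1 (.and φ ψ)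
    | or {φ ψ} : IsPi1 φ → IsPi1 ψ → IsPi1 (.or φ ψ)
    | all {φ} : IsPi1 φ → IsPi1 (.all φ)
    | negSigma {φ} : IsSigma1 φ → IsPi1 (.neg φ)
    | impSigmaPi {φ ψ} : IsSigma1 φ → IsPi1 ψ → IsPi1 (.imp φ ψ)
end

/-! ### A Hilbert-style proof system for first-order arithmetic -/

/-- Evaluation of an arithmetical formula under a valuation of its "propositionally atomic"
subformulas (atomic or quantified formulas); used for propositional tautologies and
tautological consequence. -/
def AFml.evalProp (v : AFml → Prop) : AFml → Prop
  | .neg φ => ¬ φ.evalProp v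
  | .and φ ψ => φ.evalProp v ∧ ψ.evalProp v
  | .or φ ψ => φ.evalProp v ∨ ψ.evalProp v
  | .imp φ ψ => φ.evalProp v → ψ.evalProp v
  | φ => v φ

/-- Propositional tautologies in the language of arithmetic. -/
def ATaut (φ : AFml) : Prop := ∀ v, φ.evalProp v

/-- `φ` is a tautological consequence of the set `X` of formulas. -/
def TC (X : Set AFml) (φ : AFml) : Prop :=
  ∀ v : AFml → Prop, (∀ ψ ∈ X, ψ.evalProp v) → φ.evalProp v

def iffF (φ ψ : AFml) : AFml := .and (.imp φ ψ) (.imp ψ φ)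

/-- Hilbert-style provability from the set of axioms `Γ` in classical first-order
logic with equality. -/
inductive Proves (Γ : Set AFml) : AFml → Prop
  | ax {φ} : φ ∈ Γ → Proves Γ φ
  | taut {φ} : ATaut φ → Proves Γ φ
  | mp {φ ψ} : Proves Γ (.imp φ ψ) → Proves Γ φ → Proves Γ ψ
  | allE (φ : AFml) (t : ATerm) : Proves Γ (.imp (.all φ) (φ.subst0 t))
  | exI (φ : AFml) (t : ATerm) : Proves Γ (.imp (φ.subst0 t) (.ex φ))
  | allImp (φ ψ : AFml) : Proves Γ (.imp (.all (.imp φ ψ)) (.imp (.all φ) (.all ψ)))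
  | vacAll (φ : AFml) : Proves Γ (.imp φ (.all (AFml.lift 0 φ)))
  | exDef (φ : AFml) : Proves Γ (iffF (.ex φ) (.neg (.all (.neg φ))))
  | gen {φ} : Proves Γ φ → Proves Γ (.all φ)
  | eqRefl (t : ATerm) : Proves Γ (.eq t t)
  | eqSubst (φ : AFml) (t s : ATerm) : Proves Γ (.imp (.eq t s) (.imp (φ.subst0 t) (φ.subst0 s)))

/-! ### Peano arithmetic -/

/-- The axioms of Peano arithmetic. -/
inductive PAax : AFml → Prop
  | succNeZero : PAax (.all (.neg (.eq (.succ (.var 0)) .zero)))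
  | succInj :
      PAax (.all (.all (.imp (.eq (.succ (.var 1)) (.succ (.var 0))) (.eq (.var 1) (.var 0)))))
  | addZero : PAax (.all (.eq (.add (.var 0) .zero) (.var 0)))
  | addSucc :
      PAax (.all (.all (.eq (.add (.var 1) (.succ (.var 0))) (.succ (.add (.var 1) (.var 0))))))
  | mulZero : PAax (.all (.eq (.mul (.var 0) .zero) .zero))
  | mulSucc :
      PAax (.all (.all (.eq (.mul (.var 1) (.succ (.var 0)))
        (.add (.mul (.var 1) (.var 0)) (.var 1)))))
  | leDef :
      PAax (.all (.all (iffF (.le (.var 1) (.var 0))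
        (.ex (.eq (.add (.var 0) (.var 2)) (.var 1))))))
  | ind (φ : AFml) :
      PAax (.imp (.and (φ.subst0 .zero) (.all (.imp φ (succSubst φ)))) (.all φ))

/-- Peano arithmetic, as a set of axioms. -/
def PA : Set AFml := {φ | PAax φ}

/-- The sentence `0 = 1`. -/
def botFml : AFml := .eq .zero (.succ .zero)

/-- `t < s`, as the formula `S(t) ≤ s`. -/
def ltF (t s : ATerm) : AFml := .le (.succ t) s

/-- `Δ₁(PA)` formulas: `Σ₁` formulas which are `PA`-provably equivalent to a `Π₁` formula. -/
def IsDelta1PA (φ : AFml) : Prop :=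
  IsSigma1 φ ∧ ∃ ψ, IsPi1 ψ ∧ Proves PA (iffF φ ψ)

/-! ### Theories, provability predicates, arithmetical interpretations -/

/-- `Tax` is primitive recursively axiomatized (via the Gödel numbering). -/
def PrAxiomatized (Tax : Set AFml) : Prop :=
  ∃ p : ℕ → Bool, Primrec p ∧ ∀ φ : AFml, φ ∈ Tax ↔ p φ.code = true

/-- `Σ₁`-soundness: every `T`-provable `Σ₁` sentence is true in `ℕ`. -/
def Sigma1Sound (Tax : Set AFml) : Prop :=
  ∀ φ : AFml, IsSigma1 φ → φ.FreeLt 0 → Proves Tax φ → TrueN φ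

/-- `P` is a provability predicate of `T`: a formula `P(x)` with at most the free
variable `x` such that for every formula `φ`, `T ⊢ φ` iff `PA ⊢ P(⌜φ⌝)`. -/
def IsProvPred (Tax : Set AFml) (P : AFml) : Prop :=
  P.FreeLt 1 ∧ ∀ φ : AFml, Proves Tax φ ↔ Proves PA (P.appNum φ)

/-- `f` is an arithmetical interpretation based on the predicate `P`. -/
def IsInterp (P : AFml) (f : MFml → AFml) : Prop :=
  (∀ i, (f (.var i)).FreeLt 0) ∧
  f .bot = botFml ∧
  (∀ A, f (.neg A) = .neg (f A)) ∧
  (∀ A B, f (.and A B) = .and (f A) (f B)) ∧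
  (∀ A B, f (.or A B) = .or (f A) (f B)) ∧
  (∀ A B, f (.imp A B) = .imp (f A) (f B)) ∧
  (∀ A, f (.box A) = P.appNum (f A))

/-- The provability logic of the predicate `P` (relative to the theory `Tax`). -/
def PL (Tax : Set AFml) (P : AFml) : Set MFml :=
  {A | ∀ f : MFml → AFml, IsInterp P f → Proves Tax (f A)}

/-- The formulas with a `T`-proof of code `≤ s` (relative to a proof enumeration `prf`). -/
def PTset (prf : ℕ → Option AFml) (s : ℕ) : Set AFml :=
  {φ | ∃ y ≤ s, prf y = some φ}

section Part1

/-! ## Part 1: language and completeness -/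

theorem ATerm.substAll_var (t : ATerm) : t.substAll .var = t := by
  induction t <;> simp_all [ATerm.substAll]

theorem liftSub_var : liftSub .var = .var := by
  funext n; cases n <;> simp [liftSub, ATerm.lift]

theorem AFml.substAll_var (φ : AFml) : φ.substAll .var = φ := by
  induction φ <;> simp_all [AFml.substAll, ATerm.substAll_var, liftSub_var]

def liftRen (c : ℕ) : ℕ → ATerm := fun n => .var (if n < c then n else n + 1)

theorem liftSub_liftRen (c : ℕ) : liftSub (liftRen c) = liftRen (c + 1) := by
  funext n
  cases n with
  | zero => simp [liftSub, liftRen]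
  | succ n => simp only [liftSub, liftRen, ATerm.lift]; split_ifs <;> simp_all <;> omega

theorem ATerm.lift_eq (c : ℕ) (t : ATerm) : t.lift c = t.substAll (liftRen c) := by
  induction t <;> simp_all [ATerm.substAll, ATerm.lift, liftRen]

theorem AFml.lift_eq (c : ℕ) (φ : AFml) : φ.lift c = φ.substAll (liftRen c) := by
  induction φ generalizing c <;>
    simp_all [AFml.substAll, AFml.lift, ATerm.lift_eq, liftSub_liftRen]

theorem ATerm.substAll_substAll (σ τ : ℕ → ATerm) (t : ATerm) :
    (t.substAll σ).substAll τ = t.substAll (fun n => (σ n).substAll τ) := by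
  induction t <;> simp_all [ATerm.substAll]

theorem liftSub_comp (σ τ : ℕ → ATerm) :
    (fun n => (liftSub σ n).substAll (liftSub τ)) = liftSub (fun n => (σ n).substAll τ) := by
  funext n
  cases n with
  | zero => simp [liftSub, ATerm.substAll]
  | succ n =>
    simp only [liftSub, ATerm.lift_eq, ATerm.substAll_substAll]
    congr 1
    funext k
    simp [liftRen, ATerm.substAll, liftSub, ATerm.lift_eq]

theorem AFml.substAll_substAll (σ τ : ℕ → ATerm) (φ : AFml) :
    (φ.substAll σ).substAll τ = φ.substAll (fun n => (σ n).substAll τ) := by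
  induction φ generalizing σ τ <;>
    simp_all [AFml.substAll, ATerm.substAll_substAll, liftSub_comp]

theorem ATerm.substAll_congr {c : ℕ} {σ τ : ℕ → ATerm} (h : ∀ i < c, σ i = τ i) (t : ATerm)
    (ht : t.FreeLt c) : t.substAll σ = t.substAll τ := by
  induction t <;> simp_all [ATerm.substAll, ATerm.FreeLt]

theorem liftSub_congr {c : ℕ} {σ τ : ℕ → ATerm} (h : ∀ i < c, σ i = τ i) :
    ∀ i < c + 1, liftSub σ i = liftSub τ i := by
  intro i hi
  cases i with
  | zero => rfl
  | succ i => simp [liftSub, h i (by omega)]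

theorem AFml.substAll_congr {c : ℕ} {σ τ : ℕ → ATerm} (h : ∀ i < c, σ i = τ i) (φ : AFml)
    (hφ : φ.FreeLt c) : φ.substAll σ = φ.substAll τ := by
  induction φ generalizing σ τ c with
  | eq t s => simp [AFml.substAll, ATerm.substAll_congr h t hφ.1, ATerm.substAll_congr h s hφ.2]
  | le t s => simp [AFml.substAll, ATerm.substAll_congr h t hφ.1, ATerm.substAll_congr h s hφ.2]
  | neg φ ih => simp [AFml.substAll, ih h hφ]
  | and φ ψ ih1 ih2 => simp [AFml.substAll, ih1 h hφ.1, ih2 h hφ.2]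
  | or φ ψ ih1 ih2 => simp [AFml.substAll, ih1 h hφ.1, ih2 h hφ.2]
  | imp φ ψ ih1 ih2 => simp [AFml.substAll, ih1 h hφ.1, ih2 h hφ.2]
  | all φ ih => simp [AFml.substAll, ih (liftSub_congr h) hφ]
  | ex φ ih => simp [AFml.substAll, ih (liftSub_congr h) hφ]

theorem ATerm.FreeLt.mono {c d : ℕ} (h : c ≤ d) {t : ATerm} (ht : t.FreeLt c) : t.FreeLt d := by
  induction t <;> simp_all [ATerm.FreeLt]
  omega

theorem AFml.FreeLt.mono {c d : ℕ} (h : c ≤ d) {φ : AFml} (hφ : φ.FreeLt c) : φ.FreeLt d := by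
  induction φ generalizing c d with
  | eq t s => exact ⟨hφ.1.mono h, hφ.2.mono h⟩
  | le t s => exact ⟨hφ.1.mono h, hφ.2.mono h⟩
  | neg φ ih => exact ih h hφ
  | and φ ψ ih1 ih2 => exact ⟨ih1 h hφ.1, ih2 h hφ.2⟩
  | or φ ψ ih1 ih2 => exact ⟨ih1 h hφ.1, ih2 h hφ.2⟩
  | imp φ ψ ih1 ih2 => exact ⟨ih1 h hφ.1, ih2 h hφ.2⟩
  | all φ ih => exact ih (Nat.succ_le_succ h) hφ
  | ex φ ih => exact ih (Nat.succ_le_succ h) hφ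

theorem ATerm.freeLt_code (t : ATerm) : t.FreeLt (t.code + 1) := by
  induction t with
  | var n => simp [ATerm.FreeLt, ATerm.code, Nat.right_le_pair]
  | zero => trivial
  | succ t ih => exact ih.mono (by simp [ATerm.code, Nat.right_le_pair])
  | add t s ih1 ih2 =>
    have h1 := Nat.left_le_pair t.code s.code
    have h2 := Nat.right_le_pair t.code s.code
    have h3 := Nat.right_le_pair 3 (Nat.pair t.code s.code)
    exact ⟨ih1.mono (by simp [ATerm.code]; omega), ih2.mono (by simp [ATerm.code]; omega)⟩
  | mul t s ih1 ih2 =>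
    have h1 := Nat.left_le_pair t.code s.code
    have h2 := Nat.right_le_pair t.code s.code
    have h3 := Nat.right_le_pair 4 (Nat.pair t.code s.code)
    exact ⟨ih1.mono (by simp [ATerm.code]; omega), ih2.mono (by simp [ATerm.code]; omega)⟩

theorem pair2_le (k a b : ℕ) : a ≤ Nat.pair k (Nat.pair a b) ∧ b ≤ Nat.pair k (Nat.pair a b) := by
  have h1 := Nat.left_le_pair a b
  have h2 := Nat.right_le_pair a b
  have h3 := Nat.right_le_pair k (Nat.pair a b)
  omega

theorem AFml.freeLt_code (φ : AFml) : φ.FreeLt (φ.code + 1) := by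
  induction φ with
  | eq t s => exact ⟨t.freeLt_code.mono (Nat.succ_le_succ (pair2_le _ _ _).1),
      s.freeLt_code.mono (Nat.succ_le_succ (pair2_le _ _ _).2)⟩
  | le t s => exact ⟨t.freeLt_code.mono (Nat.succ_le_succ (pair2_le _ _ _).1),
      s.freeLt_code.mono (Nat.succ_le_succ (pair2_le _ _ _).2)⟩
  | neg φ ih => exact ih.mono (Nat.succ_le_succ (Nat.right_le_pair _ _))
  | and φ ψ ih1 ih2 => exact ⟨ih1.mono (Nat.succ_le_succ (pair2_le _ _ _).1),
      ih2.mono (Nat.succ_le_succ (pair2_le _ _ _).2)⟩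
  | or φ ψ ih1 ih2 => exact ⟨ih1.mono (Nat.succ_le_succ (pair2_le _ _ _).1),
      ih2.mono (Nat.succ_le_succ (pair2_le _ _ _).2)⟩
  | imp φ ψ ih1 ih2 => exact ⟨ih1.mono (Nat.succ_le_succ (pair2_le _ _ _).1),
      ih2.mono (Nat.succ_le_succ (pair2_le _ _ _).2)⟩
  | all φ ih =>
    exact AFml.FreeLt.mono (Nat.le_succ _) (ih.mono (Nat.succ_le_succ (Nat.right_le_pair 6 _)))
  | ex φ ih =>
    exact AFml.FreeLt.mono (Nat.le_succ _) (ih.mono (Nat.succ_le_succ (Nat.right_le_pair 7 _)))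

theorem ATerm.code_inj {t s : ATerm} (h : t.code = s.code) : t = s := by
  induction t generalizing s <;> cases s <;>
    simp [ATerm.code, Nat.pair_eq_pair] at h ⊢ <;> aesop

theorem AFml.code_inj {t s : AFml} (h : t.code = s.code) : t = s := by
  induction t generalizing s <;> cases s <;>
    simp [AFml.code, Nat.pair_eq_pair] at h ⊢ <;>
    first
      | exact ⟨ATerm.code_inj h.1, ATerm.code_inj h.2⟩
      | aesop

theorem ATerm.lift_subst0 (t s : ATerm) : (t.lift 0).substAll (subst0Env s) = t := by
  rw [ATerm.lift_eq, ATerm.substAll_substAll]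
  conv_rhs => rw [← ATerm.substAll_var t]
  congr 1

theorem AFml.lift_subst0 (t : AFml) (s) : (t.lift 0).subst0 s = t := by
  rw [AFml.lift_eq, AFml.subst0, AFml.substAll_substAll]
  conv_rhs => rw [← AFml.substAll_var t]
  congr 1

def consSub (t : ATerm) (σ : ℕ → ATerm) : ℕ → ATerm
  | 0 => t
  | n + 1 => σ n

theorem subst0_liftSub (φ : AFml) (σ : ℕ → ATerm) (t : ATerm) :
    (φ.substAll (liftSub σ)).subst0 t = φ.substAll (consSub t σ) := by
  rw [AFml.subst0, AFml.substAll_substAll]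
  congr 1
  funext n
  cases n with
  | zero => rfl
  | succ n => simp [liftSub, consSub, ATerm.lift_subst0]

/-! ### Derived rules -/
variable {Γ : Set AFml}

theorem Proves.tc1 {a b : AFml} (h : ATaut (.imp a b)) (ha : Proves Γ a) : Proves Γ b :=
  .mp (.taut h) ha
theorem Proves.tc2 {a b c : AFml} (h : ATaut (.imp a (.imp b c))) (ha : Proves Γ a)
    (hb : Proves Γ b) : Proves Γ c := .mp (.mp (.taut h) ha) hb
theorem Proves.tc3 {a b c d : AFml} (h : ATaut (.imp a (.imp b (.imp c d)))) (ha : Proves Γ a)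
    (hb : Proves Γ b) (hc : Proves Γ c) : Proves Γ d := .mp (.mp (.mp (.taut h) ha) hb) hc

def allN : ℕ → AFml → AFml
  | 0, φ => φ
  | k + 1, φ => allN k (.all φ)

theorem allN_freeLt (k : ℕ) (φ : AFml) (h : φ.FreeLt k) : (allN k φ).FreeLt 0 := by
  induction k generalizing φ with
  | zero => exact h
  | succ k ih => exact ih _ h

theorem Proves.allN (k : ℕ) {φ : AFml} (h : Proves Γ φ) : Proves Γ (allN k φ) := by
  induction k generalizing φ with
  | zero => exact h
  | succ k ih => exact ih h.gen

theorem AFml.substAll_closed {φ : AFml} (h : φ.FreeLt 0) (σ) : φ.substAll σ = φ := by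
  rw [AFml.substAll_congr (c := 0) (τ := .var) (by simp) φ h, AFml.substAll_var]

theorem Proves.substAll {φ : AFml} (h : Proves Γ φ) (σ : ℕ → ATerm) : Proves Γ (φ.substAll σ) := by
  have h1 : ∀ σ, Proves Γ ((PLN.allN (φ.code + 1) φ).substAll σ) := by
    intro σ
    rw [AFml.substAll_closed (allN_freeLt _ _ φ.freeLt_code)]
    exact h.allN _
  have h2 : ∀ k φ, (∀ σ, Proves Γ ((PLN.allN k φ).substAll σ)) → ∀ σ, Proves Γ (φ.substAll σ) := by
    intro k
    induction k with
    | zero => intro φ h; exact h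
    | succ k ih =>
      intro φ h σ
      have := ih (.all φ) h (fun n => σ (n + 1))
      have h3 := Proves.mp (.allE _ (σ 0)) this
      rw [subst0_liftSub] at h3
      convert h3 using 2
      funext n; cases n <;> rfl
  exact h2 _ _ h1 σ

theorem Proves.fresh {N : ℕ} {χ ψ : AFml} (hχ : χ.FreeLt N) (hψ : ψ.FreeLt (N + 1))
    (h : Proves Γ (.imp (ψ.subst0 (.var N)) χ)) : Proves Γ (.imp (.ex ψ) χ) := by
  have h1 := h.substAll (fun i => .var (if i < N then i + 1 else 0))
  have e1 : χ.substAll (fun i => .var (if i < N then i + 1 else 0)) = χ.lift 0 := by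
    rw [AFml.lift_eq]
    exact AFml.substAll_congr (c := N) (by intro i hi; simp [liftRen, hi]) _ hχ
  have e2 : (ψ.subst0 (.var N)).substAll (fun i => .var (if i < N then i + 1 else 0)) = ψ := by
    rw [AFml.subst0, AFml.substAll_substAll]
    conv_rhs => rw [← AFml.substAll_var ψ]
    refine AFml.substAll_congr (c := N + 1) ?_ _ hψ
    intro i hi
    cases i with
    | zero => simp [subst0Env, ATerm.substAll]
    | succ i => simp [subst0Env, ATerm.substAll]; omega
  simp only [AFml.substAll] at h1
  rw [e1, e2] at h1
  have h2 : Proves Γ (.imp (.neg (χ.lift 0)) (.neg ψ)) :=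
    h1.tc1 (by intro v; simp [AFml.evalProp]; tauto)
  have h3 := Proves.mp (.allImp _ _) h2.gen
  have h4 : Proves Γ (.imp (.neg χ) (.all (.neg (χ.lift 0)))) := Proves.vacAll (.neg χ)
  exact Proves.tc3 (by intro v; simp [AFml.evalProp, iffF]; tauto) h3 h4 (Proves.exDef ψ)

/-! ### Compactness for valuations -/
theorem ultra_exists (ι : Type) : ∃ F : Ultrafilter (Finset ι), ∀ i, ∀ᶠ s in (F : Filter (Finset ι)), i ∈ s := by
  classical
  refine ⟨Ultrafilter.of Filter.atTop, fun i => ?_⟩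
  have h : ∀ᶠ s in (Filter.atTop : Filter (Finset ι)), i ∈ s := by
    filter_upwards [Filter.eventually_ge_atTop ({i} : Finset ι)] with s hs
    exact hs (Finset.mem_singleton_self i)
  exact Ultrafilter.of_le Filter.atTop h

theorem compactA (X : Set AFml)
    (h : ∀ s : Finset AFml, ∃ v : AFml → Prop, ∀ ψ ∈ s, ψ ∈ X → ψ.evalProp v) :
    ∃ v : AFml → Prop, ∀ ψ ∈ X, ψ.evalProp v := by
  obtain ⟨F, hF⟩ := ultra_exists AFml
  choose v hv using h
  have key : ∀ ψ : AFml, ψ.evalProp (fun a => ∀ᶠ s in (F : Filter (Finset AFml)), v s a) ↔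
      ∀ᶠ s in (F : Filter (Finset AFml)), ψ.evalProp (v s) := by
    intro ψ
    induction ψ with
    | eq t s => simp [AFml.evalProp]
    | le t s => simp [AFml.evalProp]
    | all t _ => simp [AFml.evalProp]
    | ex t _ => simp [AFml.evalProp]
    | neg φ ih => simp only [AFml.evalProp, ih, Ultrafilter.eventually_not]
    | and φ ψ ih1 ih2 => simp [AFml.evalProp, ih1, ih2, Filter.eventually_and]
    | or φ ψ ih1 ih2 => simp [AFml.evalProp, ih1, ih2, Ultrafilter.eventually_or]
    | imp φ ψ ih1 ih2 => simp [AFml.evalProp, ih1, ih2, Ultrafilter.eventually_imp]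
  refine ⟨_, fun ψ hψ => (key ψ).2 ?_⟩
  filter_upwards [hF ψ] with s hs
  exact hv s ψ hs hψ

theorem compactM (X : Set MFml)
    (h : ∀ s : Finset MFml, ∃ v : MFml → Prop, ∀ ψ ∈ s, ψ ∈ X → ψ.evalTC v) :
    ∃ v : MFml → Prop, ∀ ψ ∈ X, ψ.evalTC v := by
  obtain ⟨F, hF⟩ := ultra_exists MFml
  choose v hv using h
  have key : ∀ ψ : MFml, ψ.evalTC (fun a => ∀ᶠ s in (F : Filter (Finset MFml)), v s a) ↔
      ∀ᶠ s in (F : Filter (Finset MFml)), ψ.evalTC (v s) := by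
    intro ψ
    induction ψ with
    | var i => simp [MFml.evalTC]
    | bot => simp [MFml.evalTC, F.neBot.ne]
    | box t _ => simp [MFml.evalTC]
    | neg φ ih => simp only [MFml.evalTC, ih, Ultrafilter.eventually_not]
    | and φ ψ ih1 ih2 => simp [MFml.evalTC, ih1, ih2, Filter.eventually_and]
    | or φ ψ ih1 ih2 => simp [MFml.evalTC, ih1, ih2, Ultrafilter.eventually_or]
    | imp φ ψ ih1 ih2 => simp [MFml.evalTC, ih1, ih2, Ultrafilter.eventually_imp]
  refine ⟨_, fun ψ hψ => (key ψ).2 ?_⟩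
  filter_upwards [hF ψ] with s hs
  exact hv s ψ hs hψ

/-! ### Structures -/
structure AStr (M : Type) where
  z : M
  s : M → M
  a : M → M → M
  m : M → M → M
  le : M → M → Prop

def ATerm.tv {M : Type} (S : AStr M) (ρ : ℕ → M) : ATerm → M
  | .var n => ρ n
  | .zero => S.z
  | .succ t => S.s (t.tv S ρ)
  | .add t s => S.a (t.tv S ρ) (s.tv S ρ)
  | .mul t s => S.m (t.tv S ρ) (s.tv S ρ)

def consM {M : Type} (a : M) (ρ : ℕ → M) : ℕ → M
  | 0 => a
  | n + 1 => ρ n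

def AFml.sat {M : Type} (S : AStr M) (ρ : ℕ → M) : AFml → Prop
  | .eq t s => t.tv S ρ = s.tv S ρ
  | .le t s => S.le (t.tv S ρ) (s.tv S ρ)
  | .neg φ => ¬ φ.sat S ρ
  | .and φ ψ => φ.sat S ρ ∧ ψ.sat S ρ
  | .or φ ψ => φ.sat S ρ ∨ ψ.sat S ρ
  | .imp φ ψ => φ.sat S ρ → ψ.sat S ρ
  | .all φ => ∀ a, φ.sat S (consM a ρ)
  | .ex φ => ∃ a, φ.sat S (consM a ρ)

variable {M : Type} (S : AStr M)

theorem ATerm.tv_subst (σ : ℕ → ATerm) (ρ : ℕ → M) (t : ATerm) :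
    (t.substAll σ).tv S ρ = t.tv S (fun n => (σ n).tv S ρ) := by
  induction t <;> simp_all [ATerm.substAll, ATerm.tv]

theorem ATerm.tv_lift0 (a : M) (ρ : ℕ → M) (t : ATerm) :
    (t.lift 0).tv S (consM a ρ) = t.tv S ρ := by
  rw [ATerm.lift_eq, ATerm.tv_subst]; rfl

theorem liftSub_tv (σ : ℕ → ATerm) (ρ : ℕ → M) (a : M) :
    (fun n => (liftSub σ n).tv S (consM a ρ)) = consM a (fun n => (σ n).tv S ρ) := by
  funext n
  cases n with
  | zero => rfl
  | succ n => simp [liftSub, ATerm.tv_lift0, consM]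

theorem AFml.sat_subst (σ : ℕ → ATerm) (ρ : ℕ → M) (φ : AFml) :
    (φ.substAll σ).sat S ρ ↔ φ.sat S (fun n => (σ n).tv S ρ) := by
  induction φ generalizing σ ρ <;>
    simp_all [AFml.substAll, AFml.sat, ATerm.tv_subst, liftSub_tv]

theorem AFml.sat_lift0 (a : M) (ρ : ℕ → M) (φ : AFml) :
    (φ.lift 0).sat S (consM a ρ) ↔ φ.sat S ρ := by
  rw [AFml.lift_eq, AFml.sat_subst]; rfl

theorem AFml.sat_subst0 (t : ATerm) (ρ : ℕ → M) (φ : AFml) :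
    (φ.subst0 t).sat S ρ ↔ φ.sat S (consM (t.tv S ρ) ρ) := by
  rw [AFml.subst0, AFml.sat_subst]
  have : (fun n => ATerm.tv S ρ (subst0Env t n)) = consM (t.tv S ρ) ρ := by
    funext n; cases n <;> rfl
  rw [this]

theorem AFml.evalProp_sat (ρ : ℕ → M) (φ : AFml) :
    φ.evalProp (fun ψ => ψ.sat S ρ) ↔ φ.sat S ρ := by
  induction φ <;> simp_all [AFml.sat, AFml.evalProp]

def Models (Γ : Set AFml) : Prop := ∀ φ ∈ Γ, ∀ ρ, φ.sat S ρ

theorem soundness {φ : AFml} (h : Proves Γ φ) (hS : Models S Γ) (ρ : ℕ → M) : φ.sat S ρ := by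
  induction h generalizing ρ with
  | ax h => exact hS _ h _
  | taut h => exact (AFml.evalProp_sat S ρ _).1 (h _)
  | mp _ _ ih1 ih2 => exact ih1 _ (ih2 _)
  | allE φ t => intro h; rw [AFml.sat_subst0]; exact h _
  | exI φ t => intro h; rw [AFml.sat_subst0] at h; exact ⟨_, h⟩
  | allImp φ ψ => intro h1 h2 a; exact h1 a (h2 a)
  | vacAll φ => intro h a; rw [AFml.sat_lift0]; exact h
  | exDef φ => simp [iffF, AFml.sat]
  | gen _ ih => intro a; exact ih _
  | eqRefl t => rfl
  | eqSubst φ t s => intro h1 h2; rw [AFml.sat_subst0] at h2 ⊢; simp only [AFml.sat] at h1; rwa [← h1]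

/-! ### Henkin -/
def hen (K : ℕ) (ψ : AFml) : AFml := .imp (.ex ψ) (ψ.subst0 (.var (ψ.code + 1 + K)))

open Classical in
noncomputable def henAt (K j : ℕ) : AFml :=
  if h : ∃ ψ : AFml, ψ.code = j then hen K h.choose else .imp botFml botFml

noncomputable def himps (K : ℕ) (φ : AFml) : ℕ → AFml
  | 0 => φ
  | k + 1 => .imp (henAt K k) (himps K φ k)

theorem henAt_code (K : ℕ) (ψ : AFml) : henAt K ψ.code = hen K ψ := by
  have h : ∃ ψ' : AFml, ψ'.code = ψ.code := ⟨ψ, rfl⟩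
  rw [henAt, dif_pos h, AFml.code_inj h.choose_spec]

theorem ATerm.freeLt_subst {c d : ℕ} {σ : ℕ → ATerm} (h : ∀ i < c, (σ i).FreeLt d) (t : ATerm)
    (ht : t.FreeLt c) : (t.substAll σ).FreeLt d := by
  induction t <;> simp_all [ATerm.substAll, ATerm.FreeLt]

theorem ATerm.freeLt_lift0 {c : ℕ} (t : ATerm) (h : t.FreeLt c) : (t.lift 0).FreeLt (c + 1) := by
  rw [ATerm.lift_eq]
  exact ATerm.freeLt_subst (c := c) (by intro i hi; simp [liftRen, ATerm.FreeLt]; omega) t h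

theorem liftSub_freeLt {c d : ℕ} {σ : ℕ → ATerm} (h : ∀ i < c, (σ i).FreeLt d) :
    ∀ i < c + 1, (liftSub σ i).FreeLt (d + 1) := by
  intro i hi
  cases i with
  | zero => simp [liftSub, ATerm.FreeLt]
  | succ i => exact ATerm.freeLt_lift0 _ (h i (by omega))

theorem AFml.freeLt_subst {c d : ℕ} {σ : ℕ → ATerm} (h : ∀ i < c, (σ i).FreeLt d) (φ : AFml)
    (hφ : φ.FreeLt c) : (φ.substAll σ).FreeLt d := by
  induction φ generalizing c d σ with
  | eq t s => exact ⟨ATerm.freeLt_subst h t hφ.1, ATerm.freeLt_subst h s hφ.2⟩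
  | le t s => exact ⟨ATerm.freeLt_subst h t hφ.1, ATerm.freeLt_subst h s hφ.2⟩
  | neg φ ih => exact ih h hφ
  | and φ ψ ih1 ih2 => exact ⟨ih1 h hφ.1, ih2 h hφ.2⟩
  | or φ ψ ih1 ih2 => exact ⟨ih1 h hφ.1, ih2 h hφ.2⟩
  | imp φ ψ ih1 ih2 => exact ⟨ih1 h hφ.1, ih2 h hφ.2⟩
  | all φ ih => exact ih (liftSub_freeLt h) hφ
  | ex φ ih => exact ih (liftSub_freeLt h) hφ

theorem AFml.freeLt_subst0 {c : ℕ} {t : ATerm} (ht : t.FreeLt c) {φ : AFml}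
    (hφ : φ.FreeLt (c + 1)) : (φ.subst0 t).FreeLt c := by
  refine AFml.freeLt_subst (c := c + 1) ?_ φ hφ
  intro i hi
  cases i with
  | zero => exact ht
  | succ i => simp [subst0Env, ATerm.FreeLt]; omega

theorem hen_freeLt (K : ℕ) (ψ : AFml) : (hen K ψ).FreeLt (ψ.code + 1 + K + 1) := by
  refine ⟨?_, ?_⟩
  · show ψ.FreeLt _
    exact ψ.freeLt_code.mono (by omega)
  · refine AFml.freeLt_subst0 ?_ (ψ.freeLt_code.mono (by omega))
    simp [ATerm.FreeLt]

theorem henAt_freeLt (K j : ℕ) : (henAt K j).FreeLt (j + 1 + K + 1) := by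
  unfold henAt
  split_ifs with h
  · have := hen_freeLt K h.choose
    rwa [h.choose_spec] at this
  · simp [AFml.FreeLt, botFml, ATerm.FreeLt]

theorem himps_freeLt {K : ℕ} {φ : AFml} (h : φ.FreeLt (K + 1)) (k : ℕ) :
    (himps K φ k).FreeLt (k + 1 + K) := by
  induction k with
  | zero => exact h.mono (by omega)
  | succ k ih => exact ⟨(henAt_freeLt K k).mono (by omega), ih.mono (by omega)⟩

theorem himps_elim {K : ℕ} {φ : AFml} (hφ : φ.FreeLt (K + 1)) (k : ℕ)
    (h : Proves Γ (himps K φ k)) : Proves Γ φ := by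
  induction k with
  | zero => exact h
  | succ k ih =>
    apply ih
    simp only [himps] at h
    by_cases hk : ∃ ψ : AFml, ψ.code = k
    · obtain ⟨ψ, rfl⟩ := hk
      rw [henAt_code] at h
      have h1 : Proves Γ (.imp (ψ.subst0 (.var (ψ.code + 1 + K))) (himps K φ ψ.code)) :=
        h.tc1 (by intro v; simp [AFml.evalProp, hen]; tauto)
      have h2 := Proves.fresh (himps_freeLt hφ ψ.code) (ψ.freeLt_code.mono (by omega)) h1
      exact Proves.tc2 (by intro v; simp [AFml.evalProp, hen]; tauto) h h2
    · rw [henAt, dif_neg hk] at h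
      exact h.tc1 (by intro v; simp [AFml.evalProp])

theorem himps_eval (K : ℕ) (φ : AFml) (k : ℕ) (v) :
    (himps K φ k).evalProp v ↔ ((∀ j < k, (henAt K j).evalProp v) → φ.evalProp v) := by
  induction k with
  | zero => simp [himps]
  | succ k ih =>
    simp only [himps, AFml.evalProp, ih]
    constructor
    · intro h h2; exact h (h2 k (by omega)) (fun j hj => h2 j (by omega))
    · intro h h1 h2; exact h (fun j hj => by
        rcases Nat.lt_succ_iff_lt_or_eq.1 hj with h | h
        · exact h2 j h
        · subst h; exact h1)

theorem prov_of_list (l : List AFml) (hl : ∀ ψ ∈ l, Proves Γ ψ) (φ : AFml)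
    (h : ∀ v, (∀ ψ ∈ l, ψ.evalProp v) → φ.evalProp v) : Proves Γ φ := by
  induction l generalizing φ with
  | nil => exact .taut (fun v => h v (by simp))
  | cons a l ih =>
    have := ih (fun ψ hψ => hl ψ (by simp [hψ])) (.imp a φ) (by
      intro v hv ha
      exact h v (by simpa using ⟨ha, hv⟩))
    exact .mp this (hl a (by simp))

theorem henkin_val {φ : AFml} (h : ¬ Proves Γ φ) :
    ∃ v : AFml → Prop, ∃ K, (∀ ψ, Proves Γ ψ → ψ.evalProp v) ∧ (∀ ψ, (hen K ψ).evalProp v) ∧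
      ¬ φ.evalProp v := by
  classical
  obtain ⟨v, hv⟩ := compactA
    ({ψ | Proves Γ ψ} ∪ {ψ | ∃ j, ψ = henAt φ.code j} ∪ {.neg φ}) (by
      intro s
      by_contra hcon
      push Not at hcon
      apply h
      have : ∃ k, ∀ ψ ∈ s, (∃ j, ψ = henAt φ.code j) → ∃ j < k, ψ = henAt φ.code j := by
        clear hcon
        induction s using Finset.induction_on with
        | empty => exact ⟨0, by simp⟩
        | insert a s _ ih =>
          obtain ⟨k, hk⟩ := ih
          by_cases ha : ∃ j, a = henAt φ.code j
          · obtain ⟨j, hj⟩ := ha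
            refine ⟨max k (j + 1), ?_⟩
            intro ψ hψ hh
            rcases Finset.mem_insert.1 hψ with rfl | h'
            · exact ⟨j, by omega, hj⟩
            · obtain ⟨i, hi, e⟩ := hk ψ h' hh
              exact ⟨i, by omega, e⟩
          · refine ⟨k, ?_⟩
            intro ψ hψ hh
            rcases Finset.mem_insert.1 hψ with rfl | h'
            · exact absurd hh ha
            · exact hk ψ h' hh
      obtain ⟨k, hk⟩ := this
      refine himps_elim (K := φ.code) (φ.freeLt_code) k ?_
      refine prov_of_list ((s.filter (fun ψ => Proves Γ ψ)).toList) ?_ _ ?_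
      · intro ψ hψ; simp at hψ; exact hψ.2
      · intro v hv
        rw [himps_eval]
        intro hhen
        by_contra hφ
        obtain ⟨ψ, hψs, hψX, hψ⟩ := hcon v
        apply hψ
        rcases hψX with (h1 | h1) | h1
        · exact hv ψ (by simp; exact ⟨hψs, h1⟩)
        · obtain ⟨j, hj, rfl⟩ := hk ψ hψs h1
          exact hhen j hj
        · rw [Set.mem_singleton_iff] at h1; subst h1; exact hφ)
  refine ⟨v, φ.code, fun ψ hψ => hv ψ (Or.inl (Or.inl hψ)), fun ψ => ?_, ?_⟩
  · rw [← henAt_code]; exact hv _ (Or.inl (Or.inr ⟨_, rfl⟩))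
  · exact hv (.neg φ) (Or.inr rfl)

section TermModel
variable (v : AFml → Prop)

theorem teq_subst (hv : ∀ ψ, Proves Γ ψ → ψ.evalProp v) (φ : AFml) {t s : ATerm}
    (h : v (.eq t s)) (h2 : (φ.subst0 t).evalProp v) : (φ.subst0 s).evalProp v :=
  hv _ (.eqSubst φ t s) h h2

theorem teq_refl (hv : ∀ ψ, Proves Γ ψ → ψ.evalProp v) (t : ATerm) : v (.eq t t) :=
  hv _ (.eqRefl t)

theorem teq_symm (hv : ∀ ψ, Proves Γ ψ → ψ.evalProp v) {t s : ATerm}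
    (h : v (.eq t s)) : v (.eq s t) := by
  have := teq_subst v hv (.eq (.var 0) (t.lift 0)) h
  simp only [AFml.subst0, AFml.substAll, ATerm.substAll, ATerm.lift_subst0, subst0Env,
    AFml.evalProp] at this
  exact this (teq_refl v hv t)

theorem teq_trans (hv : ∀ ψ, Proves Γ ψ → ψ.evalProp v) {t s r : ATerm}
    (h : v (.eq t s)) (h2 : v (.eq s r)) : v (.eq t r) := by
  have := teq_subst v hv (.eq (t.lift 0) (.var 0)) h2
  simp only [AFml.subst0, AFml.substAll, ATerm.substAll, ATerm.lift_subst0, subst0Env,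
    AFml.evalProp] at this
  exact this h

def tmSetoid (hv : ∀ ψ, Proves Γ ψ → ψ.evalProp v) : Setoid ATerm where
  r t s := v (.eq t s)
  iseqv := ⟨teq_refl v hv, teq_symm v hv, teq_trans v hv⟩

theorem teq_succ (hv : ∀ ψ, Proves Γ ψ → ψ.evalProp v) {t s : ATerm}
    (h : v (.eq t s)) : v (.eq (.succ t) (.succ s)) := by
  have := teq_subst v hv (.eq (.succ (t.lift 0)) (.succ (.var 0))) h
  simp only [AFml.subst0, AFml.substAll, ATerm.substAll, ATerm.lift_subst0, subst0Env,
    AFml.evalProp] at this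
  exact this (teq_refl v hv _)

theorem teq_add (hv : ∀ ψ, Proves Γ ψ → ψ.evalProp v) {t s t' s' : ATerm}
    (h : v (.eq t t')) (h2 : v (.eq s s')) : v (.eq (.add t s) (.add t' s')) := by
  have := teq_subst v hv (.eq (.add (t.lift 0) (s.lift 0)) (.add (.var 0) (s.lift 0))) h
  have h3 := teq_subst v hv (.eq (.add (t.lift 0) (s.lift 0)) (.add (t'.lift 0) (.var 0))) h2
  simp only [AFml.subst0, AFml.substAll, ATerm.substAll, ATerm.lift_subst0, subst0Env,
    AFml.evalProp] at this h3
  exact h3 (this (teq_refl v hv _))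

theorem teq_mul (hv : ∀ ψ, Proves Γ ψ → ψ.evalProp v) {t s t' s' : ATerm}
    (h : v (.eq t t')) (h2 : v (.eq s s')) : v (.eq (.mul t s) (.mul t' s')) := by
  have := teq_subst v hv (.eq (.mul (t.lift 0) (s.lift 0)) (.mul (.var 0) (s.lift 0))) h
  have h3 := teq_subst v hv (.eq (.mul (t.lift 0) (s.lift 0)) (.mul (t'.lift 0) (.var 0))) h2
  simp only [AFml.subst0, AFml.substAll, ATerm.substAll, ATerm.lift_subst0, subst0Env,
    AFml.evalProp] at this h3
  exact h3 (this (teq_refl v hv _))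

theorem teq_le (hv : ∀ ψ, Proves Γ ψ → ψ.evalProp v) {t s t' s' : ATerm}
    (h : v (.eq t t')) (h2 : v (.eq s s')) (h3 : v (.le t s)) : v (.le t' s') := by
  have h4 := teq_subst v hv (.le (.var 0) (s.lift 0)) h
  have h5 := teq_subst v hv (.le (t'.lift 0) (.var 0)) h2
  simp only [AFml.subst0, AFml.substAll, ATerm.substAll, ATerm.lift_subst0, subst0Env,
    AFml.evalProp] at h4 h5
  exact h5 (h4 h3)

def tmStr (hv : ∀ ψ, Proves Γ ψ → ψ.evalProp v) : AStr (Quotient (tmSetoid v hv)) where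
  z := Quotient.mk _ .zero
  s := Quotient.map .succ (fun _ _ h => teq_succ v hv h)
  a := Quotient.map₂ .add (fun _ _ h _ _ h2 => teq_add v hv h h2)
  m := Quotient.map₂ .mul (fun _ _ h _ _ h2 => teq_mul v hv h h2)
  le := Quotient.lift₂ (fun t s => v (.le t s)) (fun _ _ _ _ h1 h2 => propext
    ⟨teq_le v hv h1 h2, teq_le v hv (teq_symm v hv h1) (teq_symm v hv h2)⟩)

theorem tm_tv (hv : ∀ ψ, Proves Γ ψ → ψ.evalProp v) (σ : ℕ → ATerm) (t : ATerm) :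
    t.tv (tmStr v hv) (fun n => Quotient.mk _ (σ n)) = Quotient.mk _ (t.substAll σ) := by
  induction t with
  | var n => rfl
  | zero => rfl
  | succ t ih => simp only [ATerm.tv, ih]; rfl
  | add t s ih1 ih2 => simp only [ATerm.tv, ih1, ih2]; rfl
  | mul t s ih1 ih2 => simp only [ATerm.tv, ih1, ih2]; rfl

theorem tm_truth (hv : ∀ ψ, Proves Γ ψ → ψ.evalProp v) {K : ℕ} (hK : ∀ ψ, (hen K ψ).evalProp v)
    (φ : AFml) (σ : ℕ → ATerm) :
    φ.sat (tmStr v hv) (fun n => Quotient.mk _ (σ n)) ↔ (φ.substAll σ).evalProp v := by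
  have hcons : ∀ (t : ATerm) (σ : ℕ → ATerm),
      consM (Quotient.mk (tmSetoid v hv) t) (fun n => Quotient.mk _ (σ n)) =
        fun n => Quotient.mk _ (consSub t σ n) := by
    intro t σ; funext n; cases n <;> rfl
  induction φ generalizing σ with
  | eq t s => simp only [AFml.sat, tm_tv, AFml.substAll, AFml.evalProp]; exact Quotient.eq
  | le t s => simp only [AFml.sat, tm_tv, AFml.substAll, AFml.evalProp]; exact Iff.rfl
  | neg φ ih => simp [AFml.sat, AFml.substAll, AFml.evalProp, ih]
  | and φ ψ ih1 ih2 => simp [AFml.sat, AFml.substAll, AFml.evalProp, ih1, ih2]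
  | or φ ψ ih1 ih2 => simp [AFml.sat, AFml.substAll, AFml.evalProp, ih1, ih2]
  | imp φ ψ ih1 ih2 => simp [AFml.sat, AFml.substAll, AFml.evalProp, ih1, ih2]
  | ex φ ih =>
    constructor
    · rintro ⟨a, ha⟩
      obtain ⟨t, rfl⟩ := Quotient.exists_rep a
      rw [hcons] at ha
      have ha := (ih _).1 ha
      rw [← subst0_liftSub] at ha
      exact hv _ (.exI _ t) ha
    · intro h
      have := hK _ h
      rw [subst0_liftSub] at this
      have this := (ih _).2 this
      rw [← hcons] at this
      exact ⟨_, this⟩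
  | all φ ih =>
    constructor
    · intro h
      by_contra hc
      have h1 : Proves Γ (.imp (.neg (.all (φ.substAll (liftSub σ))))
          (.ex (.neg (φ.substAll (liftSub σ))))) := by
        have a1 : Proves Γ (.imp (.neg (.neg (φ.substAll (liftSub σ)))) (φ.substAll (liftSub σ))) :=
          .taut (by intro v; simp [AFml.evalProp])
        have a2 := Proves.mp (.allImp _ _) a1.gen
        exact Proves.tc2 (by intro v; simp [AFml.evalProp, iffF]; tauto) a2
          (Proves.exDef (.neg (φ.substAll (liftSub σ))))
      have h2 := hv _ h1 hc
      have h3 := hK _ h2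
      have h4 := h (Quotient.mk _ (.var ((AFml.neg (φ.substAll (liftSub σ))).code + 1 + K)))
      rw [hcons] at h4
      have h4 := (ih _).1 h4
      rw [← subst0_liftSub] at h4
      exact h3 h4
    · intro h a
      obtain ⟨t, rfl⟩ := Quotient.exists_rep a
      rw [hcons]
      refine (ih _).2 ?_
      rw [← subst0_liftSub]
      exact hv _ (.allE _ t) h

end TermModel

theorem completeness {φ : AFml}
    (h : ∀ (M : Type) (S : AStr M), Models S Γ → ∀ ρ, φ.sat S ρ) : Proves Γ φ := by
  by_contra hc
  obtain ⟨v, K, hv, hK, hφ⟩ := henkin_val hc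
  apply hφ
  have h1 := h _ (tmStr v hv) (by
    intro θ hθ ρ
    have : ρ = fun n => Quotient.mk _ ((ρ n).out) := by funext n; simp
    rw [this, tm_truth v hv hK]
    exact hv _ ((Proves.ax hθ).substAll _)) (fun n => Quotient.mk _ (.var n))
  rwa [tm_truth v hv hK, AFml.substAll_var] at h1


end Part1

section Part2

/-! ## Part 2: models of PA -/
section PAModels
variable {M : Type} {S : AStr M}

theorem pa_s_ne (hS : Models S PA) (x : M) : S.s x ≠ S.z := by
  have := hS _ PAax.succNeZero (fun _ => S.z)
  simpa [AFml.sat, ATerm.tv, consM] using this x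
theorem pa_s_inj (hS : Models S PA) {x y : M} (h : S.s x = S.s y) : x = y := by
  have := hS _ PAax.succInj (fun _ => S.z)
  simp only [AFml.sat, ATerm.tv, consM] at this
  exact this x y h
theorem pa_add_z (hS : Models S PA) (x : M) : S.a x S.z = x := by
  have := hS _ PAax.addZero (fun _ => S.z)
  simpa [AFml.sat, ATerm.tv, consM] using this x
theorem pa_add_s (hS : Models S PA) (x y : M) : S.a x (S.s y) = S.s (S.a x y) := by
  have := hS _ PAax.addSucc (fun _ => S.z)
  simpa [AFml.sat, ATerm.tv, consM] using this x y
theorem pa_mul_z (hS : Models S PA) (x : M) : S.m x S.z = S.z := by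
  have := hS _ PAax.mulZero (fun _ => S.z)
  simpa [AFml.sat, ATerm.tv, consM] using this x
theorem pa_mul_s (hS : Models S PA) (x y : M) : S.m x (S.s y) = S.a (S.m x y) x := by
  have := hS _ PAax.mulSucc (fun _ => S.z)
  simpa [AFml.sat, ATerm.tv, consM] using this x y
theorem pa_le (hS : Models S PA) (x y : M) : S.le x y ↔ ∃ c, S.a c x = y := by
  have := hS _ PAax.leDef (fun _ => S.z)
  simp only [AFml.sat, ATerm.tv, consM, iffF] at this
  exact ⟨(this x y).1, (this x y).2⟩

theorem pa_ind (hS : Models S PA) (φ : AFml) (ρ : ℕ → M) (h0 : φ.sat S (consM S.z ρ))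
    (h1 : ∀ a, φ.sat S (consM a ρ) → φ.sat S (consM (S.s a) ρ)) (a : M) :
    φ.sat S (consM a ρ) := by
  have := hS _ (PAax.ind φ) ρ
  simp only [AFml.sat] at this
  refine this ⟨?_, ?_⟩ a
  · rw [AFml.sat_subst0]; exact h0
  · intro a ha
    rw [succSubst, AFml.sat_subst]
    convert h1 a ha using 1
    funext n
    cases n <;> simp [ATerm.tv, consM]

theorem pa_zero_add (hS : Models S PA) (x : M) : S.a S.z x = x := by
  have := pa_ind hS (.eq (.add .zero (.var 0)) (.var 0)) (fun _ => S.z)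
    (by simp [AFml.sat, ATerm.tv, consM, pa_add_z hS])
    (by simp [AFml.sat, ATerm.tv, consM, pa_add_s hS]; intro a h; rw [h]) x
  simpa [AFml.sat, ATerm.tv, consM] using this

theorem pa_succ_add (hS : Models S PA) (x y : M) : S.a (S.s x) y = S.s (S.a x y) := by
  have := pa_ind hS (.eq (.add (.succ (.var 1)) (.var 0)) (.succ (.add (.var 1) (.var 0))))
    (fun _ => x)
    (by simp [AFml.sat, ATerm.tv, consM, pa_add_z hS])
    (by simp [AFml.sat, ATerm.tv, consM, pa_add_s hS]; intro a h; rw [h]) y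
  simpa [AFml.sat, ATerm.tv, consM] using this

theorem pa_add_assoc (hS : Models S PA) (x y w : M) : S.a (S.a x y) w = S.a x (S.a y w) := by
  have := pa_ind hS (.eq (.add (.add (.var 1) (.var 2)) (.var 0))
    (.add (.var 1) (.add (.var 2) (.var 0))))
    (fun i => if i = 0 then x else y)
    (by simp [AFml.sat, ATerm.tv, consM, pa_add_z hS])
    (by simp [AFml.sat, ATerm.tv, consM, pa_add_s hS]; intro a h; rw [h]) w
  simpa [AFml.sat, ATerm.tv, consM] using this

theorem pa_add_cancel (hS : Models S PA) (c x : M) (h : S.a c x = x) : c = S.z := by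
  have := pa_ind hS (.imp (.eq (.add (.var 1) (.var 0)) (.var 0)) (.eq (.var 1) .zero))
    (fun _ => c)
    (by simp [AFml.sat, ATerm.tv, consM, pa_add_z hS])
    (by simp [AFml.sat, ATerm.tv, consM, pa_add_s hS]; intro a h h2; exact h (pa_s_inj hS h2)) x
  simp [AFml.sat, ATerm.tv, consM] at this
  exact this h

theorem pa_cases (hS : Models S PA) (x : M) : x = S.z ∨ ∃ y, x = S.s y := by
  have := pa_ind hS (.or (.eq (.var 0) .zero) (.ex (.eq (.var 1) (.succ (.var 0)))))
    (fun _ => S.z)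
    (by simp [AFml.sat, ATerm.tv, consM])
    (by simp [AFml.sat, ATerm.tv, consM]) x
  simpa [AFml.sat, ATerm.tv, consM] using this

theorem pa_le_refl (hS : Models S PA) (x : M) : S.le x x :=
  (pa_le hS _ _).2 ⟨_, pa_zero_add hS x⟩
theorem pa_le_trans (hS : Models S PA) {x y w : M} (h1 : S.le x y) (h2 : S.le y w) : S.le x w := by
  rw [pa_le hS] at *
  obtain ⟨c, rfl⟩ := h1
  obtain ⟨d, rfl⟩ := h2
  exact ⟨S.a d c, pa_add_assoc hS _ _ _⟩
theorem pa_le_antisymm (hS : Models S PA) {x y : M} (h1 : S.le x y) (h2 : S.le y x) : x = y := by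
  rw [pa_le hS] at *
  obtain ⟨c, rfl⟩ := h1
  obtain ⟨d, hd⟩ := h2
  rw [← pa_add_assoc hS] at hd
  have := pa_add_cancel hS _ _ hd
  rcases pa_cases hS c with rfl | ⟨e, rfl⟩
  · rw [pa_zero_add hS]
  · rw [pa_add_s hS] at this; exact absurd this (pa_s_ne hS _)
theorem pa_z_le (hS : Models S PA) (x : M) : S.le S.z x := (pa_le hS _ _).2 ⟨x, pa_add_z hS x⟩
theorem pa_le_s (hS : Models S PA) (x : M) : S.le x (S.s x) :=
  (pa_le hS _ _).2 ⟨S.s S.z, by rw [pa_succ_add hS, pa_zero_add hS]⟩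
theorem pa_lt_of_ne (hS : Models S PA) {x y : M} (h : S.le x y) (hne : x ≠ y) :
    S.le (S.s x) y := by
  rw [pa_le hS] at *
  obtain ⟨c, rfl⟩ := h
  rcases pa_cases hS c with rfl | ⟨e, rfl⟩
  · rw [pa_zero_add hS] at hne; exact absurd rfl hne
  · exact ⟨e, by rw [pa_succ_add hS, pa_add_s hS]⟩
theorem pa_le_total (hS : Models S PA) (x y : M) : S.le x y ∨ S.le y x := by
  have := pa_ind hS (.or (.le (.var 0) (.var 1)) (.le (.var 1) (.var 0))) (fun _ => y)
    (by simp [AFml.sat, ATerm.tv, consM, pa_z_le hS])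
    (by
      simp only [AFml.sat, ATerm.tv, consM]
      rintro a (h | h)
      · by_cases e : a = y
        · subst e; exact Or.inr (pa_le_s hS a)
        · exact Or.inl (pa_lt_of_ne hS h e)
      · exact Or.inr (pa_le_trans hS h (pa_le_s hS a))) x
  simpa [AFml.sat, ATerm.tv, consM] using this
theorem pa_le_z (hS : Models S PA) {x : M} (h : S.le x S.z) : x = S.z :=
  pa_le_antisymm hS h (pa_z_le hS x)
theorem pa_s_le_s (hS : Models S PA) {x y : M} (h : S.le (S.s x) (S.s y)) : S.le x y := by
  rw [pa_le hS] at *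
  obtain ⟨c, hc⟩ := h
  rw [pa_add_s hS] at hc
  exact ⟨c, pa_s_inj hS hc⟩
theorem pa_le_succ (hS : Models S PA) {x y : M} (h : S.le x (S.s y)) : S.le x y ∨ x = S.s y := by
  by_cases e : x = S.s y
  · exact Or.inr e
  · exact Or.inl (pa_s_le_s hS (pa_lt_of_ne hS h e))
theorem pa_not_s_le (hS : Models S PA) {x : M} (h : S.le (S.s x) x) : False := by
  have := pa_le_antisymm hS (pa_le_s hS x) h
  have h2 : S.a (S.s S.z) x = x := by rw [pa_succ_add hS, pa_zero_add hS]; exact this.symm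
  exact pa_s_ne hS _ (pa_add_cancel hS _ _ h2)

/-! ### renaming -/
def AFml.ren (f : ℕ → ℕ) (φ : AFml) : AFml := φ.substAll (fun n => .var (f n))

theorem AFml.sat_ren (f : ℕ → ℕ) (φ : AFml) (ρ : ℕ → M) :
    (φ.ren f).sat S ρ ↔ φ.sat S (fun n => ρ (f n)) := by
  rw [AFml.ren, AFml.sat_subst]; rfl

/-- skip the variable number 1 -/
def skip1 : ℕ → ℕ
  | 0 => 0
  | n + 1 => n + 2
/-- skip the variable number 2 -/
def skip2 : ℕ → ℕ
  | 0 => 0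
  | 1 => 1
  | n + 2 => n + 3

theorem cons_skip1 (a b : M) (ρ : ℕ → M) : (fun n => consM a (consM b ρ) (skip1 n)) = consM a ρ := by
  funext n; cases n <;> rfl
theorem cons_skip2 (a b c : M) (ρ : ℕ → M) :
    (fun n => consM a (consM b (consM c ρ)) (skip2 n)) = consM a (consM b ρ) := by
  funext n
  rcases n with _ | _ | n <;> rfl

theorem pa_lnp (hS : Models S PA) (φ : AFml) (ρ : ℕ → M) (a : M) (h : φ.sat S (consM a ρ)) :
    ∃ b, φ.sat S (consM b ρ) ∧ ∀ c, φ.sat S (consM c ρ) → S.le b c := by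
  by_contra hc
  push Not at hc
  have key := pa_ind hS (.all (.imp (.le (.var 0) (.var 1)) (.neg (φ.ren skip1)))) ρ
  simp only [AFml.sat, ATerm.tv, AFml.sat_ren, cons_skip1] at key
  simp only [consM] at key
  refine key ?_ ?_ a a (pa_le_refl hS a) h
  · intro c hc0 hφ
    obtain rfl := pa_le_z hS hc0
    obtain ⟨d, _, hd⟩ := hc _ hφ
    exact hd (pa_z_le hS d)
  · intro b hb c hcb hφ
    rcases pa_le_succ hS hcb with h1 | rfl
    · exact hb c h1 hφ
    · obtain ⟨d, hd1, hd⟩ := hc _ hφ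
      rcases pa_le_total hS d (S.s b) with h2 | h2
      · rcases pa_le_succ hS h2 with h3 | rfl
        · exact hb d h3 hd1
        · exact hd h2
      · exact hd h2

/-! ### standard part -/
def iot (S : AStr M) : ℕ → M
  | 0 => S.z
  | n + 1 => S.s (iot S n)

theorem iot_add (hS : Models S PA) (a b : ℕ) : iot S (a + b) = S.a (iot S a) (iot S b) := by
  induction b with
  | zero => simp [iot, pa_add_z hS]
  | succ b ih => simp [iot, pa_add_s hS, ← ih, ← add_assoc]
theorem iot_mul (hS : Models S PA) (a b : ℕ) : iot S (a * b) = S.m (iot S a) (iot S b) := by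
  induction b with
  | zero => simp [iot, pa_mul_z hS]
  | succ b ih => simp [iot, pa_mul_s hS, ← ih, ← iot_add hS, Nat.mul_succ]
theorem iot_inj (hS : Models S PA) {a b : ℕ} (h : iot S a = iot S b) : a = b := by
  induction a generalizing b with
  | zero => cases b with
    | zero => rfl
    | succ b => exact absurd h.symm (pa_s_ne hS _)
  | succ a ih => cases b with
    | zero => exact absurd h (pa_s_ne hS _)
    | succ b => rw [ih (pa_s_inj hS h)]
theorem iot_le (hS : Models S PA) {a b : ℕ} (h : a ≤ b) : S.le (iot S a) (iot S b) := by
  obtain ⟨c, rfl⟩ := Nat.exists_eq_add_of_le' h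
  exact (pa_le hS _ _).2 ⟨iot S c, (iot_add hS _ _).symm⟩
theorem le_iot (hS : Models S PA) {x : M} {n : ℕ} (h : S.le x (iot S n)) :
    ∃ i ≤ n, x = iot S i := by
  induction n with
  | zero => exact ⟨0, le_refl _, pa_le_z hS h⟩
  | succ n ih =>
    rcases pa_le_succ hS h with h | h
    · obtain ⟨i, hi, e⟩ := ih h
      exact ⟨i, by omega, e⟩
    · exact ⟨n + 1, le_refl _, h⟩
theorem iot_le_iff (hS : Models S PA) {a b : ℕ} : S.le (iot S a) (iot S b) ↔ a ≤ b := by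
  refine ⟨fun h => ?_, iot_le hS⟩
  obtain ⟨i, hi, e⟩ := le_iot hS h
  rw [iot_inj hS e]; exact hi
theorem std_or (hS : Models S PA) (x : M) (n : ℕ) : (∃ i, x = iot S i) ∨ S.le (iot S n) x := by
  rcases pa_le_total hS x (iot S n) with h | h
  · obtain ⟨i, _, e⟩ := le_iot hS h; exact Or.inl ⟨i, e⟩
  · exact Or.inr h

theorem tv_iot (hS : Models S PA) (t : ATerm) (ρ : ℕ → ℕ) :
    t.tv S (fun n => iot S (ρ n)) = iot S (t.val ρ) := by
  induction t with
  | var n => rfl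
  | zero => rfl
  | succ t ih => simp [ATerm.tv, ATerm.val, ih, iot]
  | add t s ih1 ih2 => simp [ATerm.tv, ATerm.val, ih1, ih2, iot_add hS]
  | mul t s ih1 ih2 => simp [ATerm.tv, ATerm.val, ih1, ih2, iot_mul hS]

theorem consM_iot (a : ℕ) (ρ : ℕ → ℕ) :
    consM (iot S a) (fun n => iot S (ρ n)) = fun n => iot S (consEnv a ρ n) := by
  funext n; cases n <;> rfl

theorem val_lift0 (a : ℕ) (ρ : ℕ → ℕ) (t : ATerm) : (t.lift 0).val (consEnv a ρ) = t.val ρ := by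
  induction t <;> simp_all [ATerm.lift, ATerm.val, consEnv]

theorem delta0_abs (hS : Models S PA) {φ : AFml} (h : IsDelta0 φ) (ρ : ℕ → ℕ) :
    φ.sat S (fun n => iot S (ρ n)) ↔ φ.Sat ρ := by
  induction h generalizing ρ with
  | eq t s => simp only [AFml.sat, AFml.Sat, tv_iot hS]
              exact ⟨iot_inj hS, fun h => by rw [h]⟩
  | le t s => simp only [AFml.sat, AFml.Sat, tv_iot hS]; exact iot_le_iff hS
  | neg _ ih => simp [AFml.sat, AFml.Sat, ih]
  | and _ _ ih1 ih2 => simp [AFml.sat, AFml.Sat, ih1, ih2]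
  | or _ _ ih1 ih2 => simp [AFml.sat, AFml.Sat, ih1, ih2]
  | imp _ _ ih1 ih2 => simp [AFml.sat, AFml.Sat, ih1, ih2]
  | ball t _ ih =>
    simp only [AFml.sat, AFml.Sat, ATerm.tv_lift0, val_lift0, ATerm.tv, ATerm.val]
    rw [tv_iot hS]
    constructor
    · intro h a ha
      have := h (iot S a) (iot_le hS ha)
      rwa [consM_iot, ih] at this
    · intro h a ha
      obtain ⟨i, hi, rfl⟩ := le_iot hS ha
      rw [consM_iot, ih]
      exact h i hi
  | bex t _ ih =>
    simp only [AFml.sat, AFml.Sat, ATerm.tv_lift0, val_lift0, ATerm.tv, ATerm.val]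
    rw [tv_iot hS]
    constructor
    · rintro ⟨a, ha, h⟩
      obtain ⟨i, hi, rfl⟩ := le_iot hS ha
      rw [consM_iot, ih] at h
      exact ⟨i, hi, h⟩
    · rintro ⟨a, ha, h⟩
      refine ⟨iot S a, iot_le hS ha, ?_⟩
      rw [consM_iot, ih]; exact h

theorem tv_congr {c : ℕ} {ρ ρ' : ℕ → M} (h : ∀ i < c, ρ i = ρ' i) (t : ATerm)
    (ht : t.FreeLt c) : t.tv S ρ = t.tv S ρ' := by
  induction t <;> simp_all [ATerm.tv, ATerm.FreeLt]

theorem consM_congr {c : ℕ} {ρ ρ' : ℕ → M} (h : ∀ i < c, ρ i = ρ' i) (a : M) :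
    ∀ i < c + 1, consM a ρ i = consM a ρ' i := by
  intro i hi
  cases i with
  | zero => rfl
  | succ i => exact h i (by omega)

theorem sat_congr {c : ℕ} {ρ ρ' : ℕ → M} (h : ∀ i < c, ρ i = ρ' i) (φ : AFml)
    (hφ : φ.FreeLt c) : φ.sat S ρ ↔ φ.sat S ρ' := by
  induction φ generalizing ρ ρ' c with
  | eq t s => simp [AFml.sat, tv_congr h t hφ.1, tv_congr h s hφ.2]
  | le t s => simp [AFml.sat, tv_congr h t hφ.1, tv_congr h s hφ.2]
  | neg φ ih => simp [AFml.sat, ih h hφ]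
  | and φ ψ ih1 ih2 => simp [AFml.sat, ih1 h hφ.1, ih2 h hφ.2]
  | or φ ψ ih1 ih2 => simp [AFml.sat, ih1 h hφ.1, ih2 h hφ.2]
  | imp φ ψ ih1 ih2 => simp [AFml.sat, ih1 h hφ.1, ih2 h hφ.2]
  | all φ ih => exact forall_congr' fun a => ih (consM_congr h a) hφ
  | ex φ ih => exact exists_congr fun a => ih (consM_congr h a) hφ

end PAModels

/-! ### the standard model -/
def natStr : AStr ℕ := ⟨0, Nat.succ, (· + ·), (· * ·), (· ≤ ·)⟩

theorem nat_tv (ρ : ℕ → ℕ) (t : ATerm) : t.tv natStr ρ = t.val ρ := by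
  induction t <;> simp_all [ATerm.tv, ATerm.val, natStr]

theorem nat_cons (a : ℕ) (ρ : ℕ → ℕ) : consM a ρ = consEnv a ρ := by
  funext n; cases n <;> rfl

theorem nat_sat (ρ : ℕ → ℕ) (φ : AFml) : φ.sat natStr ρ ↔ φ.Sat ρ := by
  induction φ generalizing ρ <;> simp_all [AFml.sat, AFml.Sat, nat_tv, nat_cons]
  rfl

theorem nat_models : Models natStr PA := by
  intro φ hφ ρ
  cases hφ with
  | succNeZero => simp [AFml.sat, ATerm.tv, natStr]
  | succInj => simp [AFml.sat, ATerm.tv, natStr]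
  | addZero => simp [AFml.sat, ATerm.tv, natStr]
  | addSucc => intro x y; simp [ATerm.tv, natStr, AFml.sat]; omega
  | mulZero => simp [AFml.sat, ATerm.tv, natStr]
  | mulSucc => intro x y; simp [ATerm.tv, natStr, AFml.sat, Nat.mul_succ]
  | leDef =>
    intro x y
    simp only [ATerm.tv, natStr, AFml.sat, consM, iffF]
    exact ⟨fun h => ⟨y - x, by omega⟩, fun ⟨c, h⟩ => by omega⟩
  | ind φ =>
    rintro ⟨h0, h1⟩ a
    rw [AFml.sat_subst0] at h0
    induction a with
    | zero => exact h0
    | succ a ih =>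
      have := h1 a ih
      rw [succSubst, AFml.sat_subst] at this
      convert this using 1
      funext n
      cases n <;> simp [ATerm.tv, consM, natStr]

/-! ### Δ₀ under substitution -/
theorem lift_substAll (t : ATerm) (σ : ℕ → ATerm) :
    (t.lift 0).substAll (liftSub σ) = (t.substAll σ).lift 0 := by
  induction t <;> simp_all [ATerm.lift, ATerm.substAll, liftSub]

theorem IsDelta0.substAll {φ : AFml} (h : IsDelta0 φ) (σ : ℕ → ATerm) :
    IsDelta0 (φ.substAll σ) := by
  induction h generalizing σ with
  | eq t s => exact .eq _ _
  | le t s => exact .le _ _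
  | neg _ ih => exact .neg (ih σ)
  | and _ _ ih1 ih2 => exact .and (ih1 σ) (ih2 σ)
  | or _ _ ih1 ih2 => exact .or (ih1 σ) (ih2 σ)
  | imp _ _ ih1 ih2 => exact .imp (ih1 σ) (ih2 σ)
  | ball t _ ih =>
    simp only [AFml.substAll, lift_substAll, ATerm.substAll, liftSub]
    exact .ball _ (ih _)
  | bex t _ ih =>
    simp only [AFml.substAll, lift_substAll, ATerm.substAll, liftSub]
    exact .bex _ (ih _)

theorem IsDelta0.ren {φ : AFml} (h : IsDelta0 φ) (f : ℕ → ℕ) : IsDelta0 (φ.ren f) := h.substAll _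

theorem AFml.freeLt_ren {c d : ℕ} {f : ℕ → ℕ} (h : ∀ i < c, f i < d) (φ : AFml)
    (hφ : φ.FreeLt c) : (φ.ren f).FreeLt d := AFml.freeLt_subst (c := c) (by simpa [ATerm.FreeLt] using h) φ hφ

/-- bounded existential with a variable bound -/
def bexV (k : ℕ) (φ : AFml) : AFml := .ex (.and (.le (.var 0) (.var (k + 1))) φ)
def ballV (k : ℕ) (φ : AFml) : AFml := .all (.imp (.le (.var 0) (.var (k + 1))) φ)

theorem IsDelta0.bexV {φ : AFml} (h : IsDelta0 φ) (k : ℕ) : IsDelta0 (bexV k φ) :=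
  IsDelta0.bex (.var k) h
theorem IsDelta0.ballV {φ : AFml} (h : IsDelta0 φ) (k : ℕ) : IsDelta0 (ballV k φ) :=
  IsDelta0.ball (.var k) h

theorem sat_bexV {M : Type} {S : AStr M} (k : ℕ) (φ : AFml) (ρ : ℕ → M) :
    (bexV k φ).sat S ρ ↔ ∃ a, S.le a (ρ k) ∧ φ.sat S (consM a ρ) := Iff.rfl
theorem sat_ballV {M : Type} {S : AStr M} (k : ℕ) (φ : AFml) (ρ : ℕ → M) :
    (ballV k φ).sat S ρ ↔ ∀ a, S.le a (ρ k) → φ.sat S (consM a ρ) := Iff.rfl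
theorem freeLt_bexV {c k : ℕ} (hk : k < c) {φ : AFml} (h : φ.FreeLt (c + 1)) :
    (bexV k φ).FreeLt c := ⟨⟨Nat.succ_pos _, Nat.succ_lt_succ hk⟩, h⟩
theorem freeLt_ballV {c k : ℕ} (hk : k < c) {φ : AFml} (h : φ.FreeLt (c + 1)) :
    (ballV k φ).FreeLt c := ⟨⟨Nat.succ_pos _, Nat.succ_lt_succ hk⟩, h⟩

/-! ### Σ₁ normal form -/
def SigEq (φ : AFml) : Prop :=
  ∃ δ, IsDelta0 δ ∧ (∀ c, φ.FreeLt c → δ.FreeLt (c + 1)) ∧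
    ∀ (M : Type) (S : AStr M), Models S PA → ∀ ρ, φ.sat S ρ ↔ ∃ z, δ.sat S (consM z ρ)

theorem SigEq.congr {φ ψ : AFml} (h : SigEq φ) (h1 : ∀ c, ψ.FreeLt c → φ.FreeLt c)
    (h2 : ∀ (M : Type) (S : AStr M) (ρ : ℕ → M), ψ.sat S ρ ↔ φ.sat S ρ) : SigEq ψ := by
  obtain ⟨δ, a, b, c⟩ := h
  exact ⟨δ, a, fun c hc => b c (h1 c hc), fun M S hS ρ => (h2 M S ρ).trans (c M S hS ρ)⟩

theorem SigEq.delta0 {φ : AFml} (h : IsDelta0 φ) : SigEq φ := by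
  refine ⟨φ.ren Nat.succ, h.ren _, ?_, ?_⟩
  · intro c hc; exact AFml.freeLt_ren (c := c) (by intro i hi; simpa using hi) _ hc
  · intro M S hS ρ
    simp only [AFml.sat_ren]
    exact ⟨fun h => ⟨S.z, h⟩, fun ⟨_, h⟩ => h⟩

theorem SigEq.or {φ ψ : AFml} (h1 : SigEq φ) (h2 : SigEq ψ) : SigEq (.or φ ψ) := by
  obtain ⟨δ, a, b, c⟩ := h1
  obtain ⟨δ', a', b', c'⟩ := h2
  refine ⟨.or δ δ', .or a a', fun k hk => ⟨b k hk.1, b' k hk.2⟩, fun M S hS ρ => ?_⟩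
  simp only [AFml.sat, c M S hS, c' M S hS, exists_or]

theorem skip1_lt {c : ℕ} : ∀ i < c + 1, skip1 i < c + 2 := by
  intro i hi; cases i <;> simp [skip1]; omega
theorem skip2_lt {c : ℕ} : ∀ i < c + 2, skip2 i < c + 3 := by
  intro i hi; rcases i with _ | _ | i <;> simp [skip2]; omega

theorem SigEq.and {φ ψ : AFml} (h1 : SigEq φ) (h2 : SigEq ψ) : SigEq (.and φ ψ) := by
  obtain ⟨δ, a, b, c⟩ := h1
  obtain ⟨δ', a', b', c'⟩ := h2
  refine ⟨.and (bexV 0 (δ.ren skip1)) (bexV 0 (δ'.ren skip1)),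
    .and ((a.ren _).bexV _) ((a'.ren _).bexV _), fun k hk => ⟨?_, ?_⟩, fun M S hS ρ => ?_⟩
  · exact freeLt_bexV (by omega) (AFml.freeLt_ren skip1_lt _ (b k hk.1))
  · exact freeLt_bexV (by omega) (AFml.freeLt_ren skip1_lt _ (b' k hk.2))
  · simp only [AFml.sat, c M S hS, c' M S hS, sat_bexV, AFml.sat_ren, cons_skip1]
    simp only [consM]
    constructor
    · rintro ⟨⟨x, hx⟩, ⟨y, hy⟩⟩
      rcases pa_le_total hS x y with h | h
      · exact ⟨y, ⟨x, h, hx⟩, ⟨y, pa_le_refl hS y, hy⟩⟩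
      · exact ⟨x, ⟨x, pa_le_refl hS x, hx⟩, ⟨y, h, hy⟩⟩
    · rintro ⟨u, ⟨x, _, hx⟩, ⟨y, _, hy⟩⟩
      exact ⟨⟨x, hx⟩, ⟨y, hy⟩⟩

theorem SigEq.ex {φ : AFml} (h1 : SigEq φ) : SigEq (.ex φ) := by
  obtain ⟨δ, a, b, c⟩ := h1
  refine ⟨bexV 0 (bexV 1 (δ.ren skip2)), ((a.ren _).bexV _).bexV _, fun k hk => ?_,
    fun M S hS ρ => ?_⟩
  · exact freeLt_bexV (by omega) (freeLt_bexV (by omega)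
      (AFml.freeLt_ren skip2_lt _ (b (k + 1) hk)))
  · simp only [AFml.sat, c M S hS, sat_bexV, AFml.sat_ren, cons_skip2]
    simp only [consM]
    constructor
    · rintro ⟨x, y, h⟩
      rcases pa_le_total hS x y with h' | h'
      · exact ⟨y, x, h', y, pa_le_refl hS y, h⟩
      · exact ⟨x, x, pa_le_refl hS x, y, h', h⟩
    · rintro ⟨u, x, _, y, _, h⟩
      exact ⟨x, y, h⟩

theorem sigma1_eq {φ : AFml} (h : IsSigma1 φ) : SigEq φ := by
  refine IsSigma1.rec (motive_1 := fun φ _ => SigEq φ) (motive_2 := fun φ _ => SigEq (.neg φ))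
    ?_ ?_ ?_ ?_ ?_ ?_ ?_ ?_ ?_ ?_ ?_ ?_ h
  · intro φ h; exact .delta0 h
  · intro φ ψ _ _ h1 h2; exact h1.and h2
  · intro φ ψ _ _ h1 h2; exact h1.or h2
  · intro φ _ h; exact h.ex
  · intro φ _ h; exact h
  · intro φ ψ _ _ h1 h2
    exact (h1.or h2).congr (fun c h => h) (fun M S ρ => by simp only [AFml.sat]; tauto)
  · intro φ h; exact .delta0 (.neg h)
  · intro φ ψ _ _ h1 h2
    exact (h1.or h2).congr (fun c h => h) (fun M S ρ => by simp only [AFml.sat]; tauto)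
  · intro φ ψ _ _ h1 h2
    exact (h1.and h2).congr (fun c h => h) (fun M S ρ => by simp only [AFml.sat]; tauto)
  · intro φ _ h1
    exact h1.ex.congr (fun c h => h) (fun M S ρ => by simp only [AFml.sat]; push Not; rfl)
  · intro φ _ h1
    exact h1.congr (fun c h => h) (fun M S ρ => by simp only [AFml.sat]; tauto)
  · intro φ ψ _ _ h1 h2
    exact (h1.and h2).congr (fun c h => h) (fun M S ρ => by simp only [AFml.sat]; tauto)

/-- Σ₁-completeness -/
theorem sigma1_complete {φ : AFml} (h : IsSigma1 φ) (hφ : TrueN φ) (h0 : φ.FreeLt 0) :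
    Proves PA φ := by
  apply completeness
  intro M S hS ρ
  obtain ⟨δ, a, b, c⟩ := sigma1_eq h
  rw [sat_congr (c := 0) (ρ' := fun _ => iot S 0) (by simp) φ h0, c M S hS]
  have h1 := (nat_sat _ _).2 hφ
  rw [c _ _ nat_models] at h1
  obtain ⟨z, hz⟩ := h1
  rw [nat_sat, nat_cons, ← delta0_abs hS a, ← consM_iot] at hz
  exact ⟨_, hz⟩

theorem ill_delta {Tax : Set AFml} (hext : PA ⊆ Tax) (hill : ¬ Sigma1Sound Tax) :
    ∃ δ, IsDelta0 δ ∧ δ.FreeLt 1 ∧ (∀ (M : Type) (S : AStr M), Models S Tax → ∀ ρ,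
      ∃ z, δ.sat S (consM z ρ)) ∧ ∀ z ρ, ¬ δ.Sat (consEnv z ρ) := by
  simp only [Sigma1Sound] at hill
  push Not at hill
  obtain ⟨φ, hφ, h0, hp, hf⟩ := hill
  obtain ⟨δ, a, b, c⟩ := sigma1_eq hφ
  refine ⟨δ, a, b 0 h0, ?_, ?_⟩
  · intro M S hS ρ
    exact (c M S (fun ψ h => hS ψ (hext h)) ρ).1 (soundness S hp hS ρ)
  · intro z ρ h
    apply hf
    have h1 : φ.sat natStr ρ := (c _ _ nat_models ρ).2 ⟨z, by rwa [nat_cons, nat_sat]⟩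
    rw [sat_congr (c := 0) (ρ' := fun _ => 0) (by simp) φ h0, nat_sat] at h1
    exact h1


end Part2

section Part3

/-! ## Part 3: Σ₁ definability in ℕ of primitive recursive functions -/

theorem Sat_subst (σ : ℕ → ATerm) (ρ : ℕ → ℕ) (φ : AFml) :
    (φ.substAll σ).Sat ρ ↔ φ.Sat (fun n => (σ n).val ρ) := by
  rw [← nat_sat, AFml.sat_subst, nat_sat]; simp only [nat_tv]
theorem Sat_ren (f : ℕ → ℕ) (ρ : ℕ → ℕ) (φ : AFml) :
    (φ.ren f).Sat ρ ↔ φ.Sat (fun n => ρ (f n)) := Sat_subst _ _ _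

theorem Sat_congr {c : ℕ} {ρ ρ' : ℕ → ℕ} (h : ∀ i < c, ρ i = ρ' i) (φ : AFml)
    (hφ : φ.FreeLt c) : φ.Sat ρ ↔ φ.Sat ρ' := by
  rw [← nat_sat, ← nat_sat]; exact sat_congr h φ hφ

theorem Sat_bexV (k : ℕ) (φ : AFml) (ρ : ℕ → ℕ) :
    (bexV k φ).Sat ρ ↔ ∃ a, a ≤ ρ k ∧ φ.Sat (consEnv a ρ) := Iff.rfl
theorem Sat_ballV (k : ℕ) (φ : AFml) (ρ : ℕ → ℕ) :
    (ballV k φ).Sat ρ ↔ ∀ a, a ≤ ρ k → φ.Sat (consEnv a ρ) := Iff.rfl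

theorem consEnv_skip1 (a b : ℕ) (ρ : ℕ → ℕ) :
    (fun n => consEnv a (consEnv b ρ) (skip1 n)) = consEnv a ρ := by
  funext n; cases n <;> rfl
theorem consEnv_skip2 (a b c : ℕ) (ρ : ℕ → ℕ) :
    (fun n => consEnv a (consEnv b (consEnv c ρ)) (skip2 n)) = consEnv a (consEnv b ρ) := by
  funext n
  rcases n with _ | _ | n <;> rfl

def SD (R : (ℕ → ℕ) → Prop) : Prop :=
  ∃ δ, IsDelta0 δ ∧ ∀ ρ, R ρ ↔ ∃ z, δ.Sat (consEnv z ρ)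

theorem SD.congr {R R' : (ℕ → ℕ) → Prop} (h : SD R) (e : ∀ ρ, R' ρ ↔ R ρ) : SD R' := by
  obtain ⟨δ, a, b⟩ := h
  exact ⟨δ, a, fun ρ => (e ρ).trans (b ρ)⟩

theorem SD.ofSig {φ : AFml} (h : SigEq φ) : SD (fun ρ => φ.Sat ρ) := by
  obtain ⟨δ, a, _, c⟩ := h
  refine ⟨δ, a, fun ρ => ?_⟩
  show AFml.Sat ρ φ ↔ _
  rw [← nat_sat, c _ _ nat_models]
  simp only [nat_sat, nat_cons]

theorem SD.delta0 {φ : AFml} (h : IsDelta0 φ) : SD (fun ρ => φ.Sat ρ) := .ofSig (.delta0 h)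

theorem SD.toSig {R : (ℕ → ℕ) → Prop} (h : SD R) : ∃ φ, SigEq φ ∧ ∀ ρ, R ρ ↔ φ.Sat ρ := by
  obtain ⟨δ, a, b⟩ := h
  exact ⟨.ex δ, (SigEq.delta0 a).ex, b⟩

theorem SD.and {R Q : (ℕ → ℕ) → Prop} (h1 : SD R) (h2 : SD Q) : SD (fun ρ => R ρ ∧ Q ρ) := by
  obtain ⟨φ, a, b⟩ := h1.toSig
  obtain ⟨ψ, c, d⟩ := h2.toSig
  exact (SD.ofSig (a.and c)).congr (fun ρ => by simp [AFml.Sat, b, d])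

theorem SD.or {R Q : (ℕ → ℕ) → Prop} (h1 : SD R) (h2 : SD Q) : SD (fun ρ => R ρ ∨ Q ρ) := by
  obtain ⟨φ, a, b⟩ := h1.toSig
  obtain ⟨ψ, c, d⟩ := h2.toSig
  exact (SD.ofSig (a.or c)).congr (fun ρ => by simp [AFml.Sat, b, d])

theorem SD.ex {R : (ℕ → ℕ) → Prop} (h1 : SD R) : SD (fun ρ => ∃ a, R (consEnv a ρ)) := by
  obtain ⟨φ, a, b⟩ := h1.toSig
  exact (SD.ofSig a.ex).congr (fun ρ => by simp [AFml.Sat, b])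

theorem SD.subst {R : (ℕ → ℕ) → Prop} (h : SD R) (σ : ℕ → ATerm) :
    SD (fun ρ => R (fun n => (σ n).val ρ)) := by
  obtain ⟨δ, a, b⟩ := h
  refine ⟨δ.substAll (liftSub σ), a.substAll _, fun ρ => ?_⟩
  refine (b _).trans ?_
  refine exists_congr fun z => ?_
  rw [Sat_subst]
  have : (fun n => ATerm.val (consEnv z ρ) (liftSub σ n)) = consEnv z (fun n => (σ n).val ρ) := by
    funext n
    cases n with
    | zero => rfl
    | succ n => simp [liftSub, val_lift0, consEnv]
  rw [this]

theorem SD.ren {R : (ℕ → ℕ) → Prop} (h : SD R) (f : ℕ → ℕ) :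
    SD (fun ρ => R (fun n => ρ (f n))) := h.subst (fun n => .var (f n))

theorem SD.ball {R : (ℕ → ℕ) → Prop} (h : SD R) (k : ℕ) :
    SD (fun ρ => ∀ i ≤ ρ k, R (consEnv i ρ)) := by
  obtain ⟨δ, a, b⟩ := h
  refine ⟨ballV (k + 1) (bexV 1 (δ.ren skip2)), ((a.ren _).bexV _).ballV _, fun ρ => ?_⟩
  simp only [Sat_ballV, Sat_bexV, Sat_ren, consEnv_skip2, b]
  simp only [consEnv]
  constructor
  · intro h
    have : ∀ N, (∀ i ≤ N, ∃ z, AFml.Sat (consEnv z (consEnv i ρ)) δ) →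
        ∃ u, ∀ i ≤ N, ∃ z ≤ u, AFml.Sat (consEnv z (consEnv i ρ)) δ := by
      intro N
      induction N with
      | zero => intro h; obtain ⟨z, hz⟩ := h 0 (le_refl _)
                exact ⟨z, fun i hi => ⟨z, le_refl _, by obtain rfl := Nat.le_zero.1 hi; exact hz⟩⟩
      | succ N ih =>
        intro h
        obtain ⟨u, hu⟩ := ih (fun i hi => h i (by omega))
        obtain ⟨z, hz⟩ := h (N + 1) (le_refl _)
        refine ⟨max u z, fun i hi => ?_⟩
        rcases Nat.le_succ_iff.1 hi with h1 | h1
        · obtain ⟨w, hw, hh⟩ := hu i h1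
          exact ⟨w, by omega, hh⟩
        · subst h1; exact ⟨z, by omega, hz⟩
    exact this _ h
  · rintro ⟨u, hu⟩ i hi
    obtain ⟨z, _, hz⟩ := hu i hi
    exact ⟨z, hz⟩

/-! ### functions -/
/-- Graph of a unary function: output in variable 0, input in variable 1. -/
def SG (f : ℕ → ℕ) : Prop := SD (fun ρ => ρ 0 = f (ρ 1))

theorem SD.eq (t s : ATerm) : SD (fun ρ => t.val ρ = s.val ρ) := .delta0 (.eq t s)
theorem SD.le (t s : ATerm) : SD (fun ρ => t.val ρ ≤ s.val ρ) := .delta0 (.le t s)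

/-- environment map picking finitely many variables -/
def pk (l : List ℕ) : ℕ → ℕ := fun n => l.getD n 0

/-- formula for `v c = pair (v a) (v b)` -/
def pairF (c a b : ATerm) : AFml :=
  .or (.and (.le (.succ a) b) (.eq c (.add (.mul b b) a)))
    (.and (.le b a) (.eq c (.add (.add (.mul a a) a) b)))
theorem pairF_delta0 (c a b : ATerm) : IsDelta0 (pairF c a b) :=
  .or (.and (.le _ _) (.eq _ _)) (.and (.le _ _) (.eq _ _))
theorem pairF_sat (c a b : ATerm) (ρ : ℕ → ℕ) :
    (pairF c a b).Sat ρ ↔ c.val ρ = Nat.pair (a.val ρ) (b.val ρ) := by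
  simp only [pairF, AFml.Sat, ATerm.val, Nat.pair]
  split_ifs with h
  · constructor
    · rintro (⟨_, h2⟩ | ⟨h1, _⟩)
      · exact h2
      · omega
    · intro h2; exact Or.inl ⟨h, h2⟩
  · constructor
    · rintro (⟨h1, h2⟩ | ⟨h1, h2⟩)
      · omega
      · exact h2
    · intro h2; exact Or.inr ⟨by omega, h2⟩

theorem SD.pair (c a b : ATerm) : SD (fun ρ => c.val ρ = Nat.pair (a.val ρ) (b.val ρ)) :=
  (SD.delta0 (pairF_delta0 c a b)).congr (fun ρ => (pairF_sat c a b ρ).symm)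

theorem SG.app {f : ℕ → ℕ} (h : SG f) (o i : ℕ) : SD (fun ρ => ρ o = f (ρ i)) :=
  (h.ren (pk [o, i])).congr (fun ρ => by simp [pk])

theorem SG.comp {f g : ℕ → ℕ} (hf : SG f) (hg : SG g) : SG (fun n => f (g n)) :=
  ((hf.app 1 0).and (hg.app 0 2)).ex.congr (fun ρ => by simp [consEnv])

theorem SG.pair {f g : ℕ → ℕ} (hf : SG f) (hg : SG g) : SG (fun n => Nat.pair (f n) (g n)) :=
  (((hf.app 1 3).and (hg.app 0 3)).and (SD.pair (.var 2) (.var 1) (.var 0))).ex.ex.congr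
    (fun ρ => by simp [consEnv, ATerm.val])

theorem SG.left : SG (fun n => n.unpair.1) :=
  (SD.pair (.var 2) (.var 1) (.var 0)).ex.congr (fun ρ => by
    simp only [consEnv, ATerm.val]
    constructor
    · intro h; exact ⟨(ρ 1).unpair.2, by rw [h, Nat.pair_unpair]⟩
    · rintro ⟨a, h⟩; rw [h, Nat.unpair_pair])

theorem SG.right : SG (fun n => n.unpair.2) :=
  (SD.pair (.var 2) (.var 0) (.var 1)).ex.congr (fun ρ => by
    simp only [consEnv, ATerm.val]
    constructor
    · intro h; exact ⟨(ρ 1).unpair.1, by rw [h, Nat.pair_unpair]⟩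
    · rintro ⟨a, h⟩; rw [h, Nat.unpair_pair])

/-- `ρ o = β(ρ c, ρ i)` -/
theorem SD.beta (o c i : ℕ) : SD (fun ρ => ρ o = Nat.beta (ρ c) (ρ i)) := by
  have h : SD (fun ρ => ∃ a, ∃ b, ∃ q, ρ c = Nat.pair a b ∧
      a = q * ((ρ i + 1) * b + 1) + ρ o ∧ ρ o < ((ρ i + 1) * b + 1)) := by
    refine ((((SD.pair (.var (c + 3)) (.var 2) (.var 1)).and
      ((SD.eq (.var 2) (.add (.mul (.var 0) (.succ (.mul (.succ (.var (i + 3))) (.var 1))))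
        (.var (o + 3)))).and
      (SD.le (.succ (.var (o + 3))) (.succ (.mul (.succ (.var (i + 3))) (.var 1))))))).ex.ex.ex).congr ?_
    intro ρ
    simp [consEnv, ATerm.val]
  refine h.congr (fun ρ => ?_)
  constructor
  · intro h
    refine ⟨(ρ c).unpair.1, (ρ c).unpair.2,
      (ρ c).unpair.1 / ((ρ i + 1) * (ρ c).unpair.2 + 1), (Nat.pair_unpair _).symm, ?_, ?_⟩
    · rw [h, Nat.beta]; exact (Nat.div_add_mod' _ _).symm
    · rw [h, Nat.beta]; exact Nat.mod_lt _ (Nat.succ_pos _)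
  · rintro ⟨a, b, q, h1, h2, h3⟩
    rw [Nat.beta, h1, Nat.unpair_pair]
    simp only
    generalize (ρ i + 1) * b + 1 = w at *
    rw [h2, Nat.mul_add_mod', Nat.mod_eq_of_lt h3]

theorem SG.prec {f g : ℕ → ℕ} (hf : SG f) (hg : SG g) :
    SG (Nat.unpaired fun z n => n.rec (f z) fun y IH => g (Nat.pair z (Nat.pair y IH))) := by
  -- variables in the body: c (0), n (1), z (2), out (3), inp (4)
  have hstep : SD (fun ρ => ∀ y ≤ ρ 1, (ρ 1 ≤ y ∨ ∃ u, ∃ v, ∃ p, ∃ q,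
      u = Nat.beta (ρ 0) y ∧ (∃ s, s = y + 1 ∧ v = Nat.beta (ρ 0) s) ∧ p = Nat.pair y u ∧
        q = Nat.pair (ρ 2) p ∧ v = g q)) := by
    -- q 0, p 1, v 2, u 3, y 4, c 5, n 6, z 7
    refine (SD.ball (R := fun ρ => (ρ 2 ≤ ρ 0 ∨ ∃ u, ∃ v, ∃ p, ∃ q,
      u = Nat.beta (ρ 1) (ρ 0) ∧ (∃ s, s = ρ 0 + 1 ∧ v = Nat.beta (ρ 1) s) ∧ p = Nat.pair (ρ 0) u ∧
        q = Nat.pair (ρ 3) p ∧ v = g q)) ?_ 1).congr (fun ρ => by simp [consEnv])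
    refine (SD.le (.var 2) (.var 0)).or ?_
    refine ((SD.beta 3 5 4).and (((SD.eq (.var 0) (.succ (.var 5))).and (SD.beta 3 6 0)).ex.and
      ((SD.pair (.var 1) (.var 4) (.var 3)).and
      ((SD.pair (.var 0) (.var 7) (.var 1)).and (hg.app 2 0))))).ex.ex.ex.ex.congr ?_
    intro ρ
    simp [consEnv, ATerm.val]
  have hz : SD (fun ρ => ∃ o, o = 0 ∧ ∃ w, w = Nat.beta (ρ 0) o ∧ w = f (ρ 2)) :=
    ((SD.eq (.var 0) .zero).and ((SD.beta 0 2 1).and (hf.app 0 4)).ex).ex.congr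
      (fun ρ => by simp [consEnv, ATerm.val])
  refine ((((SD.pair (.var 4) (.var 2) (.var 1)).and (hz.and (hstep.and (SD.beta 3 0 1))))).ex.ex.ex).congr ?_
  intro ρ
  simp only [consEnv, ATerm.val, Nat.unpaired]
  constructor
  · intro h
    set z := (ρ 1).unpair.1 with hz
    set n := (ρ 1).unpair.2 with hn
    let F : ℕ → ℕ := fun k => Nat.rec (f z) (fun y IH => g (Nat.pair z (Nat.pair y IH))) k
    let l : List ℕ := (List.range (n + 1)).map F
    have hl : ∀ i ≤ n, Nat.beta (Nat.unbeta l) i = F i := by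
      intro i hi
      have hlen : i < l.length := by simp [l]; omega
      have := Nat.beta_unbeta_coe l ⟨i, hlen⟩
      simpa [l] using this
    refine ⟨z, n, Nat.unbeta l, (Nat.pair_unpair _).symm, ⟨0, rfl, _, rfl, hl 0 (Nat.zero_le _)⟩, ?_, ?_⟩
    · intro y hy
      by_cases h1 : n ≤ y
      · exact Or.inl h1
      · refine Or.inr ⟨_, _, _, _, rfl, ⟨_, rfl, rfl⟩, rfl, rfl, ?_⟩
        rw [hl _ (by omega), hl _ (by omega)]
    · rw [hl n (le_refl _)]; exact h
  · rintro ⟨z, n, c, h1, ⟨o, rfl, w, hw, hw2⟩, h2, h3⟩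
    rw [h1, Nat.unpair_pair, h3]
    simp only
    have : ∀ k ≤ n, Nat.beta c k = Nat.rec (f z) (fun y IH => g (Nat.pair z (Nat.pair y IH))) k := by
      intro k
      induction k with
      | zero => intro _; rw [← hw]; exact hw2
      | succ k ih =>
        intro hk
        rcases h2 k (by omega) with h | ⟨u, v, p, q, rfl, ⟨s, rfl, rfl⟩, rfl, rfl, h⟩
        · omega
        · rw [h, ih (by omega)]
    exact this n (le_refl _)

theorem SG.ofPrimrec {f : ℕ → ℕ} (h : Nat.Primrec f) : SG f := by
  induction h with
  | zero => exact SD.eq (.var 0) .zero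
  | succ => exact SD.eq (.var 0) (.succ (.var 1))
  | left => exact .left
  | right => exact .right
  | pair _ _ h1 h2 => exact h1.pair h2
  | comp _ _ h1 h2 => exact h1.comp h2
  | prec _ _ h1 h2 => exact h1.prec h2

/-! ### r.e. predicates in the sense of Mathlib's primitive recursion -/
def RE {α : Type} [Primcodable α] (R : α → Prop) : Prop :=
  ∃ f : α → ℕ → Bool, Primrec₂ f ∧ ∀ x, R x ↔ ∃ z, f x z = true

theorem RE.sd {R : ℕ → Prop} (h : RE R) : SD (fun ρ => R (ρ 0)) := by
  obtain ⟨f, hf, hR⟩ := h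
  have h1 : Nat.Primrec (fun n => (f n.unpair.1 n.unpair.2).toNat) := by
    rw [← Primrec.nat_iff]
    have h2 : Primrec (fun n : ℕ => f n.unpair.1 n.unpair.2) :=
      hf.comp (Primrec.fst.comp Primrec.unpair) (Primrec.snd.comp Primrec.unpair)
    exact (Primrec.encode.comp h2).of_eq (fun n => by cases f n.unpair.1 n.unpair.2 <;> rfl)
  have h2 := SG.ofPrimrec h1
  refine ((((SD.pair (.var 0) (.var 3) (.var 2)).and ((h2.app 1 0).and
    (SD.eq (.var 1) (.succ .zero)))).ex.ex.ex)).congr (fun ρ => ?_)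
  simp only [consEnv, ATerm.val]
  rw [hR]
  constructor
  · rintro ⟨z, hz⟩
    exact ⟨z, 1, _, rfl, by simp [hz], rfl⟩
  · rintro ⟨z, o, p, rfl, h3, h4⟩
    refine ⟨z, ?_⟩
    rw [h3] at h4
    simpa using h4

theorem RE.ofPrim {α : Type} [Primcodable α] {f : α → Bool} (h : Primrec f) :
    RE (fun x => f x = true) :=
  ⟨fun x _ => f x, h.comp Primrec.fst, fun x => by simp⟩

theorem RE.congr {α : Type} [Primcodable α] {R Q : α → Prop} (h : RE R) (e : ∀ x, Q x ↔ R x) :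
    RE Q := by
  obtain ⟨f, hf, hR⟩ := h
  exact ⟨f, hf, fun x => (e x).trans (hR x)⟩

theorem RE.comp {α β : Type} [Primcodable α] [Primcodable β] {R : α → Prop} (h : RE R)
    {g : β → α} (hg : Primrec g) : RE (fun x => R (g x)) := by
  obtain ⟨f, hf, hR⟩ := h
  exact ⟨fun x z => f (g x) z, hf.comp (hg.comp Primrec.fst) Primrec.snd, fun x => hR _⟩

/-- extraction of a Δ₀ matrix with control of the free variables -/
theorem SD.extract {R : (ℕ → ℕ) → Prop} (h : SD R) (k : ℕ)
    (hk : ∀ ρ ρ', (∀ i < k, ρ i = ρ' i) → (R ρ ↔ R ρ')) :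
    ∃ δ, IsDelta0 δ ∧ δ.FreeLt (k + 1) ∧ ∀ ρ, R ρ ↔ ∃ z, δ.Sat (consEnv z ρ) := by
  obtain ⟨δ, a, b⟩ := h
  refine ⟨δ.substAll (fun n => if n < k + 1 then .var n else .zero), a.substAll _, ?_, ?_⟩
  · have : ∃ c, δ.FreeLt c := ⟨_, δ.freeLt_code⟩
    obtain ⟨c, hc⟩ := this
    refine AFml.freeLt_subst (c := c) ?_ δ hc
    intro i _
    by_cases h : i < k + 1 <;> simp only [h, if_true, if_false, ATerm.FreeLt]
  · intro ρ
    rw [hk ρ (fun n => if n < k then ρ n else 0) (by intro i hi; simp [hi]), b]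
    refine exists_congr fun z => ?_
    rw [Sat_subst]
    have : (fun n => ATerm.val (consEnv z ρ) (if n < k + 1 then .var n else .zero)) =
        consEnv z (fun n => if n < k then ρ n else 0) := by
      funext n
      cases n with
      | zero => simp [ATerm.val, consEnv]
      | succ n => by_cases h : n < k <;> simp [ATerm.val, consEnv, h]
    rw [this]

theorem RE.extract2 {R : ℕ → ℕ → Prop} (h : RE (fun p : ℕ × ℕ => R p.1 p.2)) :
    ∃ δ, IsDelta0 δ ∧ δ.FreeLt 3 ∧
      ∀ ρ : ℕ → ℕ, R (ρ 0) (ρ 1) ↔ ∃ z, δ.Sat (consEnv z ρ) := by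
  have h1 : RE (fun n : ℕ => R n.unpair.1 n.unpair.2) := h.comp Primrec.unpair
  have h2 : SD (fun ρ => R (ρ 0) (ρ 1)) :=
    ((SD.pair (.var 0) (.var 1) (.var 2)).and h1.sd).ex.congr (fun ρ => by
      simp [consEnv, ATerm.val])
  exact h2.extract 2 (fun ρ ρ' h => by rw [h 0 (by omega), h 1 (by omega)])

theorem RE.extract3 {R : ℕ → ℕ → ℕ → Prop} (h : RE (fun p : ℕ × ℕ × ℕ => R p.1 p.2.1 p.2.2)) :
    ∃ δ, IsDelta0 δ ∧ δ.FreeLt 4 ∧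
      ∀ ρ : ℕ → ℕ, R (ρ 0) (ρ 1) (ρ 2) ↔ ∃ z, δ.Sat (consEnv z ρ) := by
  have h1 : RE (fun n : ℕ => R n.unpair.1 n.unpair.2.unpair.1 n.unpair.2.unpair.2) :=
    h.comp (g := fun n : ℕ => (n.unpair.1, n.unpair.2.unpair.1, n.unpair.2.unpair.2))
      ((Primrec.fst.comp Primrec.unpair).pair ((Primrec.fst.comp (Primrec.unpair.comp
        (Primrec.snd.comp Primrec.unpair))).pair (Primrec.snd.comp (Primrec.unpair.comp
        (Primrec.snd.comp Primrec.unpair)))))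
  have h2 : SD (fun ρ => R (ρ 0) (ρ 1) (ρ 2)) :=
    (((SD.pair (.var 0) (.var 3) (.var 4)).and ((SD.pair (.var 1) (.var 2) (.var 0)).and
      (h1.sd.ren (pk [1])))).ex.ex).congr (fun ρ => by
      simp [consEnv, ATerm.val, pk])
  exact h2.extract 3 (fun ρ ρ' h => by rw [h 0 (by omega), h 1 (by omega), h 2 (by omega)])


end Part3

section Part4

/-! ## Part 4: primitive recursion toolkit and closure of r.e. predicates -/

attribute [fun_prop] Primrec
set_option linter.unusedSectionVars false

section prims
variable {α β γ σ : Type} [Primcodable α] [Primcodable β] [Primcodable γ] [Primcodable σ]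

@[fun_prop] theorem pr_id : Primrec (fun x : α => x) := Primrec.id
@[fun_prop] theorem pr_const (c : β) : Primrec (fun _ : α => c) := Primrec.const c
@[fun_prop] theorem pr_comp {f : β → γ} {g : α → β} (hf : Primrec f) (hg : Primrec g) :
    Primrec (fun x => f (g x)) := hf.comp hg
theorem pr_app2 {f : β → γ → σ} (hf : Primrec₂ f) {g : α → β} {h : α → γ} (hg : Primrec g)
    (hh : Primrec h) : Primrec (fun x => f (g x) (h x)) := Primrec₂.comp hf hg hh
@[fun_prop] theorem pr_mk {f : α → β} {g : α → γ} (hf : Primrec f) (hg : Primrec g) :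
    Primrec (fun x => (f x, g x)) := hf.pair hg
@[fun_prop] theorem pr_fst {f : α → β × γ} (hf : Primrec f) : Primrec (fun x => (f x).1) :=
  Primrec.fst.comp hf
@[fun_prop] theorem pr_snd {f : α → β × γ} (hf : Primrec f) : Primrec (fun x => (f x).2) :=
  Primrec.snd.comp hf
@[fun_prop] theorem pr_pair {f g : α → ℕ} (hf : Primrec f) (hg : Primrec g) :
    Primrec (fun x => Nat.pair (f x) (g x)) := Primrec₂.natPair.comp hf hg
@[fun_prop] theorem pr_unpair {f : α → ℕ} (hf : Primrec f) :
    Primrec (fun x => Nat.unpair (f x)) := Primrec.unpair.comp hf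
@[fun_prop] theorem pr_add {f g : α → ℕ} (hf : Primrec f) (hg : Primrec g) :
    Primrec (fun x => f x + g x) := Primrec.nat_add.comp hf hg
@[fun_prop] theorem pr_mul {f g : α → ℕ} (hf : Primrec f) (hg : Primrec g) :
    Primrec (fun x => f x * g x) := Primrec.nat_mul.comp hf hg
@[fun_prop] theorem pr_sub {f g : α → ℕ} (hf : Primrec f) (hg : Primrec g) :
    Primrec (fun x => f x - g x) := Primrec.nat_sub.comp hf hg
@[fun_prop] theorem pr_div {f g : α → ℕ} (hf : Primrec f) (hg : Primrec g) :
    Primrec (fun x => f x / g x) := Primrec.nat_div.comp hf hg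
@[fun_prop] theorem pr_mod {f g : α → ℕ} (hf : Primrec f) (hg : Primrec g) :
    Primrec (fun x => f x % g x) := Primrec.nat_mod.comp hf hg
@[fun_prop] theorem pr_and {f g : α → Bool} (hf : Primrec f) (hg : Primrec g) :
    Primrec (fun x => f x && g x) := Primrec.and.comp hf hg
@[fun_prop] theorem pr_or {f g : α → Bool} (hf : Primrec f) (hg : Primrec g) :
    Primrec (fun x => f x || g x) := Primrec.or.comp hf hg
@[fun_prop] theorem pr_not {f : α → Bool} (hf : Primrec f) :
    Primrec (fun x => !(f x)) := Primrec.not.comp hf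
@[fun_prop] theorem pr_beq [DecidableEq β] {f g : α → β} (hf : Primrec f) (hg : Primrec g) :
    Primrec (fun x => decide (f x = g x)) := by
  obtain ⟨_, h⟩ := (Primrec.eq (α := β))
  exact (h.comp (hf.pair hg)).of_eq (fun x => by simp)
@[fun_prop] theorem pr_le {f g : α → ℕ} (hf : Primrec f) (hg : Primrec g) :
    Primrec (fun x => decide (f x ≤ g x)) := by
  obtain ⟨_, h⟩ := Primrec.nat_le
  exact (h.comp (hf.pair hg)).of_eq (fun x => by simp)
@[fun_prop] theorem pr_lt {f g : α → ℕ} (hf : Primrec f) (hg : Primrec g) :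
    Primrec (fun x => decide (f x < g x)) := by
  obtain ⟨_, h⟩ := Primrec.nat_lt
  exact (h.comp (hf.pair hg)).of_eq (fun x => by simp)
@[fun_prop] theorem pr_bif {c : α → Bool} {f g : α → β} (hc : Primrec c) (hf : Primrec f)
    (hg : Primrec g) : Primrec (fun x => bif c x then f x else g x) := Primrec.cond hc hf hg
@[fun_prop] theorem pr_getD [DecidableEq β] {f : α → List β} {g : α → ℕ} {d : β} (hf : Primrec f)
    (hg : Primrec g) : Primrec (fun x => (f x).getD (g x) d) := (Primrec.list_getD d).comp hf hg
@[fun_prop] theorem pr_length {f : α → List β} (hf : Primrec f) :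
    Primrec (fun x => (f x).length) := Primrec.list_length.comp hf
@[fun_prop] theorem pr_cons {f : α → List β} {g : α → β} (hf : Primrec f) (hg : Primrec g) :
    Primrec (fun x => g x :: f x) := Primrec.list_cons.comp hg hf
@[fun_prop] theorem pr_mem [DecidableEq β] {f : α → List β} {g : α → β} (hf : Primrec f)
    (hg : Primrec g) : Primrec (fun x => decide (g x ∈ f x)) := by
  have h : Primrec (fun x => decide ((f x).idxOf (g x) < (f x).length)) :=
    pr_lt (Primrec.list_idxOf.comp hg hf) (pr_length hf)
  exact h.of_eq (fun x => by simp [List.idxOf_lt_length_iff])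
@[fun_prop] theorem pr_decode {f : α → ℕ} (hf : Primrec f) :
    Primrec (fun x => Encodable.decode (α := β) (f x)) := Primrec.decode.comp hf

/-- bounded search -/
def anyLt (n : ℕ) (f : ℕ → Bool) : Bool := Nat.rec false (fun i b => b || f i) n
theorem anyLt_iff (n : ℕ) (f : ℕ → Bool) : anyLt n f = true ↔ ∃ i < n, f i = true := by
  induction n with
  | zero => simp [anyLt]
  | succ n ih =>
    have : anyLt (n + 1) f = (anyLt n f || f n) := rfl
    rw [this, Bool.or_eq_true, ih]
    constructor
    · rintro (⟨i, h, h2⟩ | h)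
      · exact ⟨i, by omega, h2⟩
      · exact ⟨n, by omega, h⟩
    · rintro ⟨i, h, h2⟩
      rcases Nat.lt_succ_iff_lt_or_eq.1 h with h | rfl
      · exact Or.inl ⟨i, h, h2⟩
      · exact Or.inr h2
theorem pr_rec {f : α → ℕ} {g : α → β} {h : α → ℕ → β → β} (hf : Primrec f) (hg : Primrec g)
    (hh : Primrec (fun p : α × ℕ × β => h p.1 p.2.1 p.2.2)) :
    Primrec (fun a => (Nat.rec (g a) (fun n IH => h a n IH) (f a) : β)) :=
  Primrec.nat_rec' (h := fun a p => h a p.1 p.2) hf hg hh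
theorem pr_anyLt {n : α → ℕ} {f : α → ℕ → Bool} (hn : Primrec n)
    (hf : Primrec (fun p : α × ℕ => f p.1 p.2)) : Primrec (fun x => anyLt (n x) (f x)) := by
  refine pr_rec hn (pr_const false) (h := fun x i b => b || f x i) ?_
  exact pr_or (by fun_prop) (hf.comp (g := fun p : α × ℕ × Bool => (p.1, p.2.1)) (by fun_prop))

/-- strong recursion -/
theorem pr_strong {f : α → ℕ → σ} {G : α → List σ → σ} (hG : Primrec (fun p : α × List σ => G p.1 p.2))
    (H : ∀ a n, f a n = G a ((List.range n).map (f a))) : Primrec (fun p : α × ℕ => f p.1 p.2) :=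
  Primrec.nat_strong_rec f (g := fun a l => some (G a l)) (Primrec.option_some.comp hG)
    (fun a n => by rw [← H])

def srAux (G : α → List σ → σ) (a : α) : ℕ → List σ
  | 0 => []
  | n + 1 => srAux G a n ++ [G a (srAux G a n)]
def sr (G : α → List σ → σ) (a : α) (n : ℕ) : σ := G a (srAux G a n)
theorem srAux_eq (G : α → List σ → σ) (a : α) (n : ℕ) :
    srAux G a n = (List.range n).map (sr G a) := by
  induction n with
  | zero => rfl
  | succ n ih => rw [List.range_succ, List.map_append, ← ih]; rfl
theorem sr_eq (G : α → List σ → σ) (a : α) (n : ℕ) :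
    sr G a n = G a ((List.range n).map (sr G a)) := by rw [← srAux_eq]; rfl
theorem sr_prim {G : α → List σ → σ} (hG : Primrec (fun p : α × List σ => G p.1 p.2)) :
    Primrec (fun p : α × ℕ => sr G p.1 p.2) := pr_strong hG (sr_eq G)
theorem getD_map_range (f : ℕ → σ) (n i : ℕ) (d : σ) (h : i < n) :
    ((List.range n).map f).getD i d = f i := by
  simp [List.getD, h]

/-! ### r.e. closure -/
theorem RE.eq [DecidableEq β] {f g : α → β} (hf : Primrec f) (hg : Primrec g) : RE (fun x => f x = g x) :=
  (RE.ofPrim (pr_beq hf hg)).congr (fun x => by simp)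
theorem RE.lt {f g : α → ℕ} (hf : Primrec f) (hg : Primrec g) : RE (fun x => f x < g x) :=
  (RE.ofPrim (pr_lt hf hg)).congr (fun x => by simp)
theorem RE.le {f g : α → ℕ} (hf : Primrec f) (hg : Primrec g) : RE (fun x => f x ≤ g x) :=
  (RE.ofPrim (pr_le hf hg)).congr (fun x => by simp)

theorem RE.and {R Q : α → Prop} (h1 : RE R) (h2 : RE Q) : RE (fun x => R x ∧ Q x) := by
  obtain ⟨f, hf, hR⟩ := h1
  obtain ⟨g, hg, hQ⟩ := h2
  refine ⟨fun x z => f x z.unpair.1 && g x z.unpair.2, ?_, fun x => ?_⟩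
  · exact pr_and (hf.comp Primrec.fst (by fun_prop)) (hg.comp Primrec.fst (by fun_prop))
  · show R x ∧ Q x ↔ _
    rw [hR, hQ]
    constructor
    · rintro ⟨⟨a, ha⟩, b, hb⟩
      exact ⟨Nat.pair a b, by simp [ha, hb]⟩
    · rintro ⟨z, hz⟩
      rw [Bool.and_eq_true] at hz
      exact ⟨⟨_, hz.1⟩, _, hz.2⟩

theorem RE.or {R Q : α → Prop} (h1 : RE R) (h2 : RE Q) : RE (fun x => R x ∨ Q x) := by
  obtain ⟨f, hf, hR⟩ := h1
  obtain ⟨g, hg, hQ⟩ := h2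
  refine ⟨fun x z => f x z || g x z, ?_, fun x => ?_⟩
  · exact pr_or hf hg
  · show R x ∨ Q x ↔ _
    rw [hR, hQ]
    simp only [Bool.or_eq_true]
    exact exists_or.symm

theorem RE.ex {R : α → β → Prop} (h : RE (fun p : α × β => R p.1 p.2)) :
    RE (fun a => ∃ b, R a b) := by
  obtain ⟨f, hf, hR⟩ := h
  refine ⟨fun x z => match Encodable.decode (α := β × ℕ) z with
    | none => false
    | some q => f (x, q.1) q.2, ?_, fun x => ?_⟩
  · refine Primrec.option_casesOn (o := fun p : α × ℕ => Encodable.decode (α := β × ℕ) p.2)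
      (f := fun _ => false) (g := fun (p : α × ℕ) (q : β × ℕ) => f (p.1, q.1) q.2) ?_ ?_ ?_ |>.of_eq ?_
    · fun_prop
    · fun_prop
    · exact pr_app2 hf (g := fun p : (α × ℕ) × β × ℕ => (p.1.1, p.2.1)) (by fun_prop)
        (h := fun p : (α × ℕ) × β × ℕ => p.2.2) (by fun_prop)
    · rintro ⟨a, z⟩
      cases h : Encodable.decode (α := β × ℕ) z <;> simp [h]
  · constructor
    · rintro ⟨b, hb⟩
      obtain ⟨z, hz⟩ := (hR (x, b)).1 hb
      exact ⟨Encodable.encode (b, z), by simp only [Encodable.encodek]; exact hz⟩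
    · rintro ⟨z, hz⟩
      cases h : Encodable.decode (α := β × ℕ) z with
      | none => simp only [h] at hz; simp at hz
      | some q => simp only [h] at hz; exact ⟨q.1, (hR (x, q.1)).2 ⟨_, hz⟩⟩

/-- inductive closure -/
inductive Cl (Ax : β → Prop) (St : β → β → β → Prop) : β → Prop
  | ax {x} : Ax x → Cl Ax St x
  | st {x a b} : Cl Ax St a → Cl Ax St b → St x a b → Cl Ax St x

theorem RE.cl [DecidableEq β] {Ax : α → β → Prop} {St : α → β → β → β → Prop}
    (h1 : RE (fun p : α × β => Ax p.1 p.2))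
    (h2 : RE (fun p : α × β × β × β => St p.1 p.2.1 p.2.2.1 p.2.2.2)) :
    RE (fun p : α × β => Cl (Ax p.1) (St p.1) p.2) := by
  obtain ⟨f, hf, hA⟩ := h1
  obtain ⟨g, hg, hS⟩ := h2
  let cnd : α → List β → (β × β × β × ℕ) → Bool := fun p l q =>
    f (p, q.1) q.2.2.2 || (decide (q.2.1 ∈ l) && (decide (q.2.2.1 ∈ l) &&
      g (p, q.1, q.2.1, q.2.2.1) q.2.2.2))
  let cand : α → List β → (β × β × β × ℕ) → List β := fun p l q =>
    bif cnd p l q then q.1 :: l else l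
  let step : α → ℕ → List β → List β := fun p z l =>
    (Option.casesOn (Encodable.decode (α := β × β × β × ℕ) z.unpair.1) l (fun q => cand p l q) : List β)
  let stage : α → ℕ → List β := fun p n => Nat.rec [] (fun z l => step p z l) n
  have hcand : Primrec (fun t : (α × ℕ × List β) × (β × β × β × ℕ) => cand t.1.1 t.1.2.2 t.2) := by
    have e1 : Primrec (fun t : (α × ℕ × List β) × (β × β × β × ℕ) => f (t.1.1, t.2.1) t.2.2.2.2) :=
      pr_app2 hf (g := fun t : (α × ℕ × List β) × (β × β × β × ℕ) => (t.1.1, t.2.1)) (by fun_prop)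
        (h := fun t : (α × ℕ × List β) × (β × β × β × ℕ) => t.2.2.2.2) (by fun_prop)
    have e2 : Primrec (fun t : (α × ℕ × List β) × (β × β × β × ℕ) =>
        g (t.1.1, t.2.1, t.2.2.1, t.2.2.2.1) t.2.2.2.2) :=
      pr_app2 hg (g := fun t : (α × ℕ × List β) × (β × β × β × ℕ) => (t.1.1, t.2.1, t.2.2.1, t.2.2.2.1))
        (by fun_prop)
        (h := fun t : (α × ℕ × List β) × (β × β × β × ℕ) => t.2.2.2.2) (by fun_prop)
    exact pr_bif (pr_or e1 (pr_and (by fun_prop) (pr_and (by fun_prop) e2))) (by fun_prop) (by fun_prop)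
  have hstep : Primrec (fun t : α × ℕ × List β => step t.1 t.2.1 t.2.2) :=
    Primrec.option_casesOn (o := fun t : α × ℕ × List β =>
      Encodable.decode (α := β × β × β × ℕ) t.2.1.unpair.1) (f := fun t => t.2.2)
      (g := fun t q => cand t.1 t.2.2 q) (by fun_prop) (by fun_prop) hcand
  have hstage : Primrec (fun t : α × ℕ => stage t.1 t.2) := by
    refine pr_rec (f := fun t : α × ℕ => t.2) (g := fun _ => [])
      (h := fun t z l => step t.1 z l) (by fun_prop) (by fun_prop) ?_
    exact hstep.comp (g := fun t : (α × ℕ) × ℕ × List β => (t.1.1, t.2.1, t.2.2)) (by fun_prop)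
  have hsub : ∀ p z l, l ⊆ step p z l := by
    intro p z l
    simp only [step]
    cases h : Encodable.decode (α := β × β × β × ℕ) z.unpair.1 with
    | none => exact List.Subset.refl _
    | some q =>
      simp only [cand]
      cases cnd p l q with
      | true => exact List.subset_cons_self _ _
      | false => exact List.Subset.refl _
  have hmono : ∀ p z w, z ≤ w → stage p z ⊆ stage p w := by
    intro p z w h
    induction h with
    | refl => exact List.Subset.refl _
    | step _ ih => exact List.Subset.trans ih (hsub p _ _)
  have hfin :=
    pr_mem (f := fun t : (α × β) × ℕ => stage t.1.1 t.2) (g := fun t : (α × β) × ℕ => t.1.2)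
      (hstage.comp (f := fun t : α × ℕ => stage t.1 t.2)
        (g := fun t : (α × β) × ℕ => (t.1.1, t.2)) (by fun_prop)) (by fun_prop)
  refine ⟨fun q z => (fun (x : β) (l : List β) => decide (x ∈ l)) q.2 (stage q.1 z), hfin, ?_⟩
  · rintro ⟨p, x⟩
    simp only [decide_eq_true_eq]
    constructor
    · intro h
      induction h with
      | @ax x h =>
        obtain ⟨w, hw⟩ := (hA (p, x)).1 h
        refine ⟨Nat.pair (Encodable.encode (x, x, x, w)) 0 + 1, ?_⟩
        show x ∈ step p _ _
        simp only [step, Nat.unpair_pair, Encodable.encodek, cand, cnd, hw]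
        simp
      | @st x a b h1 h2 h3 i1 i2 =>
        obtain ⟨z1, i1⟩ := i1
        obtain ⟨z2, i2⟩ := i2
        obtain ⟨w, hw⟩ := (hS (p, x, a, b)).1 h3
        refine ⟨Nat.pair (Encodable.encode (x, a, b, w)) (max z1 z2) + 1, ?_⟩
        have hle := Nat.right_le_pair (Encodable.encode (x, a, b, w)) (max z1 z2)
        have j1 := hmono p _ _ (show z1 ≤ Nat.pair (Encodable.encode (x, a, b, w)) (max z1 z2) by omega) i1
        have j2 := hmono p _ _ (show z2 ≤ Nat.pair (Encodable.encode (x, a, b, w)) (max z1 z2) by omega) i2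
        show x ∈ step p _ (stage p _)
        simp only [step, Nat.unpair_pair, Encodable.encodek, cand, cnd, hw, j1, j2]
        simp
    · rintro ⟨z, hz⟩
      induction z generalizing x with
      | zero => exact absurd hz (by simp [stage])
      | succ z ih =>
        have hz' : x ∈ step p z (stage p z) := hz
        simp only [step] at hz'
        cases h : Encodable.decode (α := β × β × β × ℕ) z.unpair.1 with
        | none => rw [h] at hz'; exact ih _ hz'
        | some q =>
          rw [h] at hz'
          simp only [cand] at hz'
          cases hc : cnd p (stage p z) q with
          | false => rw [hc] at hz'; exact ih _ hz'
          | true =>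
            rw [hc] at hz'
            simp only [cond_true, List.mem_cons] at hz'
            rcases hz' with rfl | hz'
            · simp only [cnd, Bool.or_eq_true, Bool.and_eq_true, decide_eq_true_eq] at hc
              rcases hc with hc | ⟨c1, c2, c3⟩
              · exact .ax ((hA _).2 ⟨_, hc⟩)
              · exact .st (ih _ c1) (ih _ c2) ((hS (p, q.1, q.2.1, q.2.2.1)).2 ⟨_, c3⟩)
            · exact ih _ hz'

end prims

end Part4

section Part5

/-! ## Part 5: arithmetized formulas -/

section rel
variable {ι : Type} (c : ι → ℕ) (σ : ι → ℕ → ATerm) (sh : ι → ι)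

def BR (q : ℕ × ℕ × ℕ) : Prop := ∃ i, q.1 = c i ∧ q.2.2 = (σ i q.2.1).code
def ShR (q : ℕ × ℕ) : Prop := ∃ i, q.1 = c i ∧ q.2 = c (sh i)
def TR (q : ℕ × ℕ × ℕ) : Prop :=
  ∃ i t, q.1 = c i ∧ q.2.1 = ATerm.code t ∧ q.2.2 = (t.substAll (σ i)).code
def FR (q : ℕ × ℕ × ℕ) : Prop :=
  ∃ i φ, q.1 = c i ∧ q.2.1 = AFml.code φ ∧ q.2.2 = (φ.substAll (σ i)).code

theorem TR_re (hc : Function.Injective c) (hB : RE (BR c σ)) : RE (TR c σ) := by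
  let Ax : Unit → ℕ × ℕ × ℕ → Prop := fun _ q =>
    (BR c σ (q.1, q.2.1.unpair.2, q.2.2) ∧ q.2.1.unpair.1 = 0) ∨
    (q.2.1 = Nat.pair 1 0 ∧ q.2.2 = Nat.pair 1 0 ∧ ∃ y, BR c σ (q.1, 0, y))
  let St : Unit → ℕ × ℕ × ℕ → ℕ × ℕ × ℕ → ℕ × ℕ × ℕ → Prop := fun _ x a b =>
    a.1 = x.1 ∧ b.1 = x.1 ∧
    ((x.2.1 = Nat.pair 2 a.2.1 ∧ x.2.2 = Nat.pair 2 a.2.2) ∨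
     (x.2.1 = Nat.pair 3 (Nat.pair a.2.1 b.2.1) ∧ x.2.2 = Nat.pair 3 (Nat.pair a.2.2 b.2.2)) ∨
     (x.2.1 = Nat.pair 4 (Nat.pair a.2.1 b.2.1) ∧ x.2.2 = Nat.pair 4 (Nat.pair a.2.2 b.2.2)))
  have h1 : RE (fun p : Unit × ℕ × ℕ × ℕ => Ax p.1 p.2) := by
    refine RE.or ((hB.comp (g := fun p : Unit × ℕ × ℕ × ℕ =>
      (p.2.1, p.2.2.1.unpair.2, p.2.2.2)) (by fun_prop)).and (.eq (by fun_prop) (by fun_prop))) ?_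
    refine RE.and (.eq (by fun_prop) (by fun_prop)) (RE.and (.eq (by fun_prop) (by fun_prop)) ?_)
    refine RE.ex ?_
    exact hB.comp (g := fun p : (Unit × ℕ × ℕ × ℕ) × ℕ => (p.1.2.1, 0, p.2)) (by fun_prop)
  have h2 : RE (fun p : Unit × (ℕ × ℕ × ℕ) × (ℕ × ℕ × ℕ) × (ℕ × ℕ × ℕ) =>
      St p.1 p.2.1 p.2.2.1 p.2.2.2) := by
    refine RE.and (.eq (by fun_prop) (by fun_prop)) (RE.and (.eq (by fun_prop) (by fun_prop)) ?_)
    refine RE.or ?_ (RE.or ?_ ?_) <;>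
      exact RE.and (.eq (by fun_prop) (by fun_prop)) (.eq (by fun_prop) (by fun_prop))
  refine ((RE.cl h1 h2).comp (g := fun q : ℕ × ℕ × ℕ => ((), q)) (by fun_prop)).congr ?_
  intro q
  constructor
  · rintro ⟨i, t, e1, e2, e3⟩
    show Cl (Ax ()) (St ()) q
    obtain ⟨p, x, y⟩ := q
    simp only at e1 e2 e3
    subst e1 e2 e3
    induction t with
    | var n => exact .ax (Or.inl ⟨⟨i, rfl, by simp [ATerm.code, ATerm.substAll]⟩, by simp [ATerm.code]⟩)
    | zero => exact .ax (Or.inr ⟨rfl, rfl, (σ i 0).code, i, rfl, rfl⟩)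
    | succ t ih => exact .st ih ih ⟨rfl, rfl, Or.inl ⟨rfl, rfl⟩⟩
    | add t s ih1 ih2 => exact .st ih1 ih2 ⟨rfl, rfl, Or.inr (Or.inl ⟨rfl, rfl⟩)⟩
    | mul t s ih1 ih2 => exact .st ih1 ih2 ⟨rfl, rfl, Or.inr (Or.inr ⟨rfl, rfl⟩)⟩
  · intro h
    change Cl (Ax ()) (St ()) q at h
    induction h with
    | @ax q h =>
      obtain ⟨p, x, y⟩ := q
      rcases h with ⟨⟨i, e1, e2⟩, e3⟩ | ⟨e1, e2, y', i, e3, e4⟩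
      · refine ⟨i, .var x.unpair.2, e1, ?_, e2⟩
        simp only at e3
        show x = Nat.pair 0 _
        rw [← e3, Nat.pair_unpair]
      · exact ⟨i, .zero, e3, e1, e2⟩
    | @st q a b h1 h2 h3 ih1 ih2 =>
      obtain ⟨p, x, y⟩ := q
      obtain ⟨pa, xa, ya⟩ := a
      obtain ⟨pb, xb, yb⟩ := b
      obtain ⟨i, t, e1, e2, e3⟩ := ih1
      obtain ⟨j, s, d1, d2, d3⟩ := ih2
      simp only at e1 e2 e3 d1 d2 d3
      obtain ⟨f1, f2, f3⟩ := h3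
      simp only at f1 f2 f3
      subst f1 e1
      obtain rfl := hc (f2.symm.trans d1)
      subst e2 e3 d2 d3
      rcases f3 with ⟨g1, g2⟩ | ⟨g1, g2⟩ | ⟨g1, g2⟩
      · exact ⟨i, .succ t, rfl, g1, g2⟩
      · exact ⟨i, .add t s, rfl, g1, g2⟩
      · exact ⟨i, .mul t s, rfl, g1, g2⟩

theorem FR_re (hc : Function.Injective c) (hB : RE (BR c σ)) (hS : RE (ShR c sh))
    (hsh : ∀ i, liftSub (σ i) = σ (sh i)) : RE (FR c σ) := by
  have hT := TR_re c σ hc hB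
  let Ax : Unit → ℕ × ℕ × ℕ → Prop := fun _ q => ∃ t : (ℕ × ℕ) × ℕ × ℕ,
    TR c σ (q.1, t.1.1, t.1.2) ∧ TR c σ (q.1, t.2.1, t.2.2) ∧
    ((q.2.1 = Nat.pair 0 (Nat.pair t.1.1 t.2.1) ∧ q.2.2 = Nat.pair 0 (Nat.pair t.1.2 t.2.2)) ∨
     (q.2.1 = Nat.pair 1 (Nat.pair t.1.1 t.2.1) ∧ q.2.2 = Nat.pair 1 (Nat.pair t.1.2 t.2.2)))
  let St : Unit → ℕ × ℕ × ℕ → ℕ × ℕ × ℕ → ℕ × ℕ × ℕ → Prop := fun _ x a b =>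
    (a.1 = x.1 ∧ b.1 = x.1 ∧
    ((x.2.1 = Nat.pair 2 a.2.1 ∧ x.2.2 = Nat.pair 2 a.2.2) ∨
     (x.2.1 = Nat.pair 3 (Nat.pair a.2.1 b.2.1) ∧ x.2.2 = Nat.pair 3 (Nat.pair a.2.2 b.2.2)) ∨
     (x.2.1 = Nat.pair 4 (Nat.pair a.2.1 b.2.1) ∧ x.2.2 = Nat.pair 4 (Nat.pair a.2.2 b.2.2)) ∨
     (x.2.1 = Nat.pair 5 (Nat.pair a.2.1 b.2.1) ∧ x.2.2 = Nat.pair 5 (Nat.pair a.2.2 b.2.2)))) ∨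
    (ShR c sh (x.1, a.1) ∧
     ((x.2.1 = Nat.pair 6 a.2.1 ∧ x.2.2 = Nat.pair 6 a.2.2) ∨
      (x.2.1 = Nat.pair 7 a.2.1 ∧ x.2.2 = Nat.pair 7 a.2.2)))
  have h1 : RE (fun p : Unit × ℕ × ℕ × ℕ => Ax p.1 p.2) := by
    refine RE.ex (RE.and ?_ (RE.and ?_ (RE.or ?_ ?_)))
    · exact hT.comp (g := fun p : (Unit × ℕ × ℕ × ℕ) × (ℕ × ℕ) × ℕ × ℕ =>
        (p.1.2.1, p.2.1.1, p.2.1.2)) (by fun_prop)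
    · exact hT.comp (g := fun p : (Unit × ℕ × ℕ × ℕ) × (ℕ × ℕ) × ℕ × ℕ =>
        (p.1.2.1, p.2.2.1, p.2.2.2)) (by fun_prop)
    all_goals exact RE.and (.eq (by fun_prop) (by fun_prop)) (.eq (by fun_prop) (by fun_prop))
  have h2 : RE (fun p : Unit × (ℕ × ℕ × ℕ) × (ℕ × ℕ × ℕ) × (ℕ × ℕ × ℕ) =>
      St p.1 p.2.1 p.2.2.1 p.2.2.2) := by
    refine RE.or ?_ (RE.and ?_ (RE.or ?_ ?_))
    · refine RE.and (.eq (by fun_prop) (by fun_prop)) (RE.and (.eq (by fun_prop) (by fun_prop)) ?_)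
      refine RE.or ?_ (RE.or ?_ (RE.or ?_ ?_)) <;>
        exact RE.and (.eq (by fun_prop) (by fun_prop)) (.eq (by fun_prop) (by fun_prop))
    · exact hS.comp (g := fun p : Unit × (ℕ × ℕ × ℕ) × (ℕ × ℕ × ℕ) × (ℕ × ℕ × ℕ) =>
        (p.2.1.1, p.2.2.1.1)) (by fun_prop)
    all_goals exact RE.and (.eq (by fun_prop) (by fun_prop)) (.eq (by fun_prop) (by fun_prop))
  refine ((RE.cl h1 h2).comp (g := fun q : ℕ × ℕ × ℕ => ((), q)) (by fun_prop)).congr ?_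
  intro q
  constructor
  · rintro ⟨i, t, e1, e2, e3⟩
    show Cl (Ax ()) (St ()) q
    obtain ⟨p, x, y⟩ := q
    simp only at e1 e2 e3
    subst e1 e2 e3
    induction t generalizing i with
    | eq t s => exact .ax ⟨((t.code, (t.substAll (σ i)).code), (s.code, (s.substAll (σ i)).code)),
        ⟨i, t, rfl, rfl, rfl⟩, ⟨i, s, rfl, rfl, rfl⟩, Or.inl ⟨rfl, rfl⟩⟩
    | le t s => exact .ax ⟨((t.code, (t.substAll (σ i)).code), (s.code, (s.substAll (σ i)).code)),
        ⟨i, t, rfl, rfl, rfl⟩, ⟨i, s, rfl, rfl, rfl⟩, Or.inr ⟨rfl, rfl⟩⟩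
    | neg t ih => exact .st (ih i) (ih i) (Or.inl ⟨rfl, rfl, Or.inl ⟨rfl, rfl⟩⟩)
    | and t s ih1 ih2 => exact .st (ih1 i) (ih2 i) (Or.inl ⟨rfl, rfl, Or.inr (Or.inl ⟨rfl, rfl⟩)⟩)
    | or t s ih1 ih2 =>
      exact .st (ih1 i) (ih2 i) (Or.inl ⟨rfl, rfl, Or.inr (Or.inr (Or.inl ⟨rfl, rfl⟩))⟩)
    | imp t s ih1 ih2 =>
      exact .st (ih1 i) (ih2 i) (Or.inl ⟨rfl, rfl, Or.inr (Or.inr (Or.inr ⟨rfl, rfl⟩))⟩)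
    | all t ih =>
      refine .st (ih (sh i)) (ih (sh i)) (Or.inr ⟨⟨i, rfl, rfl⟩, Or.inl ⟨rfl, ?_⟩⟩)
      simp only [AFml.substAll, hsh]; rfl
    | ex t ih =>
      refine .st (ih (sh i)) (ih (sh i)) (Or.inr ⟨⟨i, rfl, rfl⟩, Or.inr ⟨rfl, ?_⟩⟩)
      simp only [AFml.substAll, hsh]; rfl
  · intro h
    change Cl (Ax ()) (St ()) q at h
    induction h with
    | @ax q h =>
      obtain ⟨p, x, y⟩ := q
      obtain ⟨⟨⟨x1, y1⟩, x2, y2⟩, ⟨i, t, e1, e2, e3⟩, ⟨j, s, d1, d2, d3⟩, f3⟩ := h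
      simp only at e1 e2 e3 d1 d2 d3 f3
      subst e1
      obtain rfl := hc d1
      subst e2 e3 d2 d3
      rcases f3 with ⟨g1, g2⟩ | ⟨g1, g2⟩
      · exact ⟨i, .eq t s, rfl, g1, g2⟩
      · exact ⟨i, .le t s, rfl, g1, g2⟩
    | @st q a b h1 h2 h3 ih1 ih2 =>
      obtain ⟨p, x, y⟩ := q
      obtain ⟨pa, xa, ya⟩ := a
      obtain ⟨pb, xb, yb⟩ := b
      obtain ⟨i, t, e1, e2, e3⟩ := ih1
      obtain ⟨j, s, d1, d2, d3⟩ := ih2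
      simp only at e1 e2 e3 d1 d2 d3
      rcases h3 with ⟨f1, f2, f3⟩ | ⟨⟨k, f1, f2⟩, f3⟩
      · simp only at f1 f2 f3
        subst f1 e1
        obtain rfl := hc (f2.symm.trans d1)
        subst e2 e3 d2 d3
        rcases f3 with ⟨g1, g2⟩ | ⟨g1, g2⟩ | ⟨g1, g2⟩ | ⟨g1, g2⟩
        · exact ⟨i, .neg t, rfl, g1, g2⟩
        · exact ⟨i, .and t s, rfl, g1, g2⟩
        · exact ⟨i, .or t s, rfl, g1, g2⟩
        · exact ⟨i, .imp t s, rfl, g1, g2⟩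
      · simp only at f1 f2 f3
        obtain rfl := hc (e1.symm.trans f2)
        subst f1 e2 e3
        rcases f3 with ⟨g1, g2⟩ | ⟨g1, g2⟩
        · exact ⟨k, .all t, rfl, g1, by simp only [AFml.substAll, hsh]; exact g2⟩
        · exact ⟨k, .ex t, rfl, g1, by simp only [AFml.substAll, hsh]; exact g2⟩
end rel

end Part5

section Part6

theorem BR_lift_re : RE (BR (id : ℕ → ℕ) liftRen) := by
  refine (RE.eq (α := ℕ × ℕ × ℕ) (β := ℕ) (f := fun q => q.2.2)
    (g := fun q => Nat.pair 0 (bif decide (q.2.1 < q.1) then q.2.1 else q.2.1 + 1))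
    (by fun_prop) (by fun_prop)).congr ?_
  rintro ⟨p, n, y⟩
  constructor
  · rintro ⟨i, hi, h⟩
    have hi : i = p := hi.symm
    rw [hi] at h
    refine h.trans ?_
    by_cases hh : n < p <;> simp [liftRen, ATerm.code, hh]
  · intro h
    refine ⟨p, rfl, h.trans ?_⟩
    by_cases hh : n < p <;> simp [liftRen, ATerm.code, hh]

theorem liftT_re : RE (TR (id : ℕ → ℕ) liftRen) := TR_re _ _ Function.injective_id BR_lift_re
theorem liftF_re : RE (FR (id : ℕ → ℕ) liftRen) :=
  FR_re _ _ Nat.succ Function.injective_id BR_lift_re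
    ((RE.eq (α := ℕ × ℕ) (f := fun q => q.2) (g := fun q => q.1 + 1)
      (by fun_prop) (by fun_prop)).congr (by
        rintro ⟨a, b⟩
        constructor
        · rintro ⟨i, h, h2⟩; simp only [id] at h h2; subst h h2; rfl
        · intro h; exact ⟨a, rfl, h⟩))
    liftSub_liftRen

def sigS (p : ℕ × ATerm) (n : ℕ) : ATerm :=
  if n < p.1 then .var n else if n = p.1 then p.2 else .var (n - 1)
def codeS (p : ℕ × ATerm) : ℕ := Nat.pair p.1 p.2.code
def shS (p : ℕ × ATerm) : ℕ × ATerm := (p.1 + 1, p.2.lift 0)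

theorem codeS_inj : Function.Injective codeS := by
  rintro ⟨a, t⟩ ⟨b, s⟩ h
  simp only [codeS, Nat.pair_eq_pair] at h
  rw [h.1, ATerm.code_inj h.2]

theorem sigS_sh (i : ℕ × ATerm) : liftSub (sigS i) = sigS (shS i) := by
  funext n
  obtain ⟨d, t⟩ := i
  cases n with
  | zero => simp [liftSub, sigS, shS]
  | succ n =>
    simp only [liftSub, sigS, shS, Nat.add_lt_add_iff_right, Nat.add_right_cancel_iff]
    split_ifs with h1 h2
    · simp [ATerm.lift]
    · rfl
    · simp only [ATerm.lift, Nat.not_lt_zero, if_false, ATerm.var.injEq]; omega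

theorem sigS_zero (t : ATerm) : sigS (0, t) = subst0Env t := by
  funext n; cases n <;> simp [sigS, subst0Env]

def IsT (x : ℕ) : Prop := ∃ t : ATerm, x = t.code
def IsF (x : ℕ) : Prop := ∃ φ : AFml, x = φ.code
theorem isT_re : RE IsT := by
  refine (RE.ex (α := ℕ) (β := ℕ) (R := fun x y => TR id liftRen (0, x, y))
    (liftT_re.comp (g := fun p : ℕ × ℕ => (0, p.1, p.2)) (by fun_prop))).congr ?_
  intro x
  constructor
  · rintro ⟨t, rfl⟩; exact ⟨_, 0, t, rfl, rfl, rfl⟩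
  · rintro ⟨y, i, t, _, h, _⟩; exact ⟨t, h⟩
theorem isF_re : RE IsF := by
  refine (RE.ex (α := ℕ) (β := ℕ) (R := fun x y => FR id liftRen (0, x, y))
    (liftF_re.comp (g := fun p : ℕ × ℕ => (0, p.1, p.2)) (by fun_prop))).congr ?_
  intro x
  constructor
  · rintro ⟨t, rfl⟩; exact ⟨_, 0, t, rfl, rfl, rfl⟩
  · rintro ⟨y, i, t, _, h, _⟩; exact ⟨t, h⟩

theorem BR_sub_re : RE (BR codeS sigS) := by
  refine ((isT_re.comp (g := fun q : ℕ × ℕ × ℕ => q.1.unpair.2) (by fun_prop)).and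
    (RE.eq (α := ℕ × ℕ × ℕ) (β := ℕ) (f := fun q => q.2.2)
    (g := fun q => bif decide (q.2.1 < q.1.unpair.1) then Nat.pair 0 q.2.1 else
      bif decide (q.2.1 = q.1.unpair.1) then q.1.unpair.2 else Nat.pair 0 (q.2.1 - 1))
    (by fun_prop) (by fun_prop))).congr ?_
  have key : ∀ d t n, (sigS (d, t) n).code = bif decide (n < d) then Nat.pair 0 n else
      bif decide (n = d) then t.code else Nat.pair 0 (n - 1) := by
    intro d t n
    by_cases h1 : n < d
    · simp [sigS, h1, ATerm.code]
    · by_cases h2 : n = d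
      · simp [sigS, h2]
      · simp [sigS, h1, h2, ATerm.code]
  rintro ⟨p, n, y⟩
  constructor
  · rintro ⟨⟨d, t⟩, h1, h2⟩
    simp only [codeS] at h1
    subst h1
    refine ⟨⟨t, by simp⟩, ?_⟩
    simp only [Nat.unpair_pair]
    exact h2.trans (key _ _ _)
  · rintro ⟨⟨t, h1⟩, h2⟩
    simp only at h1 h2
    refine ⟨(p.unpair.1, t), ?_, ?_⟩
    · simp only [codeS]; rw [← h1, Nat.pair_unpair]
    · rw [h1] at h2; exact h2.trans (key _ _ _).symm

theorem subF_re : RE (FR codeS sigS) := by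
  refine FR_re _ _ shS codeS_inj BR_sub_re ?_ sigS_sh
  refine ((RE.eq (α := ℕ × ℕ) (β := ℕ) (f := fun q => q.2.unpair.1) (g := fun q => q.1.unpair.1 + 1)
    (by fun_prop) (by fun_prop)).and (liftT_re.comp (g := fun q : ℕ × ℕ =>
      (0, q.1.unpair.2, q.2.unpair.2)) (by fun_prop))).congr ?_
  rintro ⟨p, p'⟩
  constructor
  · rintro ⟨⟨d, t⟩, h1, h2⟩
    simp only [codeS, shS] at h1 h2
    subst h1 h2
    refine ⟨by simp, 0, t, rfl, by simp, by simp [ATerm.lift_eq]⟩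
  · rintro ⟨h, i, t, h0, h1, h2⟩
    simp only [id] at h h0 h1 h2
    subst h0
    refine ⟨(p.unpair.1, t), ?_, ?_⟩
    · simp only [codeS]; rw [← h1, Nat.pair_unpair]
    · simp only [codeS, shS]; rw [ATerm.lift_eq, ← h, ← h2, Nat.pair_unpair]

/-- `S0 u a b`: b is the code of the substitution instance -/
def S0 (u a b : ℕ) : Prop := ∃ (φ : AFml) (t : ATerm), u = t.code ∧ a = φ.code ∧ b = (φ.subst0 t).code
theorem S0_re : RE (fun q : ℕ × ℕ × ℕ => S0 q.1 q.2.1 q.2.2) := by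
  refine (subF_re.comp (g := fun q : ℕ × ℕ × ℕ => (Nat.pair 0 q.1, q.2.1, q.2.2)) (by fun_prop)).congr ?_
  rintro ⟨u, a, b⟩
  constructor
  · rintro ⟨φ, t, h1, h2, h3⟩
    exact ⟨(0, t), φ, by simp only [codeS]; rw [← h1], h2, by rw [sigS_zero]; exact h3⟩
  · rintro ⟨⟨d, t⟩, φ, h1, h2, h3⟩
    simp only [codeS, Nat.pair_eq_pair] at h1
    obtain ⟨rfl, h1⟩ := h1
    rw [sigS_zero] at h3
    exact ⟨φ, t, h1, h2, h3⟩

/-! ### propositional evaluation -/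
theorem pr_pow2 {α : Type} [Primcodable α] {f : α → ℕ} (hf : Primrec f) : Primrec (fun x => 2 ^ f x) := by
  refine (pr_rec hf (pr_const 1) (h := fun _ _ r => r * 2) (by fun_prop)).of_eq ?_
  intro a
  induction f a with
  | zero => rfl
  | succ n ih => rw [pow_succ, ← ih]

def evG (k : ℕ) (l : List Bool) : Bool :=
  bif decide (l.length.unpair.1 = 2) then !(l.getD l.length.unpair.2 false) else
  bif decide (l.length.unpair.1 = 3) then
    (l.getD l.length.unpair.2.unpair.1 false && l.getD l.length.unpair.2.unpair.2 false) else
  bif decide (l.length.unpair.1 = 4) then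
    (l.getD l.length.unpair.2.unpair.1 false || l.getD l.length.unpair.2.unpair.2 false) else
  bif decide (l.length.unpair.1 = 5) then
    (!(l.getD l.length.unpair.2.unpair.1 false) || l.getD l.length.unpair.2.unpair.2 false) else
  decide ((k / 2 ^ l.length) % 2 = 1)
def evalc : ℕ → ℕ → Bool := sr evG
theorem evalc_prim : Primrec (fun p : ℕ × ℕ => evalc p.1 p.2) := by
  refine sr_prim ?_
  have : Primrec (fun p : ℕ × List Bool => 2 ^ p.2.length) := pr_pow2 (by fun_prop)
  unfold evG
  fun_prop

theorem pair_lt_of (t a : ℕ) (h : 1 ≤ t) : a < Nat.pair t a := by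
  have := Nat.add_le_pair t a
  omega
theorem pair2_lt (t a b : ℕ) (h : 1 ≤ t) : a < Nat.pair t (Nat.pair a b) ∧ b < Nat.pair t (Nat.pair a b) := by
  have h1 := Nat.left_le_pair a b
  have h2 := Nat.right_le_pair a b
  have h3 := pair_lt_of t (Nat.pair a b) h
  omega

theorem evalc_eq (k x : ℕ) : evalc k x = evG k ((List.range x).map (evalc k)) := sr_eq _ _ _

theorem evalc_code (k : ℕ) (φ : AFml) :
    evalc k φ.code = true ↔ φ.evalProp (fun ψ => (k / 2 ^ ψ.code) % 2 = 1) := by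
  induction φ with
  | neg φ ih =>
    rw [evalc_eq]
    simp only [evG, AFml.code, List.length_map, List.length_range, Nat.unpair_pair]
    rw [getD_map_range _ _ _ _ (pair_lt_of _ _ (by omega))]
    simp [AFml.evalProp, ← ih]
  | and φ ψ ih1 ih2 | or φ ψ ih1 ih2 | imp φ ψ ih1 ih2 =>
    rw [evalc_eq]
    simp only [evG, AFml.code, List.length_map, List.length_range, Nat.unpair_pair]
    rw [getD_map_range _ _ _ _ (pair2_lt _ _ _ (by omega)).1,
      getD_map_range _ _ _ _ (pair2_lt _ _ _ (by omega)).2]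
    simp [AFml.evalProp, ← ih1, ← ih2] <;>
    cases evalc k φ.code <;> simp
  | _ =>
    rw [evalc_eq]
    simp [evG, AFml.code, AFml.evalProp]

theorem evalProp_congr {v v' : AFml → Prop} (φ : AFml) (h : ∀ ψ, ψ.code ≤ φ.code → (v ψ ↔ v' ψ)) :
    φ.evalProp v ↔ φ.evalProp v' := by
  induction φ with
  | neg φ ih =>
    have := ih (fun ψ hψ => h ψ (hψ.trans (Nat.right_le_pair _ _)))
    simp [AFml.evalProp, this]
  | and φ ψ ih1 ih2 | or φ ψ ih1 ih2 | imp φ ψ ih1 ih2 =>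
    have h1 := ih1 (fun ψ hψ => h ψ (hψ.trans (pair2_le _ _ _).1))
    have h2 := ih2 (fun ψ hψ => h ψ (hψ.trans (pair2_le _ _ _).2))
    simp [AFml.evalProp, h1, h2]
  | _ => exact h _ (le_refl _)

def tautC (x : ℕ) : Bool := !(anyLt (2 ^ (x + 1)) (fun k => !(evalc k x)))
theorem tautC_prim : Primrec tautC := by
  refine pr_not (pr_anyLt (pr_pow2 (by fun_prop)) (pr_not ?_))
  exact evalc_prim.comp (g := fun p : ℕ × ℕ => (p.2, p.1)) (by fun_prop)

theorem tautC_iff (φ : AFml) : tautC φ.code = true ↔ ATaut φ := by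
  have : tautC φ.code = true ↔ ∀ k < 2 ^ (φ.code + 1), evalc k φ.code = true := by
    rw [tautC, Bool.not_eq_true', ← Bool.not_eq_true, anyLt_iff]
    simp
  rw [this]
  constructor
  · intro h v
    classical
    let k := Nat.ofBits (fun i : Fin (φ.code + 1) => decide (∃ ψ : AFml, ψ.code = i ∧ v ψ))
    have hk := h k (Nat.ofBits_lt_two_pow _)
    rw [evalc_code] at hk
    refine (evalProp_congr φ ?_).1 hk
    intro ψ hψ
    have h1 : k.testBit ψ.code = decide (∃ χ : AFml, χ.code = ψ.code ∧ v χ) :=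
      Nat.testBit_ofBits_lt _ _ (by omega)
    have h2 : k.testBit ψ.code = true ↔ (k / 2 ^ ψ.code) % 2 = 1 := by
      rw [Nat.testBit_eq_decide_div_mod_eq]; simp
    rw [← h2, h1, decide_eq_true_eq]
    constructor
    · rintro ⟨χ, h, h'⟩; rw [← AFml.code_inj h]; exact h'
    · intro h; exact ⟨ψ, rfl, h⟩
  · intro h k _
    rw [evalc_code]; exact h _

end Part6

section Part7

/-! ### provability is r.e. -/
def PrvC (Tax : Set AFml) (x : ℕ) : Prop := ∃ φ : AFml, x = φ.code ∧ Proves Tax φ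

theorem prvC_code {Tax : Set AFml} (φ : AFml) : PrvC Tax φ.code ↔ Proves Tax φ := by
  constructor
  · rintro ⟨ψ, h, h2⟩; rw [AFml.code_inj h]; exact h2
  · intro h; exact ⟨φ, rfl, h⟩

def impC (a b : ℕ) : ℕ := Nat.pair 5 (Nat.pair a b)
@[fun_prop] theorem pr_impC {α : Type} [Primcodable α] {f g : α → ℕ} (hf : Primrec f)
    (hg : Primrec g) : Primrec (fun x => impC (f x) (g x)) := by unfold impC; fun_prop

theorem PrvC_re {Tax : Set AFml} (hpr : PrAxiomatized Tax) : RE (PrvC Tax) := by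
  obtain ⟨p, hp, hpax⟩ := hpr
  let Ax : Unit → ℕ → Prop := fun _ x =>
    (IsF x ∧ (p x = true ∨ tautC x = true)) ∨
    (∃ q : ℕ × ℕ × ℕ, S0 q.1 q.2.1 q.2.2 ∧
      (x = impC (Nat.pair 6 q.2.1) q.2.2 ∨ x = impC q.2.2 (Nat.pair 7 q.2.1) ∨
        ∃ r : ℕ × ℕ, S0 r.1 q.2.1 r.2 ∧
          x = impC (Nat.pair 0 (Nat.pair q.1 r.1)) (impC q.2.2 r.2))) ∨
    (∃ a : ℕ, IsF a ∧
      ((∃ b : ℕ, IsF b ∧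
        x = impC (Nat.pair 6 (impC a b)) (impC (Nat.pair 6 a) (Nat.pair 6 b))) ∨
      (∃ b : ℕ, FR id liftRen (0, a, b) ∧ x = impC a (Nat.pair 6 b)) ∨
      x = Nat.pair 3 (Nat.pair (impC (Nat.pair 7 a) (Nat.pair 2 (Nat.pair 6 (Nat.pair 2 a))))
        (impC (Nat.pair 2 (Nat.pair 6 (Nat.pair 2 a))) (Nat.pair 7 a))))) ∨
    (∃ t : ℕ, IsT t ∧ x = Nat.pair 0 (Nat.pair t t))
  let St : Unit → ℕ → ℕ → ℕ → Prop := fun _ x a b => a = impC b x ∨ x = Nat.pair 6 a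
  have h1 : RE (fun p : Unit × ℕ => Ax p.1 p.2) := by
    refine RE.or ?_ (RE.or ?_ (RE.or ?_ ?_))
    · exact (isF_re.comp (g := fun p : Unit × ℕ => p.2) (by fun_prop)).and
        (((RE.ofPrim hp).comp (g := fun p : Unit × ℕ => p.2) (by fun_prop)).or
        ((RE.ofPrim tautC_prim).comp (g := fun p : Unit × ℕ => p.2) (by fun_prop)))
    · refine RE.ex (RE.and ?_ (RE.or ?_ (RE.or ?_ (RE.ex (RE.and ?_ ?_)))))
      · exact S0_re.comp (g := fun p : (Unit × ℕ) × ℕ × ℕ × ℕ => p.2) (by fun_prop)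
      · exact .eq (by fun_prop) (by fun_prop)
      · exact .eq (by fun_prop) (by fun_prop)
      · exact S0_re.comp (g := fun p : ((Unit × ℕ) × ℕ × ℕ × ℕ) × ℕ × ℕ =>
          (p.2.1, p.1.2.2.1, p.2.2)) (by fun_prop)
      · exact .eq (by fun_prop) (by fun_prop)
    · refine RE.ex (RE.and ?_ (RE.or (RE.ex (RE.and ?_ ?_)) (RE.or (RE.ex (RE.and ?_ ?_)) ?_)))
      · exact isF_re.comp (g := fun p : (Unit × ℕ) × ℕ => p.2) (by fun_prop)
      · exact isF_re.comp (g := fun p : ((Unit × ℕ) × ℕ) × ℕ => p.2) (by fun_prop)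
      · exact .eq (by fun_prop) (by fun_prop)
      · exact liftF_re.comp (g := fun p : ((Unit × ℕ) × ℕ) × ℕ => (0, p.1.2, p.2)) (by fun_prop)
      · exact .eq (by fun_prop) (by fun_prop)
      · exact .eq (by fun_prop) (by fun_prop)
    · refine RE.ex (RE.and ?_ ?_)
      · exact isT_re.comp (g := fun p : (Unit × ℕ) × ℕ => p.2) (by fun_prop)
      · exact .eq (by fun_prop) (by fun_prop)
  have h2 : RE (fun p : Unit × ℕ × ℕ × ℕ => St p.1 p.2.1 p.2.2.1 p.2.2.2) :=
    RE.or (.eq (by fun_prop) (by fun_prop)) (.eq (by fun_prop) (by fun_prop))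
  refine ((RE.cl h1 h2).comp (g := fun q : ℕ => ((), q)) (by fun_prop)).congr ?_
  intro x
  show _ ↔ Cl (Ax ()) (St ()) x
  constructor
  · rintro ⟨φ, rfl, h⟩
    induction h with
    | @ax φ h => exact .ax (Or.inl ⟨⟨φ, rfl⟩, Or.inl ((hpax φ).1 h)⟩)
    | @taut φ h => exact .ax (Or.inl ⟨⟨φ, rfl⟩, Or.inr ((tautC_iff φ).2 h)⟩)
    | mp _ _ i1 i2 => exact .st i1 i2 (Or.inl rfl)
    | allE φ t =>
      exact .ax (Or.inr (Or.inl ⟨(t.code, φ.code, (φ.subst0 t).code), ⟨φ, t, rfl, rfl, rfl⟩,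
        Or.inl rfl⟩))
    | exI φ t =>
      exact .ax (Or.inr (Or.inl ⟨(t.code, φ.code, (φ.subst0 t).code), ⟨φ, t, rfl, rfl, rfl⟩,
        Or.inr (Or.inl rfl)⟩))
    | allImp φ ψ =>
      exact .ax (Or.inr (Or.inr (Or.inl ⟨φ.code, ⟨φ, rfl⟩, Or.inl ⟨ψ.code, ⟨ψ, rfl⟩, rfl⟩⟩)))
    | vacAll φ =>
      refine .ax (Or.inr (Or.inr (Or.inl ⟨φ.code, ⟨φ, rfl⟩, Or.inr (Or.inl ⟨(φ.lift 0).code,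
        ⟨0, φ, rfl, rfl, ?_⟩, rfl⟩)⟩)))
      rw [AFml.lift_eq]
    | exDef φ =>
      exact .ax (Or.inr (Or.inr (Or.inl ⟨φ.code, ⟨φ, rfl⟩, Or.inr (Or.inr rfl)⟩)))
    | gen _ ih => exact .st ih ih (Or.inr rfl)
    | eqRefl t => exact .ax (Or.inr (Or.inr (Or.inr ⟨t.code, ⟨t, rfl⟩, rfl⟩)))
    | eqSubst φ t s =>
      exact .ax (Or.inr (Or.inl ⟨(t.code, φ.code, (φ.subst0 t).code), ⟨φ, t, rfl, rfl, rfl⟩,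
        Or.inr (Or.inr ⟨(s.code, (φ.subst0 s).code), ⟨φ, s, rfl, rfl, rfl⟩, rfl⟩)⟩))
  · intro h
    induction h with
    | @ax x h =>
      rcases h with ⟨⟨φ, rfl⟩, h | h⟩ | ⟨⟨u, a, b⟩, ⟨φ, t, h1, h2, h3⟩, h⟩ | ⟨a, ⟨φ, rfl⟩, h⟩ | ⟨t', ⟨t, rfl⟩, rfl⟩
      · exact ⟨φ, rfl, .ax ((hpax φ).2 h)⟩
      · exact ⟨φ, rfl, .taut ((tautC_iff φ).1 h)⟩
      · simp only at h1 h2 h3 h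
        subst h1 h2 h3
        rcases h with rfl | rfl | ⟨⟨v, b'⟩, ⟨φ', s, g1, g2, g3⟩, h⟩
        · exact ⟨_, rfl, .allE φ t⟩
        · exact ⟨_, rfl, .exI φ t⟩
        · simp only at g1 g2 g3 h
          have := AFml.code_inj g2
          subst this g1 g3 h
          exact ⟨_, rfl, .eqSubst φ t s⟩
      · rcases h with ⟨b, ⟨ψ, rfl⟩, rfl⟩ | ⟨b, ⟨i, ψ, h1, h2, h3⟩, rfl⟩ | rfl
        · exact ⟨_, rfl, .allImp φ ψ⟩
        · simp only [id] at h1 h2 h3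
          have := AFml.code_inj h2
          subst h1 this h3
          rw [← AFml.lift_eq]
          exact ⟨_, rfl, .vacAll φ⟩
        · exact ⟨_, rfl, .exDef φ⟩
      · exact ⟨_, rfl, .eqRefl t⟩
    | @st x a b _ _ h ih1 ih2 =>
      obtain ⟨φ, rfl, h1⟩ := ih1
      obtain ⟨ψ, rfl, h2⟩ := ih2
      rcases h with h | rfl
      · cases φ with
        | imp φ χ =>
          simp only [AFml.code, impC, Nat.pair_eq_pair] at h
          have := AFml.code_inj h.2.1
          subst this
          exact ⟨χ, h.2.2.symm, h1.mp h2⟩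
        | _ => simp [AFml.code, impC, Nat.pair_eq_pair] at h
      · exact ⟨_, rfl, h1.gen⟩

end Part7

section Part8

/-! ## Part 6: the self-referential predicate, numerically -/

def nc (x : ℕ) : ℕ := (numeral x).code
theorem nc_prim : Primrec nc := by
  refine (pr_rec (pr_id (α := ℕ)) (pr_const (Nat.pair 1 0)) (h := fun _ _ r => Nat.pair 2 r)
    (by fun_prop)).of_eq ?_
  intro a
  induction a with
  | zero => rfl
  | succ n ih => simp only at ih ⊢; rw [ih]; rfl
@[fun_prop] theorem pr_nc {α : Type} [Primcodable α] {f : α → ℕ} (hf : Primrec f) :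
    Primrec (fun x => nc (f x)) := nc_prim.comp hf
theorem le_nc (x : ℕ) : x ≤ nc x := by
  induction x with
  | zero => exact Nat.zero_le _
  | succ n ih =>
    have : nc (n + 1) = Nat.pair 2 (nc n) := rfl
    have h := pair_lt_of 2 (nc n) (by omega)
    omega
theorem numeral_inj {a b : ℕ} (h : numeral a = numeral b) : a = b := by
  induction a generalizing b with
  | zero => cases b with
    | zero => rfl
    | succ b => simp [numeral] at h
  | succ a ih => cases b with
    | zero => simp [numeral] at h
    | succ b => simp only [numeral, ATerm.succ.injEq] at h; rw [ih h]

def hc (g : ℕ) : ℕ := Nat.pair 7 (Nat.pair 3 (Nat.pair (Nat.pair 0 (Nat.pair (Nat.pair 0 0) (nc g))) g))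
def App (g x : ℕ) : ℕ := Nat.pair 7 (Nat.pair 3 (Nat.pair (Nat.pair 0 (Nat.pair (Nat.pair 0 0)
  (Nat.pair 3 (Nat.pair (nc x) (nc x))))) (hc g)))
def QN (g i : ℕ) : ℕ := Nat.pair 7 (Nat.pair 3 (Nat.pair (Nat.pair 0 (Nat.pair (Nat.pair 0 0)
  (nc (2 * i + 1)))) (hc g)))
@[fun_prop] theorem pr_App {α : Type} [Primcodable α] {f g : α → ℕ} (hf : Primrec f)
    (hg : Primrec g) : Primrec (fun x => App (f x) (g x)) := by unfold App hc; fun_prop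
@[fun_prop] theorem pr_QN {α : Type} [Primcodable α] {f g : α → ℕ} (hf : Primrec f)
    (hg : Primrec g) : Primrec (fun x => QN (f x) (g x)) := by unfold QN hc; fun_prop

def Hf (F : AFml) : AFml := .ex (.and (.eq (.var 0) (numeral F.code)) F)
def Pf (F : AFml) : AFml := .ex (.and (.eq (.var 0) (.add (.var 1) (.var 1))) (Hf F))
/-- the instance of `Pf F` at the number `x` -/
def PfN (F : AFml) (x : ℕ) : AFml :=
  .ex (.and (.eq (.var 0) (.add (numeral x) (numeral x))) (Hf F))
def Qf (F : AFml) (i : ℕ) : AFml := .ex (.and (.eq (.var 0) (numeral (2 * i + 1))) (Hf F))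

theorem PfN_code (F : AFml) (x : ℕ) : (PfN F x).code = App F.code x := rfl
theorem Qf_code (F : AFml) (i : ℕ) : (Qf F i).code = QN F.code i := rfl

theorem numeral_freeLt (c k : ℕ) : (numeral k).FreeLt c := by
  induction k with
  | zero => trivial
  | succ k ih => exact ih
theorem numeral_subst (σ : ℕ → ATerm) (k : ℕ) : (numeral k).substAll σ = numeral k := by
  induction k with
  | zero => rfl
  | succ k ih => simp [numeral, ATerm.substAll, ih]
theorem numeral_lift (c k : ℕ) : (numeral k).lift c = numeral k := by
  rw [ATerm.lift_eq, numeral_subst]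

theorem Hf_freeLt {F : AFml} (hF : F.FreeLt 2) : (Hf F).FreeLt 1 :=
  ⟨⟨by simp [ATerm.FreeLt], numeral_freeLt _ _⟩, hF⟩
theorem Pf_freeLt {F : AFml} (hF : F.FreeLt 2) : (Pf F).FreeLt 1 :=
  ⟨⟨by simp [ATerm.FreeLt], by simp [ATerm.FreeLt]⟩, (Hf_freeLt hF).mono (by omega)⟩
theorem PfN_freeLt {F : AFml} (hF : F.FreeLt 2) (x : ℕ) : (PfN F x).FreeLt 0 :=
  ⟨⟨by simp [ATerm.FreeLt], numeral_freeLt _ _, numeral_freeLt _ _⟩, Hf_freeLt hF⟩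
theorem Qf_freeLt {F : AFml} (hF : F.FreeLt 2) (x : ℕ) : (Qf F x).FreeLt 0 :=
  ⟨⟨by simp [ATerm.FreeLt], numeral_freeLt _ _⟩, Hf_freeLt hF⟩

theorem Pf_appNum {F : AFml} (hF : F.FreeLt 2) (φ : AFml) : (Pf F).appNum φ = PfN F φ.code := by
  have h1 : (Hf F).substAll (liftSub (subst0Env (numeral φ.code))) = Hf F := by
    conv_rhs => rw [← AFml.substAll_var (Hf F)]
    refine AFml.substAll_congr (c := 1) ?_ _ (Hf_freeLt hF)
    intro i hi
    obtain rfl : i = 0 := by omega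
    rfl
  simp only [AFml.appNum, AFml.subst0, Pf, gnum, AFml.substAll, h1]
  simp [PfN, ATerm.substAll, liftSub, subst0Env, numeral_lift]

/-- the canonical interpretation -/
def itp (F : AFml) : MFml → AFml
  | .var i => Qf F i
  | .bot => botFml
  | .neg A => .neg (itp F A)
  | .and A B => .and (itp F A) (itp F B)
  | .or A B => .or (itp F A) (itp F B)
  | .imp A B => .imp (itp F A) (itp F B)
  | .box A => PfN F (itp F A).code

theorem itp_isInterp {F : AFml} (hF : F.FreeLt 2) : IsInterp (Pf F) (itp F) :=
  ⟨fun i => Qf_freeLt hF i, rfl, fun _ => rfl, fun _ _ => rfl, fun _ _ => rfl, fun _ _ => rfl,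
    fun A => (Pf_appNum hF _).symm⟩

theorem PfN_inj {F : AFml} {a b : ℕ} (h : PfN F a = PfN F b) : a = b := by
  simp only [PfN, AFml.ex.injEq, AFml.and.injEq, AFml.eq.injEq, ATerm.add.injEq] at h
  exact numeral_inj h.1.2.1
theorem Qf_inj {F : AFml} {a b : ℕ} (h : Qf F a = Qf F b) : a = b := by
  simp only [Qf, AFml.ex.injEq, AFml.and.injEq, AFml.eq.injEq] at h
  have := numeral_inj h.1.2
  omega
theorem PfN_ne_Qf {F : AFml} (a b : ℕ) : PfN F a ≠ Qf F b := by
  intro h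
  simp [PfN, Qf, numeral] at h

theorem itp_inj {F : AFml} {A B : MFml} (h : itp F A = itp F B) : A = B := by
  induction A generalizing B with
  | var i =>
    cases B <;> simp only [itp] at h
    case var j => rw [Qf_inj h]
    case box => exact absurd h.symm (PfN_ne_Qf _ _)
    all_goals simp [Qf, botFml] at h
  | box A ih =>
    cases B <;> simp only [itp] at h
    case var j => exact absurd h (PfN_ne_Qf _ _)
    case box B => rw [ih (AFml.code_inj (PfN_inj h))]
    all_goals simp [PfN, botFml] at h
  | bot => cases B <;> simp [itp, Qf, PfN, botFml] at h ⊢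
  | neg A ih => 
    cases B <;> simp [itp, Qf, PfN, botFml] at h ⊢
    exact ih h
  | and A A' i1 i2 | or A A' i1 i2 | imp A A' i1 i2 =>
    cases B <;> simp [itp, Qf, PfN, botFml] at h ⊢
    exact ⟨i1 h.1, i2 h.2⟩

theorem lt_App (g x : ℕ) : x < App g x := by
  have h0 := le_nc x
  have h1 := (pair2_lt 3 (nc x) (nc x) (by omega)).1
  have h2 := (pair2_le 0 (Nat.pair 0 0) (Nat.pair 3 (Nat.pair (nc x) (nc x)))).2
  have h3 := (pair2_lt 3 (Nat.pair 0 (Nat.pair (Nat.pair 0 0) (Nat.pair 3 (Nat.pair (nc x) (nc x))))) (hc g)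
    (by omega)).1
  have h4 := pair_lt_of 7 (Nat.pair 3 (Nat.pair (Nat.pair 0 (Nat.pair (Nat.pair 0 0)
    (Nat.pair 3 (Nat.pair (nc x) (nc x))))) (hc g))) (by omega)
  unfold App
  omega
theorem lt_QN (g i : ℕ) : i < QN g i := by
  have h0 := le_nc (2 * i + 1)
  have h2 := (pair2_le 0 (Nat.pair 0 0) (nc (2 * i + 1))).2
  have h3 := (pair2_lt 3 (Nat.pair 0 (Nat.pair (Nat.pair 0 0) (nc (2 * i + 1)))) (hc g)
    (by omega)).1
  have h4 := pair_lt_of 7 (Nat.pair 3 (Nat.pair (Nat.pair 0 (Nat.pair (Nat.pair 0 0)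
    (nc (2 * i + 1)))) (hc g))) (by omega)
  unfold QN
  omega
theorem App_inj {g a b : ℕ} (h : App g a = App g b) : a = b := by
  simp only [App, Nat.pair_eq_pair] at h
  exact numeral_inj (ATerm.code_inj h.2.2.1.2.2.2.1)

/-! ### recognising interpreted formulas -/
@[irreducible] def botC : ℕ := botFml.code
theorem botC_eq : botFml.code = botC := by rw [botC]
def rfG (g : ℕ) (l : List Bool) : Bool :=
  decide (l.length = botC) || (anyLt l.length (fun i => decide (QN g i = l.length)) ||
  ((decide (l.length.unpair.1 = 2) && l.getD l.length.unpair.2 false) ||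
  (((decide (l.length.unpair.1 = 3) || (decide (l.length.unpair.1 = 4) || decide (l.length.unpair.1 = 5))) &&
    (l.getD l.length.unpair.2.unpair.1 false && l.getD l.length.unpair.2.unpair.2 false)) ||
  anyLt l.length (fun y => decide (App g y = l.length) && l.getD y false))))
def rf : ℕ → ℕ → Bool := sr rfG
theorem rf_eq (g x : ℕ) : rf g x = rfG g ((List.range x).map (rf g)) := sr_eq _ _ _
theorem rf_prim : Primrec (fun p : ℕ × ℕ => rf p.1 p.2) := by
  refine sr_prim ?_
  unfold rfG
  have h1 : Primrec (fun p : ℕ × List Bool => anyLt p.2.length (fun i => decide (QN p.1 i = p.2.length))) :=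
    pr_anyLt (by fun_prop) (by fun_prop)
  have h2 : Primrec (fun p : ℕ × List Bool =>
      anyLt p.2.length (fun y => decide (App p.1 y = p.2.length) && p.2.getD y false)) :=
    pr_anyLt (by fun_prop) (pr_and (pr_beq (pr_App (by fun_prop) (by fun_prop)) (by fun_prop))
      (pr_getD (by fun_prop) (by fun_prop)))
  have h3 : Primrec (fun p : ℕ × List Bool => p.2.length) := by fun_prop
  have h4 : Primrec (fun p : ℕ × List Bool => p.2.length.unpair.1) := by fun_prop
  refine pr_or (pr_beq h3 (pr_const _)) (pr_or h1 (pr_or (pr_and (pr_beq h4 (pr_const _)) ?_) (pr_or (pr_and (pr_or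
    (pr_beq h4 (pr_const _)) (pr_or (pr_beq h4 (pr_const _)) (pr_beq h4 (pr_const _)))) (pr_and ?_ ?_)) h2)))
  · exact pr_getD (by fun_prop) (by fun_prop)
  · exact pr_getD (by fun_prop) (by fun_prop)
  · exact pr_getD (by fun_prop) (by fun_prop)

theorem rf_iff (F : AFml) (x : ℕ) : rf F.code x = true ↔ ∃ A, x = (itp F A).code := by
  have key : ∀ x, rf F.code x = true ↔ (x = botC ∨ (∃ i, QN F.code i = x) ∨
      (∃ a, x = Nat.pair 2 a ∧ rf F.code a = true) ∨
      (∃ t a b, (t = 3 ∨ t = 4 ∨ t = 5) ∧ x = Nat.pair t (Nat.pair a b) ∧ rf F.code a = true ∧ rf F.code b = true) ∨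
      (∃ y, App F.code y = x ∧ rf F.code y = true)) := by
    intro x
    rw [rf_eq, rfG]
    simp only [Bool.or_eq_true, Bool.and_eq_true, decide_eq_true_eq, anyLt_iff, List.length_map,
      List.length_range]
    refine or_congr Iff.rfl (or_congr ?_ (or_congr ?_ (or_congr ?_ ?_)))
    · constructor
      · rintro ⟨i, _, h⟩; exact ⟨i, h⟩
      · rintro ⟨i, rfl⟩; exact ⟨i, lt_QN _ _, rfl⟩
    · constructor
      · rintro ⟨h1, h2⟩
        have hx : x = Nat.pair 2 x.unpair.2 := by rw [← h1, Nat.pair_unpair]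
        rw [getD_map_range _ _ _ _ (by have := pair_lt_of 2 x.unpair.2 (by omega); omega)] at h2
        exact ⟨_, hx, h2⟩
      · rintro ⟨a, rfl, h⟩
        simp only [Nat.unpair_pair]
        rw [getD_map_range _ _ _ _ (pair_lt_of _ _ (by omega))]
        exact ⟨trivial, h⟩
    · constructor
      · rintro ⟨h1, h2, h3⟩
        have hx : x = Nat.pair x.unpair.1 (Nat.pair x.unpair.2.unpair.1 x.unpair.2.unpair.2) := by
          simp only [Nat.pair_unpair]
        have hl := pair2_lt x.unpair.1 x.unpair.2.unpair.1 x.unpair.2.unpair.2 (by omega)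
        rw [← hx] at hl
        rw [getD_map_range _ _ _ _ hl.1] at h2
        rw [getD_map_range _ _ _ _ hl.2] at h3
        exact ⟨_, _, _, h1, hx, h2, h3⟩
      · rintro ⟨t, a, b, ht, rfl, h1, h2⟩
        have hl := pair2_lt t a b (by omega)
        simp only [Nat.unpair_pair]
        rw [getD_map_range _ _ _ _ hl.1, getD_map_range _ _ _ _ hl.2]
        exact ⟨ht, h1, h2⟩
    · constructor
      · rintro ⟨y, h1, h2, h3⟩
        rw [getD_map_range _ _ _ _ h1] at h3
        exact ⟨y, h2, h3⟩
      · rintro ⟨y, rfl, h⟩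
        refine ⟨y, lt_App _ _, rfl, ?_⟩
        rw [getD_map_range _ _ _ _ (lt_App _ _)]
        exact h
  constructor
  · induction x using Nat.strong_induction_on with
    | _ x ih =>
      intro h0
      rcases (key x).1 h0 with h | ⟨i, rfl⟩ | ⟨a, rfl, h⟩ | ⟨t, a, b, ht, rfl, h1, h2⟩ | ⟨y, rfl, h⟩
      · exact ⟨.bot, h.trans botC_eq.symm⟩
      · exact ⟨.var i, rfl⟩
      · obtain ⟨A, rfl⟩ := ih a (pair_lt_of _ _ (by omega)) h
        exact ⟨.neg A, rfl⟩
      · have hl := pair2_lt t a b (by omega)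
        obtain ⟨A, rfl⟩ := ih _ hl.1 h1
        obtain ⟨B, rfl⟩ := ih _ hl.2 h2
        rcases ht with rfl | rfl | rfl
        · exact ⟨.and A B, rfl⟩
        · exact ⟨.or A B, rfl⟩
        · exact ⟨.imp A B, rfl⟩
      · obtain ⟨A, rfl⟩ := ih _ (lt_App _ _) h
        exact ⟨.box A, rfl⟩
  · rintro ⟨A, rfl⟩
    induction A with
    | var i => exact (key _).2 (Or.inr (Or.inl ⟨i, rfl⟩))
    | bot => exact (key _).2 (Or.inl botC_eq)
    | neg A ih => exact (key _).2 (Or.inr (Or.inr (Or.inl ⟨_, rfl, ih⟩)))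
    | and A B i1 i2 =>
      exact (key _).2 (Or.inr (Or.inr (Or.inr (Or.inl ⟨3, _, _, by omega, rfl, i1, i2⟩))))
    | or A B i1 i2 =>
      exact (key _).2 (Or.inr (Or.inr (Or.inr (Or.inl ⟨4, _, _, by omega, rfl, i1, i2⟩))))
    | imp A B i1 i2 =>
      exact (key _).2 (Or.inr (Or.inr (Or.inr (Or.inl ⟨5, _, _, by omega, rfl, i1, i2⟩))))
    | box A ih => exact (key _).2 (Or.inr (Or.inr (Or.inr (Or.inr ⟨_, rfl, ih⟩))))

end Part8

section Part9

/-! ## Part 7: the modal logic, numerically -/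

def Appn (g : ℕ) (k y : ℕ) : ℕ := Nat.rec y (fun _ r => App g r) k
theorem Appn_zero (g y : ℕ) : Appn g 0 y = y := rfl
theorem Appn_succ (g k y : ℕ) : Appn g (k + 1) y = App g (Appn g k y) := rfl
theorem Appn_add (g a b y : ℕ) : Appn g (a + b) y = Appn g a (Appn g b y) := by
  induction a with
  | zero => rw [Nat.zero_add]; rfl
  | succ a ih => rw [Nat.succ_add, Appn_succ, Appn_succ, ih]
theorem Appn_inj {g k a b : ℕ} (h : Appn g k a = Appn g k b) : a = b := by
  induction k with
  | zero => exact h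
  | succ k ih => exact ih (App_inj h)
theorem le_Appn (g k y : ℕ) : k + y ≤ Appn g k y := by
  induction k with
  | zero => rw [Appn_zero]; omega
  | succ k ih => rw [Appn_succ]; have := lt_App g (Appn g k y); omega
@[fun_prop] theorem pr_Appn {α : Type} [Primcodable α] {f g h : α → ℕ} (hf : Primrec f)
    (hg : Primrec g) (hh : Primrec h) : Primrec (fun x => Appn (f x) (g x) (h x)) :=
  pr_rec hg hh (h := fun x _ r => App (f x) r)
    (pr_App (hf.comp Primrec.fst) (Primrec.snd.comp Primrec.snd))

theorem itp_boxIter (F : AFml) (k : ℕ) (A : MFml) :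
    (itp F (boxIter k A)).code = Appn F.code k (itp F A).code := by
  induction k with
  | zero => rfl
  | succ k ih => rw [Appn_succ, ← ih]; rfl

theorem App_itp {F : AFml} {y : ℕ} {C : MFml} (h : App F.code y = (itp F C).code) :
    ∃ D, C = .box D ∧ y = (itp F D).code := by
  have h1 : PfN F y = itp F C := AFml.code_inj h
  cases C with
  | box D => exact ⟨D, rfl, PfN_inj h1⟩
  | var i => exact absurd h1 (PfN_ne_Qf _ _)
  | _ => simp [itp, PfN, botFml] at h1
theorem Appn_itp {F : AFml} {k y : ℕ} {C : MFml} (h : Appn F.code k y = (itp F C).code) :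
    ∃ D, C = boxIter k D ∧ y = (itp F D).code := by
  induction k generalizing C with
  | zero => exact ⟨C, rfl, h⟩
  | succ k ih =>
    obtain ⟨D, rfl, h2⟩ := App_itp h
    obtain ⟨E, rfl, h3⟩ := ih h2
    exact ⟨E, rfl, h3⟩

/-- the valuation of arithmetical formulas given by a modal valuation -/
theorem itp_eval_of {F : AFml} (v : MFml → Prop) (w : AFml → Prop) (hb : ¬ w botFml)
    (h1 : ∀ i, w (Qf F i) ↔ v (.var i)) (h2 : ∀ A, w (itp F (.box A)) ↔ v (.box A)) (A : MFml) :
    (itp F A).evalProp w ↔ A.evalTC v := by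
  induction A with
  | var i => exact h1 i
  | bot => exact iff_of_false hb (fun h => h)
  | neg A ih => exact not_congr ih
  | and A B i1 i2 => exact and_congr i1 i2
  | or A B i1 i2 => exact or_congr i1 i2
  | imp A B i1 i2 => exact imp_congr i1 i2
  | box A => exact h2 A

theorem taut_itp (F : AFml) (A : MFml) : ATaut (.or botFml (itp F A)) ↔ MTaut A := by
  constructor
  · intro h v
    let w : AFml → Prop := fun ψ => ∃ C, itp F C = ψ ∧ C ≠ .bot ∧ v C
    have hb : ¬ w botFml := by
      rintro ⟨C, h1, h2, _⟩
      exact h2 (itp_inj (F := F) (B := .bot) h1)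
    have := h w
    rcases this with h1 | h1
    · exact absurd h1 hb
    · refine (itp_eval_of v w hb ?_ ?_ A).1 h1
      · intro i
        constructor
        · rintro ⟨C, h1, _, h3⟩
          rw [itp_inj (F := F) (B := .var i) h1] at h3; exact h3
        · intro h; exact ⟨_, rfl, by simp, h⟩
      · intro B
        constructor
        · rintro ⟨C, h1, _, h3⟩
          rw [itp_inj (F := F) h1] at h3; exact h3
        · intro h; exact ⟨_, rfl, by simp, h⟩
  · intro h w
    by_cases hb : w botFml
    · exact Or.inl hb
    · refine Or.inr ((itp_eval_of (fun C => w (itp F C)) w hb ?_ ?_ A).2 (h _))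
      · intro i; exact Iff.rfl
      · intro i; exact Iff.rfl

def LFAx (m n g x : ℕ) : Prop :=
  (rf g x = true ∧ tautC (Nat.pair 4 (Nat.pair botC x)) = true) ∨
    ∃ y, rf g y = true ∧ x = impC (Appn g n y) (Appn g m y)
def LFSt (g x a b : ℕ) : Prop := a = impC b x ∨ x = App g a
def LF (m n g x : ℕ) : Prop := Cl (LFAx m n g) (LFSt g) x

theorem LF_re (m n : ℕ) : RE (fun p : ℕ × ℕ => LF m n p.1 p.2) := by
  refine RE.cl (Ax := LFAx m n) (St := LFSt) ?_ ?_
  · refine RE.or (RE.and (RE.ofPrim rf_prim) (RE.ofPrim (tautC_prim.comp ?_))) (RE.ex (β := ℕ)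
      (R := fun (p : ℕ × ℕ) y => rf p.1 y = true ∧ p.2 = impC (Appn p.1 n y) (Appn p.1 m y)) ?_)
    · exact pr_pair (pr_const _) (pr_pair (pr_const _) Primrec.snd)
    · refine RE.and (RE.ofPrim (rf_prim.comp (g := fun p : (ℕ × ℕ) × ℕ => (p.1.1, p.2)) (by fun_prop)))
        (RE.eq (by fun_prop) ?_)
      exact pr_impC (pr_Appn (by fun_prop) (by fun_prop) (by fun_prop))
        (pr_Appn (by fun_prop) (by fun_prop) (by fun_prop))
  · refine RE.or (RE.eq (by fun_prop) ?_) (RE.eq (by fun_prop) ?_)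
    · exact pr_impC (by fun_prop) (by fun_prop)
    · exact pr_App (by fun_prop) (by fun_prop)

/-- all boxes are true -/
theorem NA_allTrue {m n : ℕ} (hm : 1 ≤ m) {A : MFml} (h : NAProves m n A) :
    A.evalTC (fun _ => True) := by
  induction h with
  | taut h => exact h _
  | acc A =>
    obtain ⟨m, rfl⟩ : ∃ k, m = k + 1 := ⟨m - 1, by omega⟩
    intro _; trivial
  | mp _ _ i1 i2 => exact i1 i2
  | nec _ _ => trivial
  | ros _ ih => exact absurd trivial ih

theorem LF_iff {m n : ℕ} (hm : 1 ≤ m) (F : AFml) (x : ℕ) :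
    LF m n F.code x ↔ ∃ A, x = (itp F A).code ∧ NAProves m n A := by
  constructor
  · intro h
    induction h with
    | ax h =>
      rcases h with ⟨h1, h2⟩ | ⟨y, h1, h2⟩
      · obtain ⟨A, rfl⟩ := (rf_iff F _).1 h1
        refine ⟨A, rfl, .taut ((taut_itp F A).1 ((tautC_iff _).1 ?_))⟩
        rw [← h2, ← botC_eq]; rfl
      · obtain ⟨A, rfl⟩ := (rf_iff F _).1 h1
        refine ⟨_, ?_, .acc A⟩
        rw [h2, ← itp_boxIter, ← itp_boxIter]; rfl
    | @st x a b _ _ h i1 i2 =>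
      obtain ⟨A, rfl, hA⟩ := i1
      obtain ⟨B, rfl, hB⟩ := i2
      rcases h with h | h
      · cases A with
        | imp C D =>
          simp only [itp, AFml.code, impC, Nat.pair_eq_pair] at h
          rw [itp_inj (AFml.code_inj h.2.1)] at hA
          exact ⟨D, h.2.2.symm, .mp hA hB⟩
        | _ => simp [itp, AFml.code, impC, Nat.pair_eq_pair, Qf, PfN, botFml] at h
      · exact ⟨.box A, h, .nec hA⟩
  · rintro ⟨A, rfl, h⟩
    induction h with
    | taut h =>
      refine .ax (Or.inl ⟨(rf_iff F _).2 ⟨_, rfl⟩, ?_⟩)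
      have := (tautC_iff _).2 ((taut_itp F _).2 h)
      rw [← this, ← botC_eq]; rfl
    | acc A =>
      refine .ax (Or.inr ⟨(itp F A).code, (rf_iff F _).2 ⟨_, rfl⟩, ?_⟩)
      rw [← itp_boxIter, ← itp_boxIter]; rfl
    | mp _ _ i1 i2 => exact .st i1 i2 (Or.inl rfl)
    | nec _ i => exact .st i i (Or.inr rfl)
    | ros h _ => exact absurd trivial (NA_allTrue hm h)

/-- the set of (even) numbers eventually declared provable -/
def AA (Tax : Set AFml) (m n g x : ℕ) : Prop :=
  x % 2 = 0 ∧ (LF m n g (x / 2) ∨ (PrvC Tax (x / 2) ∧ (!(rf g (x / 2))) = true))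
theorem AA_re {Tax : Set AFml} (hpr : PrAxiomatized Tax) (m n : ℕ) :
    RE (fun p : ℕ × ℕ => AA Tax m n p.1 p.2) := by
  refine RE.and (RE.eq (by fun_prop) (by fun_prop)) (RE.or
    ((LF_re m n).comp (g := fun p : ℕ × ℕ => (p.1, p.2 / 2)) (by fun_prop)) (RE.and
      ((PrvC_re hpr).comp (g := fun p : ℕ × ℕ => p.2 / 2) (by fun_prop)) (RE.ofPrim (pr_not
      (rf_prim.comp (g := fun p : ℕ × ℕ => (p.1, p.2 / 2)) (by fun_prop))))))

/-! ### the closure relation -/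
def relB (m n g x b : ℕ) : Bool := anyLt (b + 1) (fun y => anyLt (x + 1) (fun i =>
  decide (b = 2 * Appn g (m - 1) y) && decide (x = 2 * Appn g (i * (n - m) + (m - 1)) y)))
def relP (m n g x b : ℕ) : Prop := ∃ y i, b = 2 * Appn g (m - 1) y ∧
  x = 2 * Appn g (i * (n - m) + (m - 1)) y
theorem relB_iff {m n : ℕ} (hmn : m < n) (g x b : ℕ) : relB m n g x b = true ↔ relP m n g x b := by
  simp only [relB, relP, anyLt_iff, Bool.and_eq_true, decide_eq_true_eq]
  constructor
  · rintro ⟨y, _, i, _, h1, h2⟩; exact ⟨y, i, h1, h2⟩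
  · rintro ⟨y, i, h1, h2⟩
    have e1 := le_Appn g (m - 1) y
    have e2 := le_Appn g (i * (n - m) + (m - 1)) y
    have e3 : i ≤ i * (n - m) := Nat.le_mul_of_pos_right _ (by omega)
    exact ⟨y, by omega, i, by omega, h1, h2⟩
theorem relP_le {m n g x b : ℕ} (h : relP m n g x b) : b ≤ x := by
  obtain ⟨y, i, rfl, rfl⟩ := h
  rw [Appn_add]
  have := le_Appn g (i * (n - m)) (Appn g (m - 1) y)
  omega
theorem relP_trans {m n g x b c : ℕ} (h1 : relP m n g x b) (h2 : relP m n g b c) : relP m n g x c := by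
  obtain ⟨y, i, rfl, rfl⟩ := h1
  obtain ⟨y', i', e, e2⟩ := h2
  refine ⟨y', i + i', e, ?_⟩
  have e3 : Appn g (m - 1) y = Appn g (i' * (n - m) + (m - 1)) y' := by omega
  rw [Appn_add, e3, ← Appn_add, Nat.add_mul, Nat.add_assoc]
theorem relB_prim (m n : ℕ) : Primrec (fun p : ℕ × ℕ × ℕ => relB m n p.1 p.2.1 p.2.2) := by
  refine pr_anyLt (by fun_prop) (pr_anyLt (by fun_prop) (pr_and (pr_beq (by fun_prop) ?_)
    (pr_beq (by fun_prop) ?_)))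
  · exact pr_mul (pr_const _) (pr_Appn (by fun_prop) (pr_const _) (by fun_prop))
  · exact pr_mul (pr_const _) (pr_Appn (by fun_prop) (by fun_prop) (by fun_prop))

end Part9

section Part10

/-! ### tables and certificates -/
def tauB (k b : ℕ) : Bool :=
  decide (b < k.unpair.2) &&
    decide (k.unpair.1.unpair.1 % ((b + 1) * k.unpair.1.unpair.2 + 1) = 0)
@[fun_prop] theorem pr_tauB {α : Type} [Primcodable α] {f g : α → ℕ} (hf : Primrec f)
    (hg : Primrec g) : Primrec (fun x => tauB (f x) (g x)) := by
  unfold tauB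
  exact pr_and (by fun_prop) (pr_beq (pr_mod (by fun_prop) (by fun_prop)) (by fun_prop))

theorem exists_table (N : ℕ) (p : ℕ → Prop) : ∃ k, ∀ b, tauB k b = true ↔ b < N ∧ p b := by
  classical
  let l : List ℕ := (List.range N).map (fun i => if p i then 0 else 1)
  refine ⟨Nat.pair (Nat.unbeta l) N, fun b => ?_⟩
  simp only [tauB, Nat.unpair_pair, Bool.and_eq_true, decide_eq_true_eq]
  refine and_congr_right fun hb => ?_
  have h := Nat.beta_unbeta_coe l ⟨b, by simp [l, hb]⟩
  have h' : Nat.beta (Nat.unbeta l) b = if p b then 0 else 1 := by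
    rw [h]; simp [l]
  unfold Nat.beta at h'
  rw [h']
  split_ifs with hp <;> simp [hp]

def good (m n g k w : ℕ) : Bool :=
  !(tauB k w) && !(anyLt (w + 1) (fun b => relB m n g w b && tauB k b))
theorem good_iff (m n g k w : ℕ) : good m n g k w = true ↔ tauB k w = false ∧
    ∀ b ≤ w, relB m n g w b = true → tauB k b = false := by
  rw [good, Bool.and_eq_true]
  simp only [Bool.not_eq_true']
  refine and_congr_right fun _ => ?_
  rw [← Bool.not_eq_true, anyLt_iff]
  simp only [Bool.and_eq_true, not_exists, not_and, Bool.not_eq_true]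
  exact ⟨fun h b hb => h b (by omega), fun h b hb => h b (by omega)⟩
theorem pr_good {α : Type} [Primcodable α] (m n : ℕ) {f g h : α → ℕ} (hf : Primrec f)
    (hg : Primrec g) (hh : Primrec h) : Primrec (fun x => good m n (f x) (g x) (h x)) := by
  unfold good
  refine pr_and (by fun_prop) (pr_not (pr_anyLt (by fun_prop) (pr_and ?_ (by fun_prop))))
  exact (relB_prim m n).comp (g := fun p : α × ℕ => (f p.1, h p.1, p.2)) (by fun_prop)

def CAx (m n : ℕ) (q p : ℕ × ℕ) : Prop :=
  p = (botC, 0) ∨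
  (∃ y : ℕ, p.1 = App q.1 y ∧ ((p.2 = 0 ∧ tauB q.2 (2 * y) = true) ∨
    (p.2 = 1 ∧ good m n q.1 q.2 (2 * y) = true))) ∨
  (∃ y : ℕ, p.1 = QN q.1 y ∧ ((p.2 = 0 ∧ tauB q.2 (2 * y + 1) = true) ∨
    (p.2 = 1 ∧ good m n q.1 q.2 (2 * y + 1) = true)))
def CSt (_q p a b : ℕ × ℕ) : Prop :=
  p = (Nat.pair 2 a.1, 1 - a.2) ∨
  p = (Nat.pair 3 (Nat.pair a.1 b.1), a.2 * b.2) ∨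
  p = (Nat.pair 4 (Nat.pair a.1 b.1), a.2 + b.2 - a.2 * b.2) ∨
  p = (Nat.pair 5 (Nat.pair a.1 b.1), 1 - a.2 + a.2 * b.2)
def Cert (m n : ℕ) (q p : ℕ × ℕ) : Prop := Cl (CAx m n q) (CSt q) p
theorem Cert_re (m n : ℕ) : RE (fun r : (ℕ × ℕ) × ℕ × ℕ => Cert m n r.1 r.2) := by
  refine RE.cl (Ax := CAx m n) (St := CSt) ?_ ?_
  · refine RE.or (RE.eq (by fun_prop) (by fun_prop)) (RE.or
      (RE.ex (β := ℕ) (R := fun (r : (ℕ × ℕ) × ℕ × ℕ) y => r.2.1 = App r.1.1 y ∧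
        ((r.2.2 = 0 ∧ tauB r.1.2 (2 * y) = true) ∨
         (r.2.2 = 1 ∧ good m n r.1.1 r.1.2 (2 * y) = true))) ?_)
      (RE.ex (β := ℕ) (R := fun (r : (ℕ × ℕ) × ℕ × ℕ) y => r.2.1 = QN r.1.1 y ∧
        ((r.2.2 = 0 ∧ tauB r.1.2 (2 * y + 1) = true) ∨
         (r.2.2 = 1 ∧ good m n r.1.1 r.1.2 (2 * y + 1) = true))) ?_))
    · exact RE.and (RE.eq (by fun_prop) (pr_App (by fun_prop) (by fun_prop))) (RE.or
        (RE.and (RE.eq (by fun_prop) (by fun_prop)) (RE.ofPrim (pr_tauB (by fun_prop) (by fun_prop))))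
        (RE.and (RE.eq (by fun_prop) (by fun_prop))
          (RE.ofPrim (pr_good m n (by fun_prop) (by fun_prop) (by fun_prop)))))
    · exact RE.and (RE.eq (by fun_prop) (pr_QN (by fun_prop) (by fun_prop))) (RE.or
        (RE.and (RE.eq (by fun_prop) (by fun_prop)) (RE.ofPrim (pr_tauB (by fun_prop) (by fun_prop))))
        (RE.and (RE.eq (by fun_prop) (by fun_prop))
          (RE.ofPrim (pr_good m n (by fun_prop) (by fun_prop) (by fun_prop)))))
  · refine RE.or (RE.eq (by fun_prop) ?_) (RE.or (RE.eq (by fun_prop) ?_)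
      (RE.or (RE.eq (by fun_prop) ?_) (RE.eq (by fun_prop) ?_)))
    all_goals refine pr_mk ?_ ?_
    all_goals fun_prop

def EE (Tax : Set AFml) (m n g k : ℕ) : Prop := ∃ χ : ℕ, PrvC Tax χ ∧ Cert m n (g, k) (χ, 0)
theorem EE_re {Tax : Set AFml} (hpr : PrAxiomatized Tax) (m n : ℕ) :
    RE (fun p : ℕ × ℕ => EE Tax m n p.1 p.2) := by
  refine RE.ex (β := ℕ) (R := fun (p : ℕ × ℕ) χ => PrvC Tax χ ∧ Cert m n (p.1, p.2) (χ, 0)) ?_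
  refine RE.and ((PrvC_re hpr).comp (g := fun p : (ℕ × ℕ) × ℕ => p.2) (by fun_prop)) ?_
  exact (Cert_re m n).comp (g := fun p : (ℕ × ℕ) × ℕ => ((p.1.1, p.1.2), (p.2, 0))) (by fun_prop)

set_option maxHeartbeats 2000000 in
/-- a certificate computed from a modal valuation -/
theorem cert_of_val {F : AFml} {m n k : ℕ} (v : MFml → Prop) (N : ℕ)
    (hb : ∀ i, 2 * i + 1 < N → (v (.var i) → good m n F.code k (2 * i + 1) = true) ∧
      (¬ v (.var i) → tauB k (2 * i + 1) = true))
    (hc : ∀ C, 2 * (itp F C).code < N → (v (.box C) → good m n F.code k (2 * (itp F C).code) = true) ∧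
      (¬ v (.box C) → tauB k (2 * (itp F C).code) = true))
    (A : MFml) (hA : 2 * (itp F A).code < N) :
    (A.evalTC v → Cert m n (F.code, k) ((itp F A).code, 1)) ∧
    (¬ A.evalTC v → Cert m n (F.code, k) ((itp F A).code, 0)) := by
  induction A with
  | var i =>
    have h1 : 2 * i + 1 < N := by
      have : i < (itp F (.var i)).code := lt_QN _ _
      omega
    exact ⟨fun h => .ax (Or.inr (Or.inr ⟨i, rfl, Or.inr ⟨rfl, (hb i h1).1 h⟩⟩)),
      fun h => .ax (Or.inr (Or.inr ⟨i, rfl, Or.inl ⟨rfl, (hb i h1).2 h⟩⟩))⟩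
  | bot =>
    refine ⟨fun h => h.elim, fun _ => .ax (Or.inl ?_)⟩
    show ((itp F .bot).code, 0) = _
    rw [← botC_eq]; rfl
  | neg A ih =>
    have h1 : (itp F A).code < (itp F (.neg A)).code := pair_lt_of _ _ (by omega)
    obtain ⟨i1, i2⟩ := ih (by omega)
    refine ⟨fun h => ?_, fun h => ?_⟩
    · exact .st (i2 h) (i2 h) (Or.inl rfl)
    · have h : A.evalTC v := not_not.1 h
      exact .st (i1 h) (i1 h) (Or.inl rfl)
  | and A B ia ib =>
    have h1 := pair2_lt 3 (itp F A).code (itp F B).code (by omega)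
    change 2 * (Nat.pair 3 (Nat.pair (itp F A).code (itp F B).code)) < N at hA
    obtain ⟨a1, a2⟩ := ia (by omega)
    obtain ⟨b1, b2⟩ := ib (by omega)
    refine ⟨fun h => .st (a1 h.1) (b1 h.2) (Or.inr (Or.inl rfl)), fun h => ?_⟩
    by_cases ha : A.evalTC v <;> by_cases hb : B.evalTC v
    · exact absurd ⟨ha, hb⟩ h
    · exact .st (a1 ha) (b2 hb) (Or.inr (Or.inl rfl))
    · exact .st (a2 ha) (b1 hb) (Or.inr (Or.inl rfl))
    · exact .st (a2 ha) (b2 hb) (Or.inr (Or.inl rfl))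
  | or A B ia ib =>
    have h1 := pair2_lt 4 (itp F A).code (itp F B).code (by omega)
    change 2 * (Nat.pair 4 (Nat.pair (itp F A).code (itp F B).code)) < N at hA
    obtain ⟨a1, a2⟩ := ia (by omega)
    obtain ⟨b1, b2⟩ := ib (by omega)
    refine ⟨fun h => ?_, fun h => ?_⟩
    · by_cases ha : A.evalTC v <;> by_cases hb : B.evalTC v
      · exact .st (a1 ha) (b1 hb) (Or.inr (Or.inr (Or.inl rfl)))
      · exact .st (a1 ha) (b2 hb) (Or.inr (Or.inr (Or.inl rfl)))
      · exact .st (a2 ha) (b1 hb) (Or.inr (Or.inr (Or.inl rfl)))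
      · exact absurd h (not_or.2 ⟨ha, hb⟩)
    · have ⟨ha, hb⟩ := not_or.1 h
      exact .st (a2 ha) (b2 hb) (Or.inr (Or.inr (Or.inl rfl)))
  | imp A B ia ib =>
    have h1 := pair2_lt 5 (itp F A).code (itp F B).code (by omega)
    change 2 * (Nat.pair 5 (Nat.pair (itp F A).code (itp F B).code)) < N at hA
    obtain ⟨a1, a2⟩ := ia (by omega)
    obtain ⟨b1, b2⟩ := ib (by omega)
    refine ⟨fun h => ?_, fun h => ?_⟩
    · by_cases ha : A.evalTC v <;> by_cases hb : B.evalTC v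
      · exact .st (a1 ha) (b1 hb) (Or.inr (Or.inr (Or.inr rfl)))
      · exact absurd (h ha) hb
      · exact .st (a2 ha) (b1 hb) (Or.inr (Or.inr (Or.inr rfl)))
      · exact .st (a2 ha) (b2 hb) (Or.inr (Or.inr (Or.inr rfl)))
    · have ⟨ha, hb⟩ := Classical.not_imp.1 h
      exact .st (a1 ha) (b2 hb) (Or.inr (Or.inr (Or.inr rfl)))
  | box A ih =>
    have h1 : 2 * (itp F A).code < N := by
      have : (itp F A).code < (itp F (.box A)).code := lt_App _ _
      omega
    have e : (itp F (.box A)).code = App F.code (itp F A).code := PfN_code _ _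
    rw [e]
    generalize hy : (itp F A).code = y at *
    have hc' := hc A
    rw [hy] at hc'
    have hc' := hc' h1
    exact ⟨fun h => .ax (Or.inr (Or.inl ⟨y, rfl, Or.inr ⟨rfl, hc'.1 h⟩⟩)),
      fun h => .ax (Or.inr (Or.inl ⟨y, rfl, Or.inl ⟨rfl, hc'.2 h⟩⟩))⟩

/-- soundness of certificates -/
theorem cert_sound {Tax : Set AFml} (hext : PA ⊆ Tax) {F : AFml} {m n k : ℕ}
    (h1 : ∀ y, tauB k (2 * y) = true → Proves Tax (.neg (PfN F y)))
    (h2 : ∀ y, good m n F.code k (2 * y) = true → Proves Tax (PfN F y))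
    (h3 : ∀ y, tauB k (2 * y + 1) = true → Proves Tax (.neg (Qf F y)))
    (h4 : ∀ y, good m n F.code k (2 * y + 1) = true → Proves Tax (Qf F y))
    {p : ℕ × ℕ} (h : Cert m n (F.code, k) p) :
    ∃ φ : AFml, p.1 = φ.code ∧ ((p.2 = 1 ∧ Proves Tax φ) ∨ (p.2 = 0 ∧ Proves Tax (.neg φ))) := by
  induction h with
  | @ax p h =>
    rcases h with rfl | ⟨y, e, h⟩ | ⟨y, e, h⟩
    · refine ⟨botFml, botC_eq.symm, Or.inr ⟨rfl, completeness fun M S hS ρ => ?_⟩⟩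
      intro h
      have hS : Models S PA := fun ψ hψ => hS ψ (hext hψ)
      have := iot_inj hS (a := 0) (b := 1) h
      omega
    · refine ⟨PfN F y, e, ?_⟩
      rcases h with ⟨e, h⟩ | ⟨e, h⟩
      · exact Or.inr ⟨e, h1 y h⟩
      · exact Or.inl ⟨e, h2 y h⟩
    · refine ⟨Qf F y, e, ?_⟩
      rcases h with ⟨e, h⟩ | ⟨e, h⟩
      · exact Or.inr ⟨e, h3 y h⟩
      · exact Or.inl ⟨e, h4 y h⟩
  | @st p a b _ _ h ia ib =>
    obtain ⟨φ, ea, ha⟩ := ia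
    obtain ⟨ψ, eb, hb⟩ := ib
    rw [CSt, ea, eb] at h
    rcases h with rfl | rfl | rfl | rfl
    · refine ⟨.neg φ, rfl, ?_⟩
      rcases ha with ⟨e, h⟩ | ⟨e, h⟩
      · refine Or.inr ⟨by simp [e], prov_of_list [φ] (by simpa using h) _ ?_⟩
        intro v hv; simpa [AFml.evalProp] using hv
      · exact Or.inl ⟨by simp [e], h⟩
    · refine ⟨.and φ ψ, rfl, ?_⟩
      rcases ha with ⟨e, h⟩ | ⟨e, h⟩ <;> rcases hb with ⟨e', h'⟩ | ⟨e', h'⟩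
      · refine Or.inl ⟨by simp [e, e'], prov_of_list [φ, ψ] (by simpa using ⟨h, h'⟩) _ ?_⟩
        intro v hv; simpa [AFml.evalProp] using hv
      all_goals refine Or.inr ⟨by simp [e, e'], prov_of_list [_, _] (by
        intro χ hχ; rcases List.mem_pair.1 hχ with rfl | rfl; exact h; exact h') _ ?_⟩
      all_goals intro v hv; simp [AFml.evalProp] at hv ⊢; tauto
    · refine ⟨.or φ ψ, rfl, ?_⟩
      rcases ha with ⟨e, h⟩ | ⟨e, h⟩ <;> rcases hb with ⟨e', h'⟩ | ⟨e', h'⟩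
      case inr.inr =>
        refine Or.inr ⟨by simp [e, e'], prov_of_list [_, _] (by
          intro χ hχ; rcases List.mem_pair.1 hχ with rfl | rfl; exact h; exact h') _ ?_⟩
        intro v hv; simp [AFml.evalProp] at hv ⊢; tauto
      all_goals refine Or.inl ⟨by simp [e, e'], prov_of_list [_, _] (by
        intro χ hχ; rcases List.mem_pair.1 hχ with rfl | rfl; exact h; exact h') _ ?_⟩
      all_goals intro v hv; simp [AFml.evalProp] at hv ⊢; tauto
    · refine ⟨.imp φ ψ, rfl, ?_⟩
      rcases ha with ⟨e, h⟩ | ⟨e, h⟩ <;> rcases hb with ⟨e', h'⟩ | ⟨e', h'⟩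
      case inl.inr =>
        refine Or.inr ⟨by simp [e, e'], prov_of_list [_, _] (by
          intro χ hχ; rcases List.mem_pair.1 hχ with rfl | rfl; exact h; exact h') _ ?_⟩
        intro v hv; simp [AFml.evalProp] at hv ⊢; tauto
      all_goals refine Or.inl ⟨by simp [e, e'], prov_of_list [_, _] (by
        intro χ hχ; rcases List.mem_pair.1 hχ with rfl | rfl; exact h; exact h') _ ?_⟩
      all_goals intro v hv; simp [AFml.evalProp] at hv ⊢; tauto

end Part10

section Part11

/-! ## Part 8: the formula -/

/-- environments from lists -/
def lenv {M : Type} (S : AStr M) (l : List M) : ℕ → M := fun n => l.getD n S.z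
theorem consM_lenv {M : Type} (S : AStr M) (a : M) (l : List M) : consM a (lenv S l) = lenv S (a :: l) := by
  funext n; cases n <;> rfl
theorem sat_pk {M : Type} {S : AStr M} (φ : AFml) (l : List ℕ) (h : φ.FreeLt l.length) (ρ : ℕ → M) :
    (φ.ren (pk l)).sat S ρ ↔ φ.sat S (lenv S (l.map ρ)) := by
  rw [AFml.sat_ren]
  refine sat_congr ?_ φ h
  intro i hi
  simp [pk, lenv, List.getD, hi]
theorem sat_pk1 {M : Type} {S : AStr M} {φ : AFml} (h : φ.FreeLt 1) (i : ℕ) (ρ : ℕ → M) :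
    (φ.ren (pk [i])).sat S ρ ↔ φ.sat S (lenv S [ρ i]) := sat_pk φ [i] h ρ
theorem sat_pk2 {M : Type} {S : AStr M} {φ : AFml} (h : φ.FreeLt 2) (i j : ℕ) (ρ : ℕ → M) :
    (φ.ren (pk [i, j])).sat S ρ ↔ φ.sat S (lenv S [ρ i, ρ j]) := sat_pk φ [i, j] h ρ
theorem sat_pk3 {M : Type} {S : AStr M} {φ : AFml} (h : φ.FreeLt 3) (i j k : ℕ) (ρ : ℕ → M) :
    (φ.ren (pk [i, j, k])).sat S ρ ↔ φ.sat S (lenv S [ρ i, ρ j, ρ k]) := sat_pk φ [i, j, k] h ρ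
theorem sat_pk4 {M : Type} {S : AStr M} {φ : AFml} (h : φ.FreeLt 4) (i j k l : ℕ) (ρ : ℕ → M) :
    (φ.ren (pk [i, j, k, l])).sat S ρ ↔ φ.sat S (lenv S [ρ i, ρ j, ρ k, ρ l]) :=
  sat_pk φ [i, j, k, l] h ρ
theorem abs_lenv {M : Type} {S : AStr M} (hS : Models S PA) {φ : AFml} (h : IsDelta0 φ) (l : List ℕ) :
    φ.sat S (lenv S (l.map (iot S))) ↔ φ.sat natStr (lenv natStr l) := by
  rw [nat_sat, ← delta0_abs hS h]
  have : lenv S (l.map (iot S)) = fun n => iot S (lenv natStr l n) := by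
    funext n
    by_cases hn : n < l.length
    · simp [lenv, List.getD, hn]
    · simp [lenv, List.getD, hn]; rfl
  rw [this]
theorem freeLt_pk {φ : AFml} {c d : ℕ} (hφ : φ.FreeLt c) (l : List ℕ) (hl : l.length = c)
    (h : ∀ i ∈ l, i < d) : (φ.ren (pk l)).FreeLt d := by
  refine AFml.freeLt_ren (c := c) ?_ φ hφ
  intro i hi
  have h2 : i < l.length := by omega
  simp only [pk, List.getD, List.getElem?_eq_getElem h2, Option.getD_some]
  exact h _ (List.getElem_mem h2)

def tauF : AFml := bexV 0 (bexV 1 (.and (pairF (.var 2) (.var 1) (.var 0))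
  (.and (.le (.succ (.var 3)) (.var 0)) (bexV 1 (bexV 2 (.and (pairF (.var 3) (.var 1) (.var 0))
    (bexV 1 (.eq (.var 2) (.mul (.var 0) (.succ (.mul (.succ (.var 6)) (.var 1))))))))))))
def piF : AFml := bexV 0 (pairF (.var 1) (.var 2) (.var 0))
theorem tauF_delta0 : IsDelta0 tauF :=
  .bexV (.bexV (.and (pairF_delta0 _ _ _) (.and (.le _ _) (.bexV (.bexV (.and (pairF_delta0 _ _ _)
    (.bexV (.eq _ _) _)) _) _))) _) _
theorem piF_delta0 : IsDelta0 piF := .bexV (pairF_delta0 _ _ _) _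
theorem tauF_freeLt : tauF.FreeLt 2 := by
  simp [tauF, bexV, pairF, AFml.FreeLt, ATerm.FreeLt]
theorem piF_freeLt : piF.FreeLt 2 := by
  simp [piF, bexV, pairF, AFml.FreeLt, ATerm.FreeLt]
theorem tauF_sat (ρ : ℕ → ℕ) : tauF.Sat ρ ↔ tauB (ρ 0) (ρ 1) = true := by
  simp only [tauF, Sat_bexV, AFml.Sat, pairF_sat, ATerm.val, consEnv, tauB, Bool.and_eq_true,
    decide_eq_true_eq]
  constructor
  · rintro ⟨c, _, N, _, h1, h2, a, _, d, _, h3, q, _, h4⟩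
    rw [h1, Nat.unpair_pair, h3, Nat.unpair_pair]
    refine ⟨h2, ?_⟩
    show a % ((ρ 1 + 1) * d + 1) = 0
    rw [h4]; exact Nat.mul_mod_left _ _
  · rintro ⟨h1, h2⟩
    refine ⟨(ρ 0).unpair.1, Nat.unpair_left_le _, (ρ 0).unpair.2, Nat.unpair_right_le _,
      (Nat.pair_unpair _).symm, h1, (ρ 0).unpair.1.unpair.1, Nat.unpair_left_le _,
      (ρ 0).unpair.1.unpair.2, Nat.unpair_right_le _, (Nat.pair_unpair _).symm, ?_⟩
    obtain ⟨q, hq⟩ := Nat.dvd_of_mod_eq_zero h2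
    refine ⟨q, ?_, by rw [Nat.mul_comm]; exact hq⟩
    calc q = 1 * q := (Nat.one_mul q).symm
      _ ≤ _ := by rw [hq]; exact Nat.mul_le_mul_right _ (by omega)
theorem piF_sat (ρ : ℕ → ℕ) : piF.Sat ρ ↔ ∃ j, ρ 0 = Nat.pair (ρ 1) j := by
  simp only [piF, Sat_bexV, pairF_sat, ATerm.val, consEnv]
  constructor
  · rintro ⟨j, _, h⟩; exact ⟨j, h⟩
  · rintro ⟨j, h⟩; exact ⟨j, by rw [h]; exact Nat.right_le_pair _ _, h⟩

/-- the basic Δ₀ formulas -/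
structure Base where
  a : AFml
  e : AFml
  rp : AFml
  rm : AFml
  dl : AFml
  a0 : IsDelta0 a
  e0 : IsDelta0 e
  rp0 : IsDelta0 rp
  rm0 : IsDelta0 rm
  dl0 : IsDelta0 dl
  a1 : a.FreeLt 3
  e1 : e.FreeLt 3
  rp1 : rp.FreeLt 4
  rm1 : rm.FreeLt 4
  dl1 : dl.FreeLt 1

variable (B : Base) {M : Type} (S : AStr M)

def RMf : AFml := bexV 0 (.and (B.rp.ren (pk [0, 4, 2, 3]))
  (ballV 0 (.neg (B.rm.ren (pk [0, 5, 3, 4])))))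
def RM (s x b g : M) : Prop := ∃ z, S.le z s ∧ B.rp.sat S (lenv S [z, g, x, b]) ∧
  ∀ w, S.le w z → ¬ B.rm.sat S (lenv S [w, g, x, b])
theorem RMf_delta0 : IsDelta0 (RMf B) := .bexV (.and (B.rp0.ren _) (.ballV (.neg (B.rm0.ren _)) _)) _
theorem RMf_freeLt : (RMf B).FreeLt 4 :=
  freeLt_bexV (by omega) ⟨freeLt_pk B.rp1 _ rfl (by simp),
    freeLt_ballV (by omega) (freeLt_pk (d := 6) B.rm1 _ rfl (by simp))⟩
theorem RMf_sat (s x b g : M) : (RMf B).sat S (lenv S [s, x, b, g]) ↔ RM B S s x b g := by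
  simp only [RMf, sat_bexV, AFml.sat, sat_ballV, consM_lenv, sat_pk4 B.rp1, sat_pk4 B.rm1]
  rfl

def Xf : AFml := .and (.neg (tauF.ren (pk [0, 2])))
  (ballV 2 (.imp ((RMf B).ren (pk [2, 3, 0, 4])) (.neg (tauF.ren (pk [1, 0])))))
def X (k s x g : M) : Prop := ¬ tauF.sat S (lenv S [k, x]) ∧
  ∀ b, S.le b x → RM B S s x b g → ¬ tauF.sat S (lenv S [k, b])
theorem Xf_delta0 : IsDelta0 (Xf B) :=
  .and (.neg (tauF_delta0.ren _)) (.ballV (.imp ((RMf_delta0 B).ren _) (.neg (tauF_delta0.ren _))) _)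
theorem Xf_freeLt : (Xf B).FreeLt 4 :=
  ⟨freeLt_pk (d := 4) tauF_freeLt _ rfl (by simp), freeLt_ballV (by omega)
    ⟨freeLt_pk (RMf_freeLt B) _ rfl (by simp), freeLt_pk (d := 5) tauF_freeLt _ rfl (by simp)⟩⟩
theorem Xf_sat (k s x g : M) : (Xf B).sat S (lenv S [k, s, x, g]) ↔ X B S k s x g := by
  simp only [Xf, AFml.sat, sat_ballV, consM_lenv, sat_pk2 tauF_freeLt, sat_pk4 (RMf_freeLt B)]
  refine and_congr Iff.rfl (forall_congr' fun b => imp_congr Iff.rfl (imp_congr ?_ Iff.rfl))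
  exact RMf_sat B S s x b g

def Evf : AFml := .and (piF.ren (pk [1, 0])) (.and (bexV 1 (B.e.ren (pk [0, 3, 1])))
  (ballV 1 (.imp (bexV 2 (B.a.ren (pk [0, 4, 1]))) ((Xf B).ren (pk [1, 2, 0, 3])))))
def Ev (k s g : M) : Prop := piF.sat S (lenv S [s, k]) ∧
  (∃ z, S.le z s ∧ B.e.sat S (lenv S [z, g, k])) ∧
  ∀ x, S.le x s → (∃ z, S.le z s ∧ B.a.sat S (lenv S [z, g, x])) → X B S k s x g
theorem Evf_delta0 : IsDelta0 (Evf B) := .and (piF_delta0.ren _) (.and (.bexV (B.e0.ren _) _)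
  (.ballV (.imp (.bexV (B.a0.ren _) _) ((Xf_delta0 B).ren _)) _))
theorem Evf_freeLt : (Evf B).FreeLt 3 :=
  ⟨freeLt_pk piF_freeLt _ rfl (by simp), freeLt_bexV (by omega) (freeLt_pk B.e1 _ rfl (by simp)),
    freeLt_ballV (by omega) ⟨freeLt_bexV (by omega) (freeLt_pk B.a1 _ rfl (by simp)),
      freeLt_pk (Xf_freeLt B) _ rfl (by simp)⟩⟩
theorem Evf_sat (k s g : M) : (Evf B).sat S (lenv S [k, s, g]) ↔ Ev B S k s g := by
  simp only [Evf, AFml.sat, sat_ballV, sat_bexV, consM_lenv, sat_pk2 piF_freeLt, sat_pk4 (Xf_freeLt B),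
    sat_pk3 B.a1, sat_pk3 B.e1]
  refine and_congr Iff.rfl (and_congr Iff.rfl (forall_congr' fun x => imp_congr Iff.rfl
    (imp_congr Iff.rfl ?_)))
  exact Xf_sat B S k s x g

def EVf : AFml := .or (B.dl.ren (pk [0])) (bexV 0 ((Evf B).ren (pk [0, 1, 2])))
def EV (s g : M) : Prop := B.dl.sat S (lenv S [s]) ∨ ∃ k, S.le k s ∧ Ev B S k s g
theorem EVf_delta0 : IsDelta0 (EVf B) := .or (B.dl0.ren _) (.bexV ((Evf_delta0 B).ren _) _)
theorem EVf_freeLt : (EVf B).FreeLt 2 :=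
  ⟨freeLt_pk B.dl1 _ rfl (by simp), freeLt_bexV (by omega) (freeLt_pk (Evf_freeLt B) _ rfl (by simp))⟩
theorem EVf_sat (s g : M) : (EVf B).sat S (lenv S [s, g]) ↔ EV B S s g := by
  simp only [EVf, AFml.sat, sat_bexV, consM_lenv, sat_pk3 (Evf_freeLt B), sat_pk1 B.dl1]
  refine or_congr Iff.rfl (exists_congr fun k => and_congr Iff.rfl ?_)
  exact Evf_sat B S k s g

/-- the matrix of the main formula -/
def F0 : AFml := .and (ballV 0 (.or (.le (.var 1) (.var 0)) (.neg ((EVf B).ren (pk [0, 2])))))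
  (.or (.and (.and (.le (.var 2) (.var 0)) (bexV 0 (B.a.ren (pk [0, 2, 3]))))
    (.neg ((EVf B).ren (pk [0, 1]))))
  (.or (B.dl.ren (pk [0])) (bexV 0 (.and ((Evf B).ren (pk [0, 1, 2])) ((Xf B).ren (pk [0, 1, 3, 2]))))))
def FF : AFml := .ex (F0 B)
def FS (g x : M) : Prop := ∃ s, (∀ u, S.le u s → S.le s u ∨ ¬ EV B S u g) ∧
  (((S.le x s ∧ ∃ z, S.le z s ∧ B.a.sat S (lenv S [z, g, x])) ∧ ¬ EV B S s g) ∨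
   (B.dl.sat S (lenv S [s]) ∨ ∃ k, S.le k s ∧ (Ev B S k s g ∧ X B S k s x g)))
theorem F0_delta0 : IsDelta0 (F0 B) :=
  .and (.ballV (.or (.le _ _) (.neg ((EVf_delta0 B).ren _))) _)
    (.or (.and (.and (.le _ _) (.bexV (B.a0.ren _) _)) (.neg ((EVf_delta0 B).ren _)))
      (.or (B.dl0.ren _) (.bexV (.and ((Evf_delta0 B).ren _) ((Xf_delta0 B).ren _)) _)))
theorem FF_freeLt : (FF B).FreeLt 2 := by
  refine ⟨freeLt_ballV (by omega) ⟨by simp [AFml.FreeLt, ATerm.FreeLt], ?_⟩, ⟨⟨by simp [AFml.FreeLt, ATerm.FreeLt], ?_⟩, ?_⟩, ?_,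
    freeLt_bexV (by omega) ⟨?_, ?_⟩⟩
  · exact freeLt_pk (d := 4) (EVf_freeLt B) _ rfl (by simp)
  · exact freeLt_bexV (by omega) (freeLt_pk B.a1 _ rfl (by simp))
  · exact freeLt_pk (d := 3) (EVf_freeLt B) _ rfl (by simp)
  · exact freeLt_pk B.dl1 _ rfl (by simp)
  · exact freeLt_pk (Evf_freeLt B) _ rfl (by simp)
  · exact freeLt_pk (Xf_freeLt B) _ rfl (by simp)
theorem FF_sat (g x : M) : (FF B).sat S (lenv S [g, x]) ↔ FS B S g x := by
  simp only [FF, F0, AFml.sat, sat_bexV, sat_ballV, consM_lenv, sat_pk3 (Evf_freeLt B), sat_pk1 B.dl1,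
    sat_pk2 (EVf_freeLt B), sat_pk4 (Xf_freeLt B), sat_pk3 B.a1]
  refine exists_congr fun s => and_congr (forall_congr' fun u => imp_congr Iff.rfl (or_congr Iff.rfl
    (not_congr ?_))) (or_congr (and_congr Iff.rfl (not_congr ?_)) (or_congr Iff.rfl
      (exists_congr fun k => and_congr Iff.rfl (and_congr ?_ ?_))))
  · exact EVf_sat B S u g
  · exact EVf_sat B S s g
  · exact Evf_sat B S k s g
  · exact Xf_sat B S k s x g

theorem Pf_sigma1 : IsSigma1 (Pf (FF B)) :=
  .ex (.and (.delta0 (.eq _ _)) (.ex (.and (.delta0 (.eq _ _)) (.ex (.delta0 (F0_delta0 B))))))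

variable {S}
theorem numeral_tv (ρ : ℕ → M) (k : ℕ) : (numeral k).tv S ρ = iot S k := by
  induction k with
  | zero => rfl
  | succ k ih => simp [numeral, ATerm.tv, ih, iot]
theorem Hf_sat (x : M) (ρ : ℕ → M) : (Hf (FF B)).sat S (consM x ρ) ↔ FS B S (iot S (FF B).code) x := by
  rw [← FF_sat]
  simp only [Hf, AFml.sat, ATerm.tv, numeral_tv]
  have e : ∀ g, (FF B).sat S (consM g (consM x ρ)) ↔ (FF B).sat S (lenv S [g, x]) := by
    intro g
    refine sat_congr (c := 2) ?_ _ (FF_freeLt B)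
    intro i hi
    rcases i with _ | _ | i
    · rfl
    · rfl
    · omega
  constructor
  · rintro ⟨g, h1, h2⟩
    have h1 : g = iot S (FF B).code := h1
    rw [e, h1] at h2; exact h2
  · intro h
    refine ⟨iot S (FF B).code, ?_, (e _).2 h⟩
    show consM (iot S (FF B).code) (consM x ρ) 0 = _
    rw [consM]
theorem PfN_sat (hS : Models S PA) (y : ℕ) (ρ : ℕ → M) :
    (PfN (FF B) y).sat S ρ ↔ FS B S (iot S (FF B).code) (iot S (2 * y)) := by
  simp only [PfN, AFml.sat, ATerm.tv, numeral_tv, Hf_sat]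
  rw [two_mul, iot_add hS]
  constructor
  · rintro ⟨x, h1, h2⟩
    have h1 : x = S.a (iot S y) (iot S y) := h1
    rw [h1] at h2; exact h2
  · intro h; exact ⟨_, rfl, h⟩
theorem Qf_sat (y : ℕ) (ρ : ℕ → M) :
    (Qf (FF B) y).sat S ρ ↔ FS B S (iot S (FF B).code) (iot S (2 * y + 1)) := by
  simp only [Qf, AFml.sat, ATerm.tv, numeral_tv, Hf_sat]
  constructor
  · rintro ⟨x, h1, h2⟩
    have h1 : x = iot S (2 * y + 1) := h1
    rw [h1] at h2; exact h2
  · intro h; exact ⟨_, rfl, h⟩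

/-! ### absoluteness and the least event -/
theorem abs_EV (hS : Models S PA) (s g : ℕ) : EV B S (iot S s) (iot S g) ↔ EV B natStr s g := by
  rw [← EVf_sat, ← EVf_sat]; exact abs_lenv hS (EVf_delta0 B) [s, g]
theorem abs_Ev (hS : Models S PA) (k s g : ℕ) : Ev B S (iot S k) (iot S s) (iot S g) ↔ Ev B natStr k s g := by
  rw [← Evf_sat, ← Evf_sat]; exact abs_lenv hS (Evf_delta0 B) [k, s, g]
theorem abs_X (hS : Models S PA) (k s x g : ℕ) :
    X B S (iot S k) (iot S s) (iot S x) (iot S g) ↔ X B natStr k s x g := by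
  rw [← Xf_sat, ← Xf_sat]; exact abs_lenv hS (Xf_delta0 B) [k, s, x, g]

def Least (s g : M) : Prop := EV B S s g ∧ ∀ u, EV B S u g → S.le s u

theorem exists_least (hS : Models S PA) (g : M) (h : ∃ z, B.dl.sat S (lenv S [z])) :
    ∃ s, Least B (S := S) s g := by
  obtain ⟨z, hz⟩ := h
  obtain ⟨b, h1, h2⟩ := pa_lnp hS (EVf B) (lenv S [g]) z (by
    rw [consM_lenv, EVf_sat]; exact Or.inl hz)
  rw [consM_lenv, EVf_sat] at h1
  refine ⟨b, h1, fun u hu => h2 u ?_⟩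
  rw [consM_lenv, EVf_sat]; exact hu

theorem FS_iff (hS : Models S PA) {s g : M} (hs : Least B (S := S) s g) (x : M) :
    FS B S g x ↔ B.dl.sat S (lenv S [s]) ∨ ∃ k, S.le k s ∧ Ev B S k s g ∧ X B S k s x g := by
  constructor
  · rintro ⟨u, h1, h2⟩
    have hus : S.le u s := by
      rcases pa_le_total hS u s with h | h
      · exact h
      · rcases h1 s h with h | h
        · exact h
        · exact absurd hs.1 h
    rcases h2 with ⟨⟨hx, z, hz, ha⟩, _⟩ | h2
    · rcases hs.1 with h | ⟨k, hk, h⟩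
      · exact Or.inl h
      · exact Or.inr ⟨k, hk, h, h.2.2 x (pa_le_trans hS hx hus) ⟨z, pa_le_trans hS hz hus, ha⟩⟩
    · have hu : EV B S u g := by
        rcases h2 with h | ⟨k, hk, h, _⟩
        · exact Or.inl h
        · exact Or.inr ⟨k, hk, h⟩
      have e : u = s := pa_le_antisymm hS hus (hs.2 u hu)
      rw [← e]; exact h2
  · intro h
    refine ⟨s, fun u hu => ?_, Or.inr h⟩
    by_cases he : EV B S u g
    · exact Or.inl (hs.2 u he)
    · exact Or.inr he

end Part11

section Part12

/-! ## Part 9: the main argument -/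

structure BaseOK (Tax : Set AFml) (m n : ℕ) (B : Base) : Prop where
  ha : ∀ g x, AA Tax m n g x ↔ ∃ z, B.a.sat natStr (lenv natStr [z, g, x])
  he : ∀ g k, EE Tax m n g k ↔ ∃ z, B.e.sat natStr (lenv natStr [z, g, k])
  hp : ∀ g x b, relB m n g x b = true ↔ ∃ z, B.rp.sat natStr (lenv natStr [z, g, x, b])
  hq : ∀ g x b, relB m n g x b = false ↔ ∃ z, B.rm.sat natStr (lenv natStr [z, g, x, b])
  hd : ∀ (M : Type) (S : AStr M), Models S Tax → ∃ z, B.dl.sat S (lenv S [z])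
  hd0 : ∀ z, ¬ B.dl.sat natStr (lenv natStr [z])

theorem Sat_cons_lenv (φ : AFml) (z : ℕ) (l : List ℕ) :
    φ.Sat (consEnv z (lenv natStr l)) ↔ φ.sat natStr (lenv natStr (z :: l)) := by
  rw [← nat_sat, ← nat_cons, consM_lenv]

theorem exists_base {Tax : Set AFml} (hext : PA ⊆ Tax) (hpr : PrAxiomatized Tax)
    (hill : ¬ Sigma1Sound Tax) (m n : ℕ) : ∃ B, BaseOK Tax m n B := by
  obtain ⟨a, a0, a1, ha⟩ := (AA_re hpr m n).extract2
  obtain ⟨e, e0, e1, he⟩ := (EE_re hpr m n).extract2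
  obtain ⟨p, p0, p1, hp⟩ := (RE.ofPrim (relB_prim m n)).extract3 (R := fun g x b => relB m n g x b = true)
  obtain ⟨q, q0, q1, hq⟩ := ((RE.ofPrim (pr_not (relB_prim m n))).congr
    (Q := fun p : ℕ × ℕ × ℕ => relB m n p.1 p.2.1 p.2.2 = false) (by simp)).extract3
    (R := fun g x b => relB m n g x b = false)
  obtain ⟨d, d0, d1, hd, hd0⟩ := ill_delta hext hill
  refine ⟨⟨a, e, p, q, d, a0, e0, p0, q0, d0, a1, e1, p1, q1, d1⟩, ?_, ?_, ?_, ?_, ?_, ?_⟩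
  · intro g x
    have := ha (lenv natStr [g, x])
    simp only [Sat_cons_lenv] at this; exact this
  · intro g x
    have := he (lenv natStr [g, x])
    simp only [Sat_cons_lenv] at this; exact this
  · intro g x b
    have := hp (lenv natStr [g, x, b])
    simp only [Sat_cons_lenv] at this; exact this
  · intro g x b
    have := hq (lenv natStr [g, x, b])
    simp only [Sat_cons_lenv] at this; exact this
  · intro M S hS
    obtain ⟨z, hz⟩ := hd M S hS (lenv S [])
    rw [consM_lenv] at hz
    exact ⟨z, hz⟩
  · intro z hz
    rw [← Sat_cons_lenv] at hz
    exact hd0 _ _ hz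

section
variable {Tax : Set AFml} {m n : ℕ} {B : Base}

theorem nat_tau (k b : ℕ) : tauF.sat natStr (lenv natStr [k, b]) ↔ tauB k b = true := by
  rw [nat_sat, tauF_sat]; rfl
theorem nat_pi (s k : ℕ) : piF.sat natStr (lenv natStr [s, k]) ↔ ∃ j, s = Nat.pair k j := by
  rw [nat_sat, piF_sat]; rfl

theorem X_of_good (hB : BaseOK Tax m n B) {k s x g : ℕ} (h : good m n g k x = true) :
    X B natStr k s x g := by
  rw [good_iff] at h
  refine ⟨by rw [nat_tau, h.1]; simp, fun b hb hr => ?_⟩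
  obtain ⟨z, _, h1, _⟩ := hr
  rw [nat_tau, h.2 b hb ((hB.hp _ _ _).2 ⟨z, h1⟩)]; simp

theorem models_pa (hext : PA ⊆ Tax) {M : Type} {S : AStr M} (hS : Models S Tax) : Models S PA :=
  fun ψ hψ => hS ψ (hext hψ)

/-- there is no event in the standard model -/
theorem noEvent (hext : PA ⊆ Tax) (hcons : ¬ Proves Tax botFml) (hB : BaseOK Tax m n B) (s : ℕ) :
    ¬ EV B natStr s (FF B).code := by
  intro hs
  classical
  have hex : ∃ s, EV B natStr s (FF B).code := ⟨s, hs⟩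
  let s0 := Nat.find hex
  have hs0 : EV B natStr s0 (FF B).code := Nat.find_spec hex
  have hmin : ∀ i, EV B natStr i (FF B).code → s0 ≤ i := fun i hi => Nat.find_min' hex hi
  rcases id hs0 with h | ⟨k, hk, hev⟩
  · exact hB.hd0 _ h
  obtain ⟨j, hj⟩ := (nat_pi _ _).1 hev.1
  obtain ⟨z, _, hz⟩ := hev.2.1
  obtain ⟨χ, hχ, hc⟩ := (hB.he _ _).2 ⟨z, hz⟩
  have main : ∀ (M : Type) (S : AStr M), Models S Tax → ∀ x : ℕ,
      FS B S (iot S (FF B).code) (iot S x) ↔ X B natStr k s0 x (FF B).code := by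
    intro M S hT x
    have hS := models_pa hext hT
    have hl : Least B (S := S) (iot S s0) (iot S (FF B).code) := by
      refine ⟨(abs_EV B hS _ _).2 hs0, fun u hu => ?_⟩
      rcases pa_le_total hS (iot S s0) u with h | h
      · exact h
      · obtain ⟨i, _, rfl⟩ := le_iot hS h
        exact iot_le hS (hmin i ((abs_EV B hS _ _).1 hu))
    rw [FS_iff B hS hl]
    constructor
    · rintro (h | ⟨k', hk', h1, h2⟩)
      · exact absurd ((abs_lenv hS B.dl0 [s0]).1 h) (hB.hd0 _)
      · obtain ⟨k1, _, rfl⟩ := le_iot hS hk'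
        rw [abs_Ev B hS] at h1
        rw [abs_X B hS] at h2
        obtain ⟨j1, hj1⟩ := (nat_pi _ _).1 h1.1
        rw [hj, Nat.pair_eq_pair] at hj1
        rw [hj1.1]; exact h2
    · intro h
      exact Or.inr ⟨iot S k, iot_le hS hk, (abs_Ev B hS _ _ _).2 hev, (abs_X B hS _ _ _ _).2 h⟩
  have hbad : ∀ x, tauB k x = true → ¬ X B natStr k s0 x (FF B).code :=
    fun x hx h => h.1 ((nat_tau _ _).2 hx)
  obtain ⟨φ, h1, h2⟩ := cert_sound (Tax := Tax) hext (F := FF B) (m := m) (n := n) (k := k)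
    (fun y hy => completeness fun M S hS ρ h => hbad _ hy
      ((main M S hS _).1 ((PfN_sat B (models_pa hext hS) _ _).1 h)))
    (fun y hy => completeness fun M S hS ρ => (PfN_sat B (models_pa hext hS) _ _).2
      ((main M S hS _).2 (X_of_good hB hy)))
    (fun y hy => completeness fun M S hS ρ h => hbad _ hy
      ((main M S hS _).1 ((Qf_sat B _ _).1 h)))
    (fun y hy => completeness fun M S hS ρ => (Qf_sat B _ _).2
      ((main M S hS _).2 (X_of_good hB hy))) hc
  rcases h2 with ⟨h, _⟩ | ⟨_, h⟩
  · exact absurd h (by simp)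
  · have h1 : χ = φ.code := h1
    rw [h1, prvC_code] at hχ
    refine hcons (prov_of_list [φ, .neg φ] ?_ _ ?_)
    · intro ψ hψ
      rcases List.mem_pair.1 hψ with rfl | rfl
      · exact hχ
      · exact h
    · intro v hv
      exact absurd (hv φ (by simp)) (hv (.neg φ) (by simp))

theorem NA_of_list (l : List MFml) (hl : ∀ ψ ∈ l, NAProves m n ψ) (A : MFml)
    (h : ∀ v, (∀ ψ ∈ l, ψ.evalTC v) → A.evalTC v) : NAProves m n A := by
  induction l generalizing A with
  | nil => exact .taut fun v => h v (by simp)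
  | cons ψ l ih =>
    refine .mp (ih (fun χ hχ => hl χ (List.mem_cons_of_mem _ hχ)) (.imp ψ A) ?_) (hl ψ (by simp))
    intro v hv hψ
    refine h v fun χ hχ => ?_
    rcases List.mem_cons.1 hχ with rfl | hχ
    · exact hψ
    · exact hv χ hχ

theorem NA_complete {A : MFml} (h : ¬ NAProves m n A) :
    ∃ v, (∀ C, NAProves m n C → C.evalTC v) ∧ ¬ A.evalTC v := by
  classical
  obtain ⟨v, hv⟩ := compactM ({C | NAProves m n C} ∪ {.neg A}) (by
    intro s
    by_contra hc
    push Not at hc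
    refine h (NA_of_list (s.toList.filter (fun C => decide (NAProves m n C))) ?_ A ?_)
    · intro ψ hψ
      simpa using (List.mem_filter.1 hψ).2
    · intro v hv
      by_contra hA
      obtain ⟨ψ, h1, h2, h3⟩ := hc v
      rcases h2 with h2 | rfl
      · exact h3 (hv ψ (List.mem_filter.2 ⟨by simpa using h1, by simpa using h2⟩))
      · exact h3 hA)
  exact ⟨v, fun C hC => hv C (Or.inl hC), hv (.neg A) (Or.inr rfl)⟩

theorem boxIter_add (a b : ℕ) (A : MFml) : boxIter (a + b) A = boxIter a (boxIter b A) := by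
  induction a with
  | zero => rw [Nat.zero_add]; rfl
  | succ a ih => rw [Nat.succ_add, boxIter, boxIter, ih]

theorem completeArith (hm : 1 ≤ m) (hmn : m < n) (hext : PA ⊆ Tax) (hcons : ¬ Proves Tax botFml)
    (hB : BaseOK Tax m n B) {A : MFml} (hA : Proves Tax (itp (FF B) A)) : NAProves m n A := by
  by_contra hna
  obtain ⟨v, hv, hvA⟩ := NA_complete hna
  have hbox : ∀ C, NAProves m n C → v (.box C) := fun C hC => hv _ (.nec hC)
  have hacc : ∀ (i : ℕ) (D : MFml), v (.box (boxIter (i * (n - m) + (m - 1)) D)) →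
      v (.box (boxIter (m - 1) D)) := by
    intro i
    induction i with
    | zero => intro D h; rw [Nat.zero_mul, Nat.zero_add] at h; exact h
    | succ i ih =>
      intro D h
      refine ih D ?_
      have h1 := hv _ (.acc (boxIter (i * (n - m)) D))
      have e1 : ∀ k, 1 ≤ k → boxIter k (boxIter (i * (n - m)) D) =
          .box (boxIter (i * (n - m) + (k - 1)) D) := by
        intro k hk
        rw [← boxIter_add]
        have : k + i * (n - m) = (i * (n - m) + (k - 1)) + 1 := by omega
        rw [this]; rfl
      rw [e1 n (by omega), e1 m hm] at h1
      refine h1 ?_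
      have : (i + 1) * (n - m) + (m - 1) = i * (n - m) + (n - 1) := by
        rw [Nat.succ_mul]; omega
      rw [this] at h; exact h
  let p : ℕ → Prop := fun b => (∃ C, b = 2 * (itp (FF B) C).code ∧ ¬ v (.box C)) ∨
    (∃ i, b = 2 * i + 1 ∧ ¬ v (.var i))
  obtain ⟨N, hN⟩ : ∃ N, N = 2 * (itp (FF B) A).code + 1 := ⟨_, rfl⟩
  obtain ⟨k, hk⟩ := exists_table N p
  have prel : ∀ x b, relP m n (FF B).code x b → p b → p x := by
    rintro x b ⟨y, i, hb, hx⟩ (⟨C, h1, h2⟩ | ⟨j, h1, _⟩)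
    · obtain ⟨D, rfl, rfl⟩ := Appn_itp (F := FF B) (k := m - 1) (y := y) (C := C) (by omega)
      rw [← itp_boxIter] at hx
      exact Or.inl ⟨_, hx, fun h => h2 (hacc i D h)⟩
    · omega
  have pgood : ∀ x, ¬ p x → good m n (FF B).code k x = true := by
    intro x hx
    have ht : ∀ b, ¬ p b → tauB k b = false := fun b hb => by
      rw [← Bool.not_eq_true, hk]; exact fun h => hb h.2
    rw [good_iff]
    refine ⟨ht x hx, fun b _ hr => ht b fun hb => hx (prel x b ((relB_iff hmn _ _ _).1 hr) hb)⟩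
  have hcert := (cert_of_val (F := FF B) (m := m) (n := n) (k := k) v N ?_ ?_ A (by omega)).2 hvA
  · obtain ⟨z, hz⟩ := (hB.he _ _).1 ⟨_, (prvC_code _).2 hA, hcert⟩
    refine noEvent hext hcons hB (Nat.pair k z) (Or.inr ⟨k, Nat.left_le_pair _ _, (nat_pi _ _).2 ⟨z, rfl⟩,
      ⟨z, Nat.right_le_pair _ _, hz⟩, ?_⟩)
    rintro x _ ⟨z', _, hz'⟩
    refine X_of_good hB (pgood x ?_)
    obtain ⟨he, ha⟩ := (hB.ha _ _).2 ⟨z', hz'⟩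
    rintro (⟨C, h1, h2⟩ | ⟨i, h1, _⟩)
    · have hx : x / 2 = (itp (FF B) C).code := by omega
      rw [hx] at ha
      rcases ha with h | ⟨_, h⟩
      · obtain ⟨C', e, h⟩ := (LF_iff hm _ _).1 h
        rw [itp_inj (AFml.code_inj e)] at h2
        exact h2 (hbox _ h)
      · rw [(rf_iff (FF B) _).2 ⟨C, rfl⟩] at h
        exact absurd h (by simp)
    · omega
  · intro i hi
    constructor
    · intro h
      refine pgood _ ?_
      rintro (⟨C, h1, _⟩ | ⟨j, h1, h2⟩)
      · omega
      · obtain rfl : i = j := by omega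
        exact h2 h
    · intro h
      exact (hk _).2 ⟨hi, Or.inr ⟨i, rfl, h⟩⟩
  · intro C hC
    constructor
    · intro h
      refine pgood _ ?_
      rintro (⟨D, h1, h2⟩ | ⟨j, h1, h2⟩)
      · have e : (itp (FF B) C).code = (itp (FF B) D).code := by omega
        rw [← itp_inj (AFml.code_inj e)] at h2
        exact h2 h
      · omega
    · intro h
      exact (hk _).2 ⟨hC, Or.inl ⟨C, rfl, h⟩⟩

theorem accArith (hmn : m < n) (hext : PA ⊆ Tax) (hcons : ¬ Proves Tax botFml)
    (hB : BaseOK Tax m n B) {x b : ℕ} (hr : relP m n (FF B).code x b) {M : Type} {S : AStr M}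
    (hT : Models S Tax) (hF : FS B S (iot S (FF B).code) (iot S x)) :
    FS B S (iot S (FF B).code) (iot S b) := by
  have hS := models_pa hext hT
  generalize hg : (FF B).code = g at *
  have hno : ∀ s, ¬ EV B natStr s g := by
    intro s; rw [← hg]; exact noEvent hext hcons hB s
  obtain ⟨s, hs⟩ := exists_least B hS (iot S g) (hB.hd M S hT)
  rw [FS_iff B hS hs] at hF ⊢
  have hbig : ∀ i, S.le (iot S i) s := by
    intro i
    rcases std_or hS s i with ⟨j, rfl⟩ | h
    · exact absurd ((abs_EV B hS _ _).1 hs.1) (hno j)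
    · exact h
  have hRM : ∀ x b : ℕ, RM B S s (iot S x) (iot S b) (iot S g) ↔ relP m n g x b := by
    intro x b
    rw [← relB_iff hmn]
    constructor
    · rintro ⟨z, _, h1, h2⟩
      by_contra hc
      rw [Bool.not_eq_true] at hc
      obtain ⟨w, hw⟩ := (hB.hq _ _ _).1 hc
      rw [← abs_lenv hS B.rm0] at hw
      rcases pa_le_total hS (iot S w) z with h | h
      · exact h2 _ h hw
      · obtain ⟨i, _, rfl⟩ := le_iot hS h
        have h1 := (abs_lenv hS B.rp0 [i, g, x, b]).1 h1
        rw [(hB.hp _ _ _).2 ⟨i, h1⟩] at hc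
        exact absurd hc (by simp)
    · intro h
      obtain ⟨z, hz⟩ := (hB.hp _ _ _).1 h
      refine ⟨iot S z, hbig z, (abs_lenv hS B.rp0 [z, g, x, b]).2 hz, ?_⟩
      intro w hw hc
      obtain ⟨i, _, rfl⟩ := le_iot hS hw
      have hc := (abs_lenv hS B.rm0 [i, g, x, b]).1 hc
      rw [(hB.hq _ _ _).2 ⟨i, hc⟩] at h
      exact absurd h (by simp)
  rcases hF with h | ⟨k, hk, h1, h2⟩
  · exact Or.inl h
  · refine Or.inr ⟨k, hk, h1, ?_, ?_⟩
    · exact h2.2 _ (iot_le hS (relP_le hr)) ((hRM _ _).2 hr)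
    · intro b' hb' hr'
      obtain ⟨c, hc, rfl⟩ := le_iot hS hb'
      have h3 := relP_trans hr ((hRM _ _).1 hr')
      exact h2.2 _ (iot_le hS (relP_le h3)) ((hRM _ _).2 h3)

theorem nat_iot (k : ℕ) : iot natStr k = k := by
  induction k with
  | zero => rfl
  | succ k ih => rw [iot, ih]; rfl

theorem trueN_PfN (hext : PA ⊆ Tax) (hcons : ¬ Proves Tax botFml)
    (hB : BaseOK Tax m n B) (y : ℕ) : TrueN (PfN (FF B) y) ↔ AA Tax m n (FF B).code (2 * y) := by
  rw [TrueN, ← nat_sat, PfN_sat B nat_models, nat_iot, nat_iot]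
  constructor
  · rintro ⟨s, _, h⟩
    rcases h with ⟨⟨_, z, _, hz⟩, _⟩ | h | ⟨k, hk, h, _⟩
    · exact (hB.ha _ _).2 ⟨z, hz⟩
    · exact absurd h (hB.hd0 _)
    · exact absurd (Or.inr ⟨k, hk, h⟩) (noEvent hext hcons hB s)
  · intro h
    obtain ⟨z, hz⟩ := (hB.ha _ _).1 h
    exact ⟨max (2 * y) z, fun u _ => Or.inr (noEvent hext hcons hB u), Or.inl ⟨⟨le_max_left _ _, z,
      le_max_right _ _, hz⟩, noEvent hext hcons hB _⟩⟩

theorem PfN_sigma1 (y : ℕ) : IsSigma1 (PfN (FF B) y) :=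
  .ex (.and (.delta0 (.eq _ _)) (.ex (.and (.delta0 (.eq _ _)) (.ex (.delta0 (F0_delta0 B))))))

theorem Proves.mono {Γ Δ : Set AFml} (h : Γ ⊆ Δ) {φ : AFml} (hp : Proves Γ φ) : Proves Δ φ :=
  completeness fun _ S hS ρ => soundness S hp (fun ψ hψ => hS ψ (h hψ)) ρ

theorem necArith (hm : 1 ≤ m) (hmn : m < n) (hext : PA ⊆ Tax) (hcons : ¬ Proves Tax botFml)
    (hB : BaseOK Tax m n B) {φ : AFml} (h : Proves Tax φ) : Proves PA (PfN (FF B) φ.code) := by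
  refine sigma1_complete (PfN_sigma1 _) ((trueN_PfN hext hcons hB _).2 ⟨by omega, ?_⟩)
    (PfN_freeLt (FF_freeLt B) _)
  rw [Nat.mul_div_cancel_left _ (by omega)]
  by_cases hr : rf (FF B).code φ.code = true
  · obtain ⟨A, hA⟩ := (rf_iff _ _).1 hr
    rw [AFml.code_inj hA] at h
    exact Or.inl ((LF_iff hm _ _).2 ⟨A, hA, completeArith hm hmn hext hcons hB h⟩)
  · exact Or.inr ⟨(prvC_code _).2 h, by simpa using hr⟩

theorem soundArith (hm : 1 ≤ m) (hmn : m < n) (hext : PA ⊆ Tax) (hcons : ¬ Proves Tax botFml)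
    (hB : BaseOK Tax m n B) {A : MFml} {f : MFml → AFml} (hf : IsInterp (Pf (FF B)) f)
    (h : NAProves m n A) : Proves Tax (f A) := by
  obtain ⟨_, f1, f2, f3, f4, f5, f6⟩ := hf
  simp only [Pf_appNum (FF_freeLt B)] at f6
  induction h with
  | @taut A h =>
    have hbot : Proves Tax (.neg botFml) := completeness fun M S hS ρ h => by
      have := iot_inj (models_pa hext hS) (a := 0) (b := 1) h
      omega
    refine prov_of_list [.neg botFml] (by simpa using hbot) _ ?_
    intro w hw
    have hw : ¬ w botFml := hw (.neg botFml) (by simp)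
    have key : ∀ C : MFml, (f C).evalProp w ↔ C.evalTC (fun D => (f D).evalProp w) := by
      intro C
      induction C with
      | var i => exact Iff.rfl
      | bot => rw [f1]; exact iff_of_false hw (fun h => h)
      | neg A ih => rw [f2]; exact not_congr ih
      | and A B i1 i2 => rw [f3]; exact and_congr i1 i2
      | or A B i1 i2 => rw [f4]; exact or_congr i1 i2
      | imp A B i1 i2 => rw [f5]; exact imp_congr i1 i2
      | box A => exact Iff.rfl
    exact (key A).2 (h _)
  | acc A =>
    have e : ∀ k, f (boxIter (k + 1) A) = PfN (FF B) (Appn (FF B).code k (f A).code) := by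
      intro k
      induction k with
      | zero => exact f6 A
      | succ k ih => rw [boxIter, f6, ih, PfN_code]; rfl
    rw [f5, show n = (n - 1) + 1 by omega, show m = (m - 1) + 1 by omega, e, e]
    refine completeness fun M S hS ρ h => ?_
    rw [PfN_sat B (models_pa hext hS)] at h ⊢
    refine accArith hmn hext hcons hB ⟨(f A).code, 1, rfl, ?_⟩ hS h
    rw [show 1 * (n - m) + (m - 1) = n - 1 by omega]
  | mp _ _ i1 i2 => rw [f5] at i1; exact .mp i1 i2
  | nec _ ih => rw [f6]; exact Proves.mono hext (necArith hm hmn hext hcons hB ih)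
  | ros h _ => exact absurd trivial (NA_allTrue hm h)
end

theorem mainThm (Tax : Set AFml) (hext : PA ⊆ Tax)
    (hcons : ¬ Proves Tax botFml) (hpr : PrAxiomatized Tax)
    (hill : ¬ Sigma1Sound Tax)
    (m n : ℕ) (hm : 1 ≤ m) (hmn : m < n) :
    ∃ P : AFml, IsSigma1 P ∧ IsProvPred Tax P ∧
      (∀ (A : MFml) (f : MFml → AFml), IsInterp P f → NAProves m n A → Proves Tax (f A)) ∧
      (∃ f : MFml → AFml, IsInterp P f ∧ ∀ A : MFml, NAProves m n A ↔ Proves Tax (f A)) := by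
  obtain ⟨B, hB⟩ := exists_base hext hpr hill m n
  have hs : ∀ (A : MFml) (f : MFml → AFml), IsInterp (Pf (FF B)) f → NAProves m n A → Proves Tax (f A) :=
    fun A f hf h => soundArith hm hmn hext hcons hB hf h
  have hi := itp_isInterp (FF_freeLt B)
  refine ⟨Pf (FF B), Pf_sigma1 B, ⟨Pf_freeLt (FF_freeLt B), fun φ => ?_⟩, hs, itp (FF B), hi,
    fun A => ⟨hs A _ hi, completeArith hm hmn hext hcons hB⟩⟩
  rw [Pf_appNum (FF_freeLt B)]
  refine ⟨necArith hm hmn hext hcons hB, fun h => ?_⟩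
  have h1 : TrueN (PfN (FF B) φ.code) := (nat_sat _ _).1 (soundness natStr h nat_models _)
  obtain ⟨_, h2⟩ := (trueN_PfN hext hcons hB _).1 h1
  rw [Nat.mul_div_cancel_left _ (by omega)] at h2
  rcases h2 with h2 | ⟨h2, _⟩
  · obtain ⟨A, e, h3⟩ := (LF_iff hm _ _).1 h2
    rw [AFml.code_inj e]
    exact hs A _ hi h3
  · exact (prvC_code _).1 h2

end Part12

/-- Theorem 4.6: Suppose `T` is `Σ₁`-ill and `n > m ≥ 1`. Then
there is a `Σ₁` provability predicate `PR_T(x)` of `T` such that (1) `N⁺A_{m,n}` is sound for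
every arithmetical interpretation based on `PR_T(x)`, and (2) some arithmetical interpretation
based on `PR_T(x)` is exact for `N⁺A_{m,n}`. -/
theorem statement_10 (Tax : Set AFml) (hext : PA ⊆ Tax)
    (hcons : ¬ Proves Tax botFml) (hpr : PrAxiomatized Tax)
    (hill : ¬ Sigma1Sound Tax)
    (m n : ℕ) (hm : 1 ≤ m) (hmn : m < n) :
    ∃ P : AFml, IsSigma1 P ∧ IsProvPred Tax P ∧
      (∀ (A : MFml) (f : MFml → AFml), IsInterp P f → NAProves m n A → Proves Tax (f A)) ∧
      (∃ f : MFml → AFml, IsInterp P f ∧ ∀ A : MFml, NAProves m n A ↔ Proves Tax (f A)) := by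
  exact mainThm Tax hext hcons hpr hill m n hm hmn

end PLN
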